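/- There exists an absolute constant c > 0 with the following property. For every q ∈ (0, c) and every ε > 0 there exist C_q > 0 and n₀ ∈ ℕ (depending only on q and ε) such that for every n ≥ n₀ and every p ∈ (q, c), the n×n Bernoulli(p) random matrix M_n satisfies |P{M_n is singular} − 2n(1−p)ⁿ| ≤ ε·n(1−p)ⁿ, and for every t > 0, P{s_min(M_n) ≤ C_q·n^{−5/2}·t} ≤ t + (2+ε)·n(1−p)ⁿ. -/

import Mathlib

open MeasureTheory

/-- Euclidean norm of a vector in `ℝⁿ`. -/
noncomputable def eNorm {n : ℕ} (x : Fin n → ℝ) : ℝ := Real.sqrt (∑ i, (x i) ^ 2)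

/-- Smallest singular value of an `n × n` real matrix. -/
noncomputable def sMin {n : ℕ} (A : Matrix (Fin n) (Fin n) ℝ) : ℝ :=
  sInf {r | ∃ x : Fin n → ℝ, eNorm x = 1 ∧ r = eNorm (A.mulVec x)}

/-- `M` is a random `n × n` matrix with i.i.d. Bernoulli(p) entries. -/
def IsBernoulliMatrix {Ω : Type*} [MeasurableSpace Ω] (μ : Measure Ω) {n : ℕ}
    (M : Ω → Matrix (Fin n) (Fin n) ℝ) (p : ℝ) : Prop :=
  (∀ ω i j, M ω i j = 0 ∨ M ω i j = 1) ∧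
  ∀ A : Matrix (Fin n) (Fin n) ℝ, (∀ i j, A i j = 0 ∨ A i j = 1) →
    μ {ω | M ω = A} =
      ENNReal.ofReal
        (p ^ (Finset.univ.filter (fun ij : Fin n × Fin n => A ij.1 ij.2 = 1)).card *
          (1 - p) ^ (Finset.univ.filter (fun ij : Fin n × Fin n => A ij.1 ij.2 = 0)).card)

set_option linter.unusedSectionVars false
set_option linter.unusedVariables false

section SCPall
open Finset

namespace SCP

section Framework
variable {κ α : Type*} [Fintype κ] [DecidableEq κ] [Fintype α]

/-- product weight -/
noncomputable def pw (w : κ → α → ℝ) (f : κ → α) : ℝ := ∏ i, w i (f i)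

/-- weighted sum (expectation) -/
noncomputable def EE (w : κ → α → ℝ) (F : (κ → α) → ℝ) : ℝ := ∑ f, pw w f * F f

open Classical in
/-- indicator -/
noncomputable def ind (P : Prop) : ℝ := if P then 1 else 0

/-- probability -/
noncomputable def PP (w : κ → α → ℝ) (S : (κ → α) → Prop) : ℝ := EE w (fun f => ind (S f))

/-- probability weights -/
def IsW (w : κ → α → ℝ) : Prop := (∀ i a, 0 ≤ w i a) ∧ ∀ i, ∑ a, w i a = 1

theorem ind_true {P : Prop} (h : P) : ind P = 1 := by simp [ind, h]
theorem ind_false {P : Prop} (h : ¬ P) : ind P = 0 := by simp [ind, h]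
theorem ind_nonneg (P : Prop) : 0 ≤ ind P := by unfold ind; split_ifs <;> norm_num
theorem ind_le_one (P : Prop) : ind P ≤ 1 := by unfold ind; split_ifs <;> norm_num
theorem ind_mono {P Q : Prop} (h : P → Q) : ind P ≤ ind Q := by
  by_cases hp : P
  · rw [ind_true hp, ind_true (h hp)]
  · rw [ind_false hp]; exact ind_nonneg _
theorem ind_or (P Q : Prop) : ind (P ∨ Q) ≤ ind P + ind Q := by
  by_cases hp : P <;> by_cases hq : Q <;> simp [ind, hp, hq]
theorem ind_and (P Q : Prop) : ind (P ∧ Q) = ind P * ind Q := by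
  by_cases hp : P <;> by_cases hq : Q <;> simp [ind, hp, hq]
theorem ind_not (P : Prop) : ind (¬ P) = 1 - ind P := by
  by_cases hp : P <;> simp [ind, hp]

theorem pw_nonneg {w : κ → α → ℝ} (hw : IsW w) (f : κ → α) : 0 ≤ pw w f :=
  Finset.prod_nonneg (fun i _ => hw.1 i _)

theorem sum_prod_eq {R : Type*} [CommSemiring R] (h : κ → α → R) :
    ∑ f : κ → α, ∏ i, h i (f i) = ∏ i, ∑ a, h i a := by
  rw [Finset.prod_univ_sum, Fintype.piFinset_univ]

theorem EE_mono {w : κ → α → ℝ} (hw : IsW w) {F G : (κ → α) → ℝ} (h : ∀ f, F f ≤ G f) :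
    EE w F ≤ EE w G :=
  Finset.sum_le_sum (fun f _ => mul_le_mul_of_nonneg_left (h f) (pw_nonneg hw f))

theorem EE_add (w : κ → α → ℝ) (F G : (κ → α) → ℝ) :
    EE w (fun f => F f + G f) = EE w F + EE w G := by
  simp [EE, mul_add, Finset.sum_add_distrib]

theorem EE_sub (w : κ → α → ℝ) (F G : (κ → α) → ℝ) :
    EE w (fun f => F f - G f) = EE w F - EE w G := by
  simp [EE, mul_sub, Finset.sum_sub_distrib]

theorem EE_smul (w : κ → α → ℝ) (c : ℝ) (F : (κ → α) → ℝ) :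
    EE w (fun f => c * F f) = c * EE w F := by
  simp only [EE, Finset.mul_sum]
  exact Finset.sum_congr rfl (fun f _ => by ring)

theorem EE_div (w : κ → α → ℝ) (c : ℝ) (F : (κ → α) → ℝ) :
    EE w (fun f => F f / c) = EE w F / c := by
  simp only [EE, Finset.sum_div]
  exact Finset.sum_congr rfl (fun f _ => by ring)

theorem EE_sum {β : Type*} (w : κ → α → ℝ) (s : Finset β) (F : β → (κ → α) → ℝ) :
    EE w (fun f => ∑ b ∈ s, F b f) = ∑ b ∈ s, EE w (F b) := by
  simp only [EE, Finset.mul_sum]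
  rw [Finset.sum_comm]

theorem EE_prod (w : κ → α → ℝ) (h : κ → α → ℝ) :
    EE w (fun f => ∏ i, h i (f i)) = ∏ i, ∑ a, w i a * h i a := by
  simp only [EE, pw, ← Finset.prod_mul_distrib]
  exact sum_prod_eq (fun i a => w i a * h i a)

theorem EE_one {w : κ → α → ℝ} (hw : IsW w) : EE w (fun _ => 1) = 1 := by
  have := EE_prod w (fun _ _ => 1)
  simpa [hw.2] using this

theorem EE_const {w : κ → α → ℝ} (hw : IsW w) (c : ℝ) : EE w (fun _ => c) = c := by
  have := EE_smul w c (fun _ => 1)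
  simpa [EE_one hw] using this

theorem EE_nonneg {w : κ → α → ℝ} (hw : IsW w) {F : (κ → α) → ℝ} (h : ∀ f, 0 ≤ F f) :
    0 ≤ EE w F := by
  have := EE_mono hw (F := fun _ => 0) h
  rwa [EE_const hw] at this

theorem EE_le_const {w : κ → α → ℝ} (hw : IsW w) {F : (κ → α) → ℝ} {c : ℝ} (h : ∀ f, F f ≤ c) :
    EE w F ≤ c := by
  have := EE_mono hw (G := fun _ => c) h
  rwa [EE_const hw] at this

theorem exists_lt_of_EE_lt {w : κ → α → ℝ} (hw : IsW w) {F : (κ → α) → ℝ} {c : ℝ}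
    (h : EE w F < c) : ∃ f, F f < c := by
  by_contra! hc
  have := EE_mono hw (F := fun _ => c) hc
  rw [EE_const hw] at this
  linarith

theorem EE_coord {w : κ → α → ℝ} (hw : IsW w) (i : κ) (h : α → ℝ) :
    EE w (fun f => h (f i)) = ∑ a, w i a * h a := by
  have := EE_prod w (fun j a => if j = i then h a else 1)
  have h1 : ∀ f : κ → α, ∏ j, (if j = i then h (f j) else 1) = h (f i) := by
    intro f; simp
  simp only [h1] at this
  rw [this, Finset.prod_eq_single i]
  · simp
  · intro j _ hj; simp [hj, hw.2]
  · simp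

theorem EE_coord2 {w : κ → α → ℝ} (hw : IsW w) {i j : κ} (hij : i ≠ j) (h g : α → ℝ) :
    EE w (fun f => h (f i) * g (f j)) = (∑ a, w i a * h a) * (∑ a, w j a * g a) := by
  have := EE_prod w (fun l a => (if l = i then h a else 1) * (if l = j then g a else 1))
  have h1 : ∀ f : κ → α, ∏ l, ((if l = i then h (f l) else 1) * (if l = j then g (f l) else 1))
      = h (f i) * g (f j) := by
    intro f; rw [Finset.prod_mul_distrib]; simp
  simp only [h1] at this
  rw [this]
  have h2 : ∀ l, ∑ a, w l a * ((if l = i then h a else 1) * (if l = j then g a else 1))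
     = (if l = i then ∑ a, w i a * h a else 1) * (if l = j then ∑ a, w j a * g a else 1) := by
    intro l
    by_cases hi : l = i
    · subst hi; simp [hij]
    · by_cases hj : l = j
      · subst hj; simp [hi]
      · simp [hi, hj, hw.2]
  simp only [h2]
  rw [Finset.prod_mul_distrib]; simp

/-- variance of a sum of centred coordinate functions -/
theorem EE_var {w : κ → α → ℝ} (hw : IsW w) (h : κ → α → ℝ) (h0 : ∀ i, ∑ a, w i a * h i a = 0) :
    EE w (fun f => (∑ i, h i (f i)) ^ 2) = ∑ i, ∑ a, w i a * (h i a) ^ 2 := by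
  have h1 : ∀ f : κ → α, (∑ i, h i (f i)) ^ 2 = ∑ i, ∑ j, h i (f i) * h j (f j) := by
    intro f; rw [sq, Finset.sum_mul_sum]
  simp only [h1]
  rw [EE_sum]
  refine Finset.sum_congr rfl (fun i _ => ?_)
  rw [EE_sum, Finset.sum_eq_single i]
  · rw [← EE_coord hw i (fun a => (h i a) ^ 2)]
    congr 1; funext f; ring
  · intro j _ hj
    rw [EE_coord2 hw (Ne.symm hj), h0 i, zero_mul]
  · simp

theorem EE_resample {w : κ → α → ℝ} (hw : IsW w) (i : κ) (F : (κ → α) → ℝ) :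
    EE w F = EE w (fun f => ∑ a, w i a * F (Function.update f i a)) := by
  have key : ∑ x : (κ → α) × α, pw w x.1 * (w i x.2 * F (Function.update x.1 i x.2))
      = ∑ x : (κ → α) × α, pw w x.1 * (w i x.2 * F x.1) := by
    have hinv : Function.Involutive (fun x : (κ → α) × α => (Function.update x.1 i x.2, x.1 i)) := by
      rintro ⟨f, a⟩; simp
    refine Fintype.sum_equiv hinv.toPerm _ _ ?_
    rintro ⟨f, a⟩
    simp only [Function.Involutive.coe_toPerm]
    have : pw w (Function.update f i a) * w i (f i) = pw w f * w i a := by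
      unfold pw
      rw [← Finset.mul_prod_erase _ _ (Finset.mem_univ i),
        ← Finset.mul_prod_erase _ (fun j => w j (f j)) (Finset.mem_univ i)]
      have : ∏ x ∈ univ.erase i, w x (Function.update f i a x) = ∏ x ∈ univ.erase i, w x (f x) := by
        refine Finset.prod_congr rfl (fun x hx => ?_)
        rw [Function.update_of_ne (Finset.ne_of_mem_erase hx)]
      rw [this]; simp; ring
    calc _ = (pw w f * w i a) * F (Function.update f i a) := by ring
      _ = _ := by rw [← this]; ring
  rw [Fintype.sum_prod_type, Fintype.sum_prod_type] at key
  simp only [EE, Finset.mul_sum]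
  rw [key]
  refine Finset.sum_congr rfl (fun f _ => ?_)
  show pw w f * F f = ∑ y, pw w f * (w i y * F f)
  rw [← Finset.mul_sum, ← Finset.sum_mul, hw.2, one_mul]

theorem PP_nonneg {w : κ → α → ℝ} (hw : IsW w) (S : (κ → α) → Prop) : 0 ≤ PP w S :=
  EE_nonneg hw (fun _ => ind_nonneg _)
theorem PP_le_one {w : κ → α → ℝ} (hw : IsW w) (S : (κ → α) → Prop) : PP w S ≤ 1 :=
  EE_le_const hw (fun _ => ind_le_one _)
theorem PP_mono {w : κ → α → ℝ} (hw : IsW w) {S T : (κ → α) → Prop} (h : ∀ f, S f → T f) :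
    PP w S ≤ PP w T := EE_mono hw (fun f => ind_mono (h f))
theorem PP_or {w : κ → α → ℝ} (hw : IsW w) (S T : (κ → α) → Prop) :
    PP w (fun f => S f ∨ T f) ≤ PP w S + PP w T := by
  unfold PP; rw [← EE_add]; exact EE_mono hw (fun f => ind_or _ _)

theorem ind_exists_le {β : Type*} (s : Finset β) (S : β → Prop) :
    ind (∃ b ∈ s, S b) ≤ ∑ b ∈ s, ind (S b) := by
  by_cases h : ∃ b ∈ s, S b
  · rw [ind_true h]
    obtain ⟨b, hb, hS⟩ := h
    calc (1:ℝ) = ind (S b) := (ind_true hS).symm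
      _ ≤ _ := Finset.single_le_sum (f := fun b => ind (S b)) (fun _ _ => ind_nonneg _) hb
  · rw [ind_false h]; exact Finset.sum_nonneg (fun _ _ => ind_nonneg _)

theorem PP_exists {β : Type*} {w : κ → α → ℝ} (hw : IsW w) (s : Finset β)
    (S : β → (κ → α) → Prop) :
    PP w (fun f => ∃ b ∈ s, S b f) ≤ ∑ b ∈ s, PP w (S b) := by
  unfold PP; rw [← EE_sum]; exact EE_mono hw (fun f => ind_exists_le _ _)

theorem PP_markov {w : κ → α → ℝ} (hw : IsW w) {F : (κ → α) → ℝ} (hF : ∀ f, 0 ≤ F f) {c : ℝ}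
    (hc : 0 < c) : PP w (fun f => c ≤ F f) ≤ EE w F / c := by
  rw [le_div_iff₀ hc, mul_comm]
  unfold PP; rw [← EE_smul]
  refine EE_mono hw (fun f => ?_)
  by_cases h : c ≤ F f
  · rw [ind_true h]; linarith
  · rw [ind_false h]; simpa using hF f

end Framework

section Bern
/-- Bernoulli weight -/
noncomputable def bw (p : ℝ) (b : Bool) : ℝ := if b then p else 1 - p

theorem sum_bw (p : ℝ) (h : Bool → ℝ) : ∑ a, bw p a * h a = p * h true + (1 - p) * h false := by
  simp [bw]

theorem sum_bw_complex (p : ℝ) (h : Bool → ℂ) :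
    ∑ a, (bw p a : ℂ) * h a = p * h true + (1 - p) * h false := by
  simp [bw]

theorem isW_bw {κ : Type*} {p : κ → ℝ} (h0 : ∀ i, 0 ≤ p i) (h1 : ∀ i, p i ≤ 1) :
    IsW (fun i => bw (p i)) := by
  constructor
  · intro i a
    have := h0 i; have := h1 i
    cases a <;> simp [bw] <;> linarith
  · intro i; simp [bw]

/-- linear form -/
noncomputable def XX {ι : Type*} [Fintype ι] (Y : ι → ℝ) (C : ι → Bool) : ℝ :=
  ∑ i, (if C i then Y i else 0)

/-- weights on columns -/
noncomputable abbrev wv (ι : Type*) (p : ℝ) : ι → Bool → ℝ := fun _ => bw p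

/-- weights on matrices (families of columns) -/
noncomputable abbrev wm (κ ι : Type*) [Fintype ι] (p : ℝ) : κ → (ι → Bool) → ℝ :=
  fun _ => pw (wv ι p)

theorem isW_wv {ι : Type*} {p : ℝ} (h0 : 0 ≤ p) (h1 : p ≤ 1) : IsW (wv ι p) :=
  isW_bw (fun _ => h0) (fun _ => h1)

theorem isW_wm {κ ι : Type*} [Fintype ι] [DecidableEq ι] {p : ℝ} (h0 : 0 ≤ p) (h1 : p ≤ 1) :
    IsW (wm κ ι p) := by
  constructor
  · intro i a; exact pw_nonneg (isW_wv h0 h1) a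
  · intro i
    have := EE_one (isW_wv (ι := ι) h0 h1)
    simpa [EE] using this
end Bern
end SCP

namespace SCP

/-- e^{i x} -/
noncomputable def cx (x : ℝ) : ℂ := Complex.exp (x * Complex.I)

theorem cx_norm (x : ℝ) : ‖cx x‖ = 1 := Complex.norm_exp_ofReal_mul_I x
theorem cx_add (x y : ℝ) : cx (x + y) = cx x * cx y := by
  unfold cx; rw [← Complex.exp_add]; push_cast; ring_nf
theorem cx_zero : cx 0 = 1 := by simp [cx]
theorem cx_re (x : ℝ) : (cx x).re = Real.cos x := Complex.exp_ofReal_mul_I_re x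
theorem cx_im (x : ℝ) : (cx x).im = Real.sin x := Complex.exp_ofReal_mul_I_im x
theorem cx_sum {β : Type*} (s : Finset β) (h : β → ℝ) : cx (∑ b ∈ s, h b) = ∏ b ∈ s, cx (h b) := by
  unfold cx; rw [← Complex.exp_sum]; push_cast; rw [Finset.sum_mul]
theorem cx_conj (x : ℝ) : (starRingEnd ℂ) (cx x) = cx (-x) := by
  unfold cx; rw [← Complex.exp_conj]; simp

theorem sum_shift_le (N : ℕ) (h : ℤ → ℝ) (hh : ∀ j, 0 ≤ h j) (t : ℕ) (ht : t < N) :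
    ∑ t' ∈ range N, h ((t:ℤ) - t') ≤ ∑ j ∈ Finset.Ioo (-(N:ℤ)) N, h j := by
  rw [← Finset.sum_image (s := range N) (g := fun t' : ℕ => (t:ℤ) - t') (f := h)]
  · refine Finset.sum_le_sum_of_subset_of_nonneg ?_ (fun j _ _ => hh j)
    intro j hj
    simp only [Finset.mem_image, Finset.mem_range] at hj
    obtain ⟨a, ha, rfl⟩ := hj
    simp only [Finset.mem_Ioo]; omega
  · intro a _ b _ hab
    simp at hab; exact hab

theorem ind_le_sum_cos (N : ℕ) (hN : 1 ≤ N) (ψ : ℝ) :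
    ind (|N * ψ| ≤ 1) ≤ 4 / (N:ℝ) ^ 2 * ∑ t ∈ range N, ∑ t' ∈ range N,
      (cx (((t:ℤ) - (t':ℤ) : ℤ) * ψ)).re := by
  have hNpos : (0:ℝ) < N := by exact_mod_cast hN
  have h1 : ∑ t ∈ range N, ∑ t' ∈ range N, (cx (((t:ℤ) - (t':ℤ) : ℤ) * ψ)).re
      = (∑ t ∈ range N, Real.cos (t * ψ)) ^ 2 + (∑ t ∈ range N, Real.sin (t * ψ)) ^ 2 := by
    rw [sq, sq, Finset.sum_mul_sum, Finset.sum_mul_sum, ← Finset.sum_add_distrib]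
    refine Finset.sum_congr rfl (fun t _ => ?_)
    rw [← Finset.sum_add_distrib]
    refine Finset.sum_congr rfl (fun t' _ => ?_)
    rw [cx_re, ← Real.cos_sub]; push_cast; ring_nf
  rw [h1]
  by_cases h : |N * ψ| ≤ 1
  · rw [ind_true h]
    have h2 : (N:ℝ) / 2 ≤ ∑ t ∈ range N, Real.cos (t * ψ) := by
      have : ∑ t ∈ range N, (1/2:ℝ) ≤ ∑ t ∈ range N, Real.cos (t * ψ) := by
        refine Finset.sum_le_sum (fun t ht => ?_)
        have ht' : (t:ℝ) ≤ N := by exact_mod_cast (Finset.mem_range.1 ht).le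
        have h3 : |(t:ℝ) * ψ| ≤ 1 := by
          rw [abs_mul] at h ⊢
          refine le_trans (mul_le_mul_of_nonneg_right ?_ (abs_nonneg ψ)) h
          rw [abs_of_nonneg (by positivity), abs_of_nonneg (by positivity)]; exact ht'
        have := Real.one_sub_sq_div_two_le_cos (x := (t:ℝ) * ψ)
        have h4 : ((t:ℝ) * ψ) ^ 2 ≤ 1 := by
          rw [← sq_abs]; nlinarith [abs_nonneg ((t:ℝ) * ψ)]
        linarith
      simp at this; linarith
    have h5 : (N:ℝ) ^ 2 / 4 ≤ (∑ t ∈ range N, Real.cos (t * ψ)) ^ 2 := by nlinarith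
    have h6 : (1:ℝ) = 4 / (N:ℝ) ^ 2 * ((N:ℝ) ^ 2 / 4) := by field_simp
    calc (1:ℝ) = 4 / (N:ℝ) ^ 2 * ((N:ℝ) ^ 2 / 4) := h6
      _ ≤ _ := mul_le_mul_of_nonneg_left (by nlinarith [sq_nonneg (∑ t ∈ range N, Real.sin (t * ψ))]) (by positivity)
  · rw [ind_false h]; positivity

/-- discrete Esseen inequality -/
theorem esseen {Ω : Type*} [Fintype Ω] (μ : Ω → ℝ) (hμ : ∀ ω, 0 ≤ μ ω) (X : Ω → ℝ) (τ v : ℝ)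
    (hτ : 0 < τ) (N : ℕ) (hN : 1 ≤ N) :
    ∑ ω, μ ω * ind (|X ω - v| ≤ τ) ≤
      4 / (N:ℝ) * ∑ j ∈ Finset.Ioo (-(N:ℤ)) N, ‖∑ ω, (μ ω : ℂ) * cx (j / (N * τ) * X ω)‖ := by
  have hNpos : (0:ℝ) < N := by exact_mod_cast hN
  set h : ℤ → ℝ := fun j => ‖∑ ω, (μ ω : ℂ) * cx (j / (N * τ) * X ω)‖ with hh
  have h1 : ∀ ω, μ ω * ind (|X ω - v| ≤ τ) ≤ μ ω * (4 / (N:ℝ) ^ 2 * ∑ t ∈ range N, ∑ t' ∈ range N,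
      (cx (((t:ℤ) - (t':ℤ) : ℤ) * ((X ω - v) / (N * τ)))).re) := by
    intro ω
    refine mul_le_mul_of_nonneg_left ?_ (hμ ω)
    refine le_trans (ind_mono (fun hx => ?_)) (ind_le_sum_cos N hN _)
    have : (N:ℝ) * ((X ω - v) / (N * τ)) = (X ω - v) / τ := by field_simp
    rw [this, abs_div, abs_of_pos hτ, div_le_one hτ]; exact hx
  have h2 : ∀ j : ℤ, ∑ ω, μ ω * (cx (j * ((X ω - v) / (N * τ)))).re ≤ h j := by
    intro j
    have : ∑ ω, μ ω * (cx (j * ((X ω - v) / (N * τ)))).re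
      = (cx (-(j * v / (N * τ))) * ∑ ω, (μ ω : ℂ) * cx (j / (N * τ) * X ω)).re := by
      rw [Finset.mul_sum, Complex.re_sum]
      refine Finset.sum_congr rfl (fun ω _ => ?_)
      have : cx (-(j * v / (N * τ))) * ((μ ω : ℂ) * cx (j / (N * τ) * X ω))
        = (μ ω : ℂ) * cx (j * ((X ω - v) / (N * τ))) := by
        rw [mul_left_comm, ← cx_add]; congr 2; field_simp; ring
      rw [this, Complex.re_ofReal_mul]
    rw [this]
    refine (Complex.re_le_norm _).trans ?_
    rw [norm_mul, cx_norm, one_mul]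
  calc ∑ ω, μ ω * ind (|X ω - v| ≤ τ)
      ≤ ∑ ω, μ ω * (4 / (N:ℝ) ^ 2 * ∑ t ∈ range N, ∑ t' ∈ range N,
      (cx (((t:ℤ) - (t':ℤ) : ℤ) * ((X ω - v) / (N * τ)))).re) := Finset.sum_le_sum (fun ω _ => h1 ω)
    _ = 4 / (N:ℝ) ^ 2 * ∑ t ∈ range N, ∑ t' ∈ range N,
        ∑ ω, μ ω * (cx (((t:ℤ) - (t':ℤ) : ℤ) * ((X ω - v) / (N * τ)))).re := by
      simp only [Finset.mul_sum]
      rw [Finset.sum_comm]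
      refine Finset.sum_congr rfl (fun t _ => ?_)
      rw [Finset.sum_comm]
      refine Finset.sum_congr rfl (fun t' _ => Finset.sum_congr rfl (fun ω _ => by ring))
    _ ≤ 4 / (N:ℝ) ^ 2 * ∑ t ∈ range N, ∑ j ∈ Finset.Ioo (-(N:ℤ)) N, h j := by
      refine mul_le_mul_of_nonneg_left ?_ (by positivity)
      refine Finset.sum_le_sum (fun t ht => ?_)
      refine le_trans (Finset.sum_le_sum (fun t' _ => h2 ((t:ℤ) - t')))
        (sum_shift_le N h (fun _ => norm_nonneg _) t (Finset.mem_range.1 ht))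
    _ = 4 / (N:ℝ) * ∑ j ∈ Finset.Ioo (-(N:ℤ)) N, h j := by
      rw [Finset.sum_const, Finset.card_range, nsmul_eq_mul]; field_simp

theorem phi_norm (p s : ℝ) (hp0 : 0 ≤ p) (hp : p ≤ 1/2) (hs : |s| ≤ Real.pi) :
    ‖(p:ℂ) * cx s + (1 - p)‖ ≤ Real.exp (-(p / 10) * s ^ 2) := by
  have h1 : ‖(p:ℂ) * cx s + (1 - p)‖ ^ 2 = 1 - 2 * p * (1 - p) * (1 - Real.cos s) := by
    rw [← Complex.normSq_eq_norm_sq, Complex.normSq_apply]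
    have hre : ((p:ℂ) * cx s + (1 - p)).re = p * Real.cos s + (1 - p) := by
      simp [cx_re]
    have him : ((p:ℂ) * cx s + (1 - p)).im = p * Real.sin s := by simp [cx_im]
    rw [hre, him]
    have := Real.sin_sq_add_cos_sq s
    linear_combination p^2 * this
  have h2 := Real.cos_le_one_sub_mul_cos_sq hs
  have h3 : 1/5 * s^2 ≤ 1 - Real.cos s := by
    have : (1:ℝ)/5 ≤ 2 / Real.pi ^ 2 := by
      rw [div_le_div_iff₀ (by norm_num) (by positivity)]
      have := Real.pi_lt_d2; have := Real.pi_pos; nlinarith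
    nlinarith [sq_nonneg s]
  have h4 : ‖(p:ℂ) * cx s + (1 - p)‖ ^ 2 ≤ (Real.exp (-(p / 10) * s ^ 2)) ^ 2 := by
    rw [h1, ← Real.exp_nat_mul]
    have h5 := Real.add_one_le_exp (((2:ℕ):ℝ) * (-(p / 10) * s ^ 2))
    refine le_trans ?_ h5
    push_cast
    have : p * (1/5 * s^2) ≤ 2 * p * (1 - p) * (1 - Real.cos s) := by
      have : 0 ≤ 1 - Real.cos s := by linarith [Real.cos_le_one s]
      calc p * (1/5 * s^2) ≤ p * (1 - Real.cos s) := by gcongr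
        _ ≤ _ := by nlinarith [mul_nonneg hp0 this]
    nlinarith
  exact (pow_le_pow_iff_left₀ (norm_nonneg _) (Real.exp_nonneg _) two_ne_zero).1 h4

theorem phi_norm_le_one (p s : ℝ) (hp0 : 0 ≤ p) (hp : p ≤ 1/2) :
    ‖(p:ℂ) * cx s + (1 - p)‖ ≤ 1 := by
  calc _ ≤ ‖(p:ℂ) * cx s‖ + ‖((1 - p : ℝ):ℂ)‖ := by
        have := norm_add_le ((p:ℂ) * cx s) ((1 - p : ℝ):ℂ)
        simpa using this
    _ = 1 := by
      rw [norm_mul, cx_norm, Complex.norm_real, Complex.norm_real, Real.norm_of_nonneg hp0,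
        Real.norm_of_nonneg (by linarith)]; ring

variable {ι : Type*} [Fintype ι] [DecidableEq ι]

theorem cx_XX (Y : ι → ℝ) (s : ℝ) (C : ι → Bool) :
    cx (s * XX Y C) = ∏ i, (if C i then cx (s * Y i) else 1) := by
  unfold XX; rw [Finset.mul_sum, cx_sum]
  refine Finset.prod_congr rfl (fun i _ => ?_)
  split_ifs <;> simp [cx_zero]

theorem char_eq (p s : ℝ) (Y : ι → ℝ) :
    ∑ C : ι → Bool, (pw (wv ι p) C : ℂ) * cx (s * XX Y C) = ∏ i, ((p:ℂ) * cx (s * Y i) + (1 - p)) := by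
  have h : ∀ C : ι → Bool, (pw (wv ι p) C : ℂ) * cx (s * XX Y C)
      = ∏ i, ((bw p (C i) : ℂ) * (if C i then cx (s * Y i) else 1)) := by
    intro C; rw [cx_XX, Finset.prod_mul_distrib]; simp [pw, wv]
  simp only [h]
  rw [sum_prod_eq (fun i a => ((bw p a : ℂ) * (if a = true then cx (s * Y i) else 1)))]
  refine Finset.prod_congr rfl (fun i _ => ?_)
  rw [sum_bw_complex]; simp

theorem char_le (p s : ℝ) (hp0 : 0 ≤ p) (hp : p ≤ 1/2) (Y : ι → ℝ) (S : Finset ι)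
    (hS : ∀ i ∈ S, |s * Y i| ≤ Real.pi) :
    ‖∑ C : ι → Bool, (pw (wv ι p) C : ℂ) * cx (s * XX Y C)‖
      ≤ Real.exp (-(p/10) * ∑ i ∈ S, (s * Y i) ^ 2) := by
  rw [char_eq, norm_prod, Finset.mul_sum, Real.exp_sum]
  rw [← Finset.prod_mul_prod_compl S]
  calc _ ≤ (∏ i ∈ S, Real.exp (-(p / 10) * (s * Y i) ^ 2)) * 1 := by
        refine mul_le_mul ?_ ?_ (Finset.prod_nonneg (fun _ _ => norm_nonneg _))
          (Finset.prod_nonneg (fun _ _ => Real.exp_nonneg _))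
        · exact Finset.prod_le_prod (fun _ _ => norm_nonneg _) (fun i hi => phi_norm p _ hp0 hp (hS i hi))
        · exact Finset.prod_le_one (fun _ _ => norm_nonneg _) (fun i hi => phi_norm_le_one p _ hp0 hp)
    _ = _ := mul_one _

/-- rounding weights -/
noncomputable abbrev rwt (z : ι → ℝ) : ι → Bool → ℝ := fun i => bw (Int.fract (z i))

/-- rounded vector -/
noncomputable def rd (z : ι → ℝ) (f : ι → Bool) : ι → ℤ := fun i => ⌊z i⌋ + (if f i then 1 else 0)

theorem isW_rwt (z : ι → ℝ) : IsW (rwt z) :=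
  isW_bw (fun i => Int.fract_nonneg _) (fun i => (Int.fract_lt_one _).le)

theorem rd_sub (z : ι → ℝ) (f : ι → Bool) (i : ι) :
    (rd z f i : ℝ) - z i = (if f i then 1 else 0) - Int.fract (z i) := by
  unfold rd; push_cast; have := Int.floor_add_fract (z i); split_ifs <;> linarith

theorem rd_abs (z : ι → ℝ) (f : ι → Bool) (i : ι) : |(rd z f i : ℝ) - z i| ≤ 1 := by
  rw [rd_sub, abs_le]
  have := Int.fract_nonneg (z i); have := (Int.fract_lt_one (z i)).le
  split_ifs <;> constructor <;> linarith

theorem rd_var (z : ι → ℝ) (c : ι → ℝ) :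
    EE (rwt z) (fun f => (∑ i, c i * ((rd z f i : ℝ) - z i)) ^ 2)
      = ∑ i, (c i) ^ 2 * (Int.fract (z i) * (1 - Int.fract (z i))) := by
  simp only [rd_sub]
  rw [EE_var (isW_rwt z) (fun i b => c i * ((if b then 1 else 0) - Int.fract (z i)))]
  · refine Finset.sum_congr rfl (fun i _ => ?_)
    rw [sum_bw]; simp; ring
  · intro i; rw [sum_bw]; simp; ring

theorem rd_var_le (z : ι → ℝ) (C : ι → Bool) :
    EE (rwt z) (fun f => (XX (fun i => (rd z f i : ℝ)) C - XX z C) ^ 2) ≤ (Fintype.card ι) / 4 := by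
  have h : ∀ f, XX (fun i => (rd z f i : ℝ)) C - XX z C
     = ∑ i, (if C i then 1 else 0) * ((rd z f i : ℝ) - z i) := by
    intro f; unfold XX; rw [← Finset.sum_sub_distrib]
    refine Finset.sum_congr rfl (fun i _ => ?_)
    split_ifs <;> simp
  simp only [h, rd_var]
  calc _ ≤ ∑ i : ι, (1/4 : ℝ) := by
        refine Finset.sum_le_sum (fun i _ => ?_)
        split_ifs <;> nlinarith [sq_nonneg (Int.fract (z i) - 1/2)]
    _ = _ := by simp; ring

end SCP

namespace SCP

/-- spread vector -/
def Grad {n : ℕ} (θ : ℝ) (Y : Fin n → ℝ) : Prop :=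
  ∑ i, |Y i| ≤ 5 * n ∧
  θ ^ 2 / 16 * n ≤ ((univ.filter (fun i => θ / 2 ≤ |Y i| ∧ |Y i| ≤ 4 / θ)).card : ℝ)

/-- multiple of a spread vector -/
def HasGrad {n : ℕ} (θ : ℝ) (x : Fin n → ℝ) : Prop :=
  ∃ (s : ℝ) (Y : Fin n → ℝ), 1 / (5 * n) ≤ s ∧ Grad θ Y ∧ ∀ i, x i = s * Y i

/-- structured null vector event -/
def StructBad {n : ℕ} (θ : ℝ) (A : Fin n → Fin n → Bool) : Prop :=
  ∃ x : Fin n → ℝ, ∑ i, x i ^ 2 = 1 ∧ ∑ r, (XX x (A r)) ^ 2 ≤ θ / 17 ∧ ¬ HasGrad θ x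

/-- net vectors -/
def Net {n : ℕ} (θ : ℝ) (i0 : Fin n) (y : Fin n → ℤ) : Prop :=
  |y i0| ≤ 4 * n + 1 ∧ ∑ i ∈ univ.erase i0, (|y i| : ℝ) ≤ 4 * θ * n ∧
  (n:ℝ) / 4 ≤ ∑ i ∈ univ.erase i0, (y i : ℝ) ^ 2 ∧ ∀ i, |y i| ≤ |y i0| + 2

theorem XX_smul {ι : Type*} [Fintype ι] (c : ℝ) (Y : ι → ℝ) (C : ι → Bool) :
    XX (fun i => c * Y i) C = c * XX Y C := by
  unfold XX; rw [Finset.mul_sum]; refine Finset.sum_congr rfl (fun i _ => ?_); split_ifs <;> simp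

theorem var_le_abs (z : ℝ) : Int.fract z * (1 - Int.fract z) ≤ |z| := by
  have h1 := Int.fract_nonneg z; have h2 := Int.fract_lt_one z
  have h3 := Int.floor_add_fract z
  rcases le_or_gt 0 z with h | h
  · have : (0:ℤ) ≤ ⌊z⌋ := Int.floor_nonneg.2 h
    have : (0:ℝ) ≤ ⌊z⌋ := by exact_mod_cast this
    rw [abs_of_nonneg h]; nlinarith
  · have : ⌊z⌋ ≤ -1 := by
      have : ⌊z⌋ < 0 := Int.floor_lt.2 (by simpa using h)
      omega
    have : (⌊z⌋:ℝ) ≤ -1 := by exact_mod_cast this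
    rw [abs_of_neg h]; nlinarith

theorem mean_abs (z : ℝ) :
    Int.fract z * |(⌊z⌋:ℝ) + 1| + (1 - Int.fract z) * |(⌊z⌋:ℝ)| = |z| := by
  have h3 := Int.floor_add_fract z
  rcases le_or_gt 0 z with h | h
  · have : (0:ℤ) ≤ ⌊z⌋ := Int.floor_nonneg.2 h
    have : (0:ℝ) ≤ ⌊z⌋ := by exact_mod_cast this
    rw [abs_of_nonneg h, abs_of_nonneg this, abs_of_nonneg (by linarith)]; linarith
  · have : ⌊z⌋ ≤ -1 := by
      have : ⌊z⌋ < 0 := Int.floor_lt.2 (by simpa using h)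
      omega
    have : (⌊z⌋:ℝ) ≤ -1 := by exact_mod_cast this
    rw [abs_of_neg h, abs_of_nonpos (by linarith), abs_of_nonpos (by linarith)]; linarith

theorem round_sparse {n : ℕ} {θ : ℝ} (hθ : 0 < θ) (hθ1 : θ ≤ 1/16) (hn : 1 ≤ θ * n)
    (A : Fin n → Fin n → Bool) (i0 : Fin n) (y : Fin n → ℝ)
    (h0 : |y i0| ≤ 4 * n) (h1 : ∑ i ∈ univ.erase i0, (y i) ^ 2 = n)
    (h2 : ∑ i ∈ univ.erase i0, |y i| ≤ θ * n) (h3 : ∀ i, |y i| ≤ |y i0|)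
    (h4 : ∑ r, (XX y (A r)) ^ 2 ≤ θ * n ^ 2) :
    ∃ z : Fin n → ℤ, Net θ i0 z ∧ ∑ r, (XX (fun i => (z i : ℝ)) (A r)) ^ 2 ≤ 32 * θ * n ^ 2 := by
  have hn0 : (0:ℝ) < n := by
    by_contra h; nlinarith
  have hv : ∑ i, (Int.fract (y i) * (1 - Int.fract (y i))) ≤ 2 * θ * n := by
    rw [← Finset.add_sum_erase _ _ (Finset.mem_univ i0)]
    have : ∑ i ∈ univ.erase i0, (Int.fract (y i) * (1 - Int.fract (y i))) ≤ θ * n :=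
      le_trans (Finset.sum_le_sum (fun i _ => var_le_abs _)) h2
    nlinarith [sq_nonneg (Int.fract (y i0) - 1/2)]
  -- three functionals
  set F1 : (Fin n → Bool) → ℝ := fun f => ∑ r, (XX (fun i => (rd y f i : ℝ)) (A r) - XX y (A r)) ^ 2
  set F2 : (Fin n → Bool) → ℝ := fun f => ∑ i ∈ univ.erase i0, |(rd y f i : ℝ)|
  set F3 : (Fin n → Bool) → ℝ := fun f => ∑ i ∈ univ.erase i0, ((rd y f i : ℝ) - y i) ^ 2
  have hw := isW_rwt y
  have e1 : EE (rwt y) F1 ≤ 2 * θ * n ^ 2 := by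
    have : EE (rwt y) F1 ≤ ∑ r : Fin n, (2 * θ * n) := by
      show EE (rwt y) (fun f => ∑ r, (XX (fun i => (rd y f i : ℝ)) (A r) - XX y (A r)) ^ 2) ≤ _
      rw [EE_sum]
      refine Finset.sum_le_sum (fun r _ => ?_)
      have h : ∀ f, XX (fun i => (rd y f i : ℝ)) (A r) - XX y (A r)
          = ∑ i, (if A r i then 1 else 0) * ((rd y f i : ℝ) - y i) := by
        intro f; unfold XX; rw [← Finset.sum_sub_distrib]
        refine Finset.sum_congr rfl (fun i _ => ?_)
        split_ifs <;> simp
      simp only [h, rd_var]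
      refine le_trans (Finset.sum_le_sum (fun i _ => ?_)) hv
      have : 0 ≤ Int.fract (y i) * (1 - Int.fract (y i)) :=
        mul_nonneg (Int.fract_nonneg _) (by linarith [Int.fract_lt_one (y i)])
      split_ifs <;> nlinarith
    simp at this; nlinarith
  have e2 : EE (rwt y) F2 ≤ θ * n := by
    show EE (rwt y) (fun f => ∑ i ∈ univ.erase i0, |(rd y f i : ℝ)|) ≤ _
    rw [EE_sum]
    refine le_trans (le_of_eq (Finset.sum_congr rfl (fun i _ => ?_))) h2
    have := EE_coord hw i (fun b => |((⌊y i⌋ + (if b then 1 else 0) : ℤ) : ℝ)|)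
    unfold rd
    rw [this, sum_bw]; simpa using mean_abs (y i)
  have e3 : EE (rwt y) F3 ≤ θ * n := by
    show EE (rwt y) (fun f => ∑ i ∈ univ.erase i0, ((rd y f i : ℝ) - y i) ^ 2) ≤ _
    rw [EE_sum]
    refine le_trans (Finset.sum_le_sum (fun i _ => ?_)) h2
    simp only [rd_sub]
    have := EE_coord hw i (fun b => ((if b then 1 else 0) - Int.fract (y i)) ^ 2)
    rw [this, sum_bw]
    refine le_trans (le_of_eq ?_) (var_le_abs (y i))
    simp; ring
  have etot : EE (rwt y) (fun f => F1 f / (8 * θ * n ^ 2) + (F2 f / (4 * θ * n) + F3 f / (n / 4))) < 1 := by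
    rw [EE_add, EE_add, EE_div, EE_div, EE_div]
    have a1 : EE (rwt y) F1 / (8 * θ * n ^ 2) ≤ 1/4 := by
      rw [div_le_iff₀ (by positivity)]; linarith
    have a2 : EE (rwt y) F2 / (4 * θ * n) ≤ 1/4 := by
      rw [div_le_iff₀ (by positivity)]; linarith
    have a3 : EE (rwt y) F3 / (n / 4) ≤ 1/4 := by
      rw [div_le_iff₀ (by positivity)]; nlinarith
    linarith
  obtain ⟨f, hf⟩ := exists_lt_of_EE_lt hw etot
  have p1 : 0 ≤ F1 f := Finset.sum_nonneg (fun _ _ => sq_nonneg _)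
  have p2 : 0 ≤ F2 f := Finset.sum_nonneg (fun _ _ => abs_nonneg _)
  have p3 : 0 ≤ F3 f := Finset.sum_nonneg (fun _ _ => sq_nonneg _)
  have q1 : 0 ≤ F1 f / (8 * θ * n ^ 2) := by positivity
  have q2 : 0 ≤ F2 f / (4 * θ * n) := by positivity
  have q3 : 0 ≤ F3 f / (n / 4) := by positivity
  have r1 : F1 f ≤ 8 * θ * n ^ 2 := by
    have : F1 f / (8 * θ * n ^ 2) ≤ 1 := by linarith
    rwa [div_le_one (by positivity)] at this
  have r2 : F2 f ≤ 4 * θ * n := by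
    have : F2 f / (4 * θ * n) ≤ 1 := by linarith
    rwa [div_le_one (by positivity)] at this
  have r3 : F3 f ≤ n / 4 := by
    have : F3 f / (n / 4) ≤ 1 := by linarith
    rwa [div_le_one (by positivity)] at this
  have hb := rd_abs y f
  have hb0 : |(rd y f i0 : ℝ)| ≤ |y i0| + 1 := by
    have := abs_add_le ((rd y f i0 : ℝ) - y i0) (y i0)
    rw [sub_add_cancel] at this; linarith [hb i0]
  refine ⟨rd y f, ⟨?_, ?_, ?_, ?_⟩, ?_⟩
  · have : |(rd y f i0 : ℝ)| ≤ 4 * n + 1 := by linarith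
    exact_mod_cast this
  · exact r2
  · have : ∀ i, (y i) ^ 2 / 2 - ((rd y f i : ℝ) - y i) ^ 2 ≤ (rd y f i : ℝ) ^ 2 := by
      intro i; nlinarith [sq_nonneg ((rd y f i : ℝ) * 2 - y i)]
    have := Finset.sum_le_sum (fun i (_ : i ∈ univ.erase i0) => this i)
    rw [Finset.sum_sub_distrib, ← Finset.sum_div, h1] at this
    have r3' : ∑ i ∈ univ.erase i0, ((rd y f i : ℝ) - y i) ^ 2 ≤ n / 4 := r3
    linarith
  · intro i
    have h5 : |(rd y f i : ℝ)| ≤ |(rd y f i0 : ℝ)| + 2 := by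
      have a := abs_add_le ((rd y f i : ℝ) - y i) (y i)
      rw [sub_add_cancel] at a
      have b := abs_add_le (y i0 - (rd y f i0 : ℝ)) (rd y f i0 : ℝ)
      rw [sub_add_cancel, abs_sub_comm] at b
      linarith [hb i0, hb i, h3 i]
    exact_mod_cast h5
  · have r1' : ∑ r, (XX (fun i => (rd y f i : ℝ)) (A r) - XX y (A r)) ^ 2 ≤ 8 * θ * n ^ 2 := r1
    have : ∀ r, (XX (fun i => (rd y f i : ℝ)) (A r)) ^ 2 ≤ 2 * (XX y (A r)) ^ 2 +
        2 * (XX (fun i => (rd y f i : ℝ)) (A r) - XX y (A r)) ^ 2 := by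
      intro r; nlinarith [sq_nonneg (XX (fun i => (rd y f i : ℝ)) (A r) - 2 * XX y (A r))]
    have := Finset.sum_le_sum (fun r (_ : r ∈ univ) => this r)
    rw [Finset.sum_add_distrib, ← Finset.mul_sum, ← Finset.mul_sum] at this
    have : 0 ≤ θ * (n:ℝ)^2 := by positivity
    linarith

theorem grad_of_spread {n : ℕ} {θ : ℝ} (hθ : 0 < θ) (hθ1 : θ ≤ 1/16) 
    (i0 : Fin n) (y : Fin n → ℝ)
    (h0 : |y i0| ≤ 4 * n) (h1 : ∑ i ∈ univ.erase i0, (y i) ^ 2 = n)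
    (h2 : θ * n < ∑ i ∈ univ.erase i0, |y i|) : Grad θ y := by
  have hn0 : (0:ℝ) < n := by exact_mod_cast (Fin.pos i0)
  constructor
  · rw [← Finset.add_sum_erase _ _ (Finset.mem_univ i0)]
    have : ∑ i ∈ univ.erase i0, |y i| ≤ n := by
      have h3 : ∀ i ∈ univ.erase i0, |y i| ≤ ((y i) ^ 2 + 1) / 2 := by
        intro i _; nlinarith [sq_abs (y i), sq_nonneg (|y i| - 1)]
      have h4 := Finset.sum_le_sum h3
      rw [← Finset.sum_div, Finset.sum_add_distrib, h1] at h4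
      have h5 : ((univ.erase i0).card : ℝ) ≤ n := by
        have := Finset.card_le_univ (univ.erase i0); simp only [Fintype.card_fin] at this
        exact_mod_cast this
      simp only [Finset.sum_const, nsmul_eq_mul, mul_one] at h4
      linarith
    linarith
  · set S := univ.filter (fun i => θ / 2 ≤ |y i| ∧ |y i| ≤ 4 / θ)
    have h3 : ∀ i ∈ univ.erase i0, |y i| ≤ θ / 2 + (θ / 4) * (y i) ^ 2 + (if i ∈ S then 4 / θ else 0) := by
      intro i _
      have hy := abs_nonneg (y i)
      have hp : 0 ≤ (θ / 4) * (y i) ^ 2 := by positivity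
      have hq : (0:ℝ) ≤ if i ∈ S then 4 / θ else 0 := by split_ifs <;> positivity
      by_cases a : |y i| < θ / 2
      · linarith
      by_cases b : |y i| ≤ 4 / θ
      · have : i ∈ S := by simp [S]; exact ⟨by linarith, b⟩
        rw [if_pos this]; linarith
      · have : |y i| ≤ (θ / 4) * (y i) ^ 2 := by
          push Not at b
          rw [div_lt_iff₀ hθ] at b
          rw [← sq_abs]; nlinarith
        linarith
    have h4 := Finset.sum_le_sum h3
    rw [Finset.sum_add_distrib, Finset.sum_add_distrib, ← Finset.mul_sum, h1] at h4
    have h5 : ((univ.erase i0).card : ℝ) ≤ n := by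
        have := Finset.card_le_univ (univ.erase i0); simp only [Fintype.card_fin] at this
        exact_mod_cast this
    have h6 : ∑ i ∈ univ.erase i0, (if i ∈ S then 4 / θ else 0) ≤ S.card * (4 / θ) := by
      have : ∑ i ∈ univ.erase i0, (if i ∈ S then 4 / θ else 0) ≤ ∑ i, (if i ∈ S then 4 / θ else 0) :=
        Finset.sum_le_sum_of_subset_of_nonneg (Finset.subset_univ _)
          (fun i _ _ => by split_ifs <;> positivity)
      simpa using this
    simp only [Finset.sum_const, nsmul_eq_mul] at h4
    have h7 : θ / 4 * n ≤ S.card * (4 / θ) := by nlinarith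
    rw [← mul_div_assoc, le_div_iff₀ hθ] at h7
    nlinarith

theorem struct_dichotomy {n : ℕ} {θ : ℝ} (hθ : 0 < θ) (hθ1 : θ ≤ 1/16) (hn : 1 ≤ θ * n)
    (A : Fin n → Fin n → Bool) (h : StructBad θ A) :
    (∃ i0 : Fin n, ∀ r, A r i0 = false) ∨ ∃ i0 : Fin n, ∃ z : Fin n → ℤ, Net θ i0 z ∧
      ∑ r, (XX (fun i => (z i : ℝ)) (A r)) ^ 2 ≤ 32 * θ * n ^ 2 := by
  obtain ⟨x, hx, hA, hG⟩ := h
  have hn0 : (0:ℝ) < n := by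
    by_contra h; nlinarith
  have hn1 : (1:ℝ) ≤ n := by exact_mod_cast (by exact_mod_cast hn0 : 0 < n)
  have : Nonempty (Fin n) := ⟨⟨0, by exact_mod_cast hn0⟩⟩
  obtain ⟨i0, -, hmax⟩ := Finset.exists_max_image (univ : Finset (Fin n)) (fun i => |x i|) Finset.univ_nonempty
  set R := ∑ i ∈ univ.erase i0, (x i) ^ 2 with hR
  have hR0 : 0 ≤ R := Finset.sum_nonneg (fun _ _ => sq_nonneg _)
  have hxR : (x i0) ^ 2 + R = 1 := by
    rw [← hx, ← Finset.add_sum_erase _ _ (Finset.mem_univ i0)]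
  by_cases hc : 16 * n * R < (x i0) ^ 2
  · left
    refine ⟨i0, fun r => ?_⟩
    by_contra hr
    have hr' : A r i0 = true := by simpa using hr
    have h1 : XX x (A r) = x i0 + ∑ i ∈ univ.erase i0, (if A r i then x i else 0) := by
      unfold XX; rw [← Finset.add_sum_erase _ _ (Finset.mem_univ i0), hr']; simp
    set T := ∑ i ∈ univ.erase i0, (if A r i then x i else 0)
    have h2 : T ^ 2 ≤ n * R := by
      have := sq_sum_le_card_mul_sum_sq (s := univ.erase i0) (f := fun i => if A r i then x i else 0)
      have h5 : ((univ.erase i0).card : ℝ) ≤ n := by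
        have := Finset.card_le_univ (univ.erase i0); simp only [Fintype.card_fin] at this
        exact_mod_cast this
      have h6 : ∑ i ∈ univ.erase i0, (if A r i then x i else 0) ^ 2 ≤ R := by
        refine Finset.sum_le_sum (fun i _ => ?_)
        split_ifs <;> nlinarith [sq_nonneg (x i)]
      calc T ^ 2 ≤ _ := this
        _ ≤ n * R := mul_le_mul h5 h6 (Finset.sum_nonneg (fun _ _ => sq_nonneg _)) hn0.le
    have h3 : (x i0 + T) ^ 2 ≤ θ / 17 := by
      rw [← h1]
      exact le_trans (Finset.single_le_sum (f := fun r => (XX x (A r)) ^ 2) (fun _ _ => sq_nonneg _) (Finset.mem_univ r)) hA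
    have h4 : (x i0) ^ 2 ≤ 2 * (x i0 + T) ^ 2 + 2 * T ^ 2 := by nlinarith [sq_nonneg (x i0 + 2 * T)]
    have h5 : R ≤ n * R := by nlinarith
    nlinarith
  · right
    push Not at hc
    have hR1 : 1 ≤ 17 * n * R := by nlinarith
    have hRpos : 0 < R := by
      rcases hR0.lt_or_eq with h | h
      · exact h
      · rw [← h] at hR1; norm_num at hR1
    set ρ := Real.sqrt R
    have hρ : 0 < ρ := Real.sqrt_pos.2 hRpos
    have hρ2 : ρ ^ 2 = R := Real.sq_sqrt hR0
    set sn := Real.sqrt n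
    have hs : 0 < sn := Real.sqrt_pos.2 hn0
    have hs2 : sn ^ 2 = n := Real.sq_sqrt hn0.le
    set y : Fin n → ℝ := fun i => sn / ρ * x i with hy
    have y0 : |y i0| ≤ 4 * n := by
      refine abs_le_of_sq_le_sq ?_ (by positivity)
      simp only [hy]
      rw [mul_pow, div_pow, hs2, hρ2, div_mul_eq_mul_div, div_le_iff₀ hRpos]
      nlinarith
    have y1 : ∑ i ∈ univ.erase i0, (y i) ^ 2 = n := by
      simp only [hy, mul_pow, ← Finset.mul_sum]
      rw [← hR, div_pow, hs2, hρ2]; field_simp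
    have y3 : ∀ i, |y i| ≤ |y i0| := by
      intro i; simp only [hy, abs_mul]
      exact mul_le_mul_of_nonneg_left (hmax i (Finset.mem_univ i)) (abs_nonneg _)
    have y4 : ∑ r, (XX y (A r)) ^ 2 ≤ θ * n ^ 2 := by
      simp only [hy, XX_smul, mul_pow, ← Finset.mul_sum]
      rw [div_pow, hs2, hρ2, div_mul_eq_mul_div, div_le_iff₀ hRpos]
      calc (n:ℝ) * ∑ r, (XX x (A r)) ^ 2 ≤ n * (θ / 17) := by gcongr
        _ ≤ _ := by nlinarith [mul_pos hθ hn0]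
    by_cases hsp : ∑ i ∈ univ.erase i0, |y i| ≤ θ * n
    · exact ⟨i0, round_sparse hθ hθ1 hn A i0 y y0 y1 hsp y3 y4⟩
    · exfalso
      push Not at hsp
      refine hG ⟨ρ / sn, y, ?_, grad_of_spread hθ hθ1 i0 y y0 y1 hsp, fun i => ?_⟩
      · rw [div_le_div_iff₀ (by positivity) hs]
        refine le_of_sq_le_sq ?_ (by positivity)
        nlinarith
      · simp only [hy]; field_simp

end SCP

namespace SCP

section
variable {ι : Type*} [Fintype ι] [DecidableEq ι]

theorem XX_update (Y : ι → ℝ) (C : ι → Bool) (i : ι) (b : Bool) :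
    XX Y (Function.update C i b) = (if b then Y i else 0) + XX Y (Function.update C i false) := by
  unfold XX
  rw [← Finset.add_sum_erase _ _ (Finset.mem_univ i), ← Finset.add_sum_erase univ (fun j => if Function.update C i false j = true then Y j else 0) (Finset.mem_univ i)]
  simp only [Function.update_self]
  have : ∀ b' : Bool, ∑ x ∈ univ.erase i, (if Function.update C i b' x = true then Y x else 0)
      = ∑ x ∈ univ.erase i, (if C x = true then Y x else 0) := by
    intro b'
    refine Finset.sum_congr rfl (fun x hx => ?_)
    rw [Function.update_of_ne (Finset.ne_of_mem_erase hx)]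
  rw [this b, this false]; simp

theorem four_val (p τ a b s : ℝ) (hp0 : 0 ≤ p) (hp : p ≤ 1/2) (ha : 2 * τ < |a|) (hb : 2 * τ < |b|) :
    p * (p * ind (|a + (b + s)| ≤ τ) + (1 - p) * ind (|0 + (b + s)| ≤ τ))
      + (1 - p) * (p * ind (|a + (0 + s)| ≤ τ) + (1 - p) * ind (|0 + (0 + s)| ≤ τ))
    ≤ (1 - p) ^ 2 + p ^ 2 := by
  have key : ∀ u c : ℝ, 2 * τ < |c| → |u| ≤ τ → |c + u| ≤ τ → False := by
    intro u c hc h1 h2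
    have := abs_sub (c + u) u
    rw [add_sub_cancel_right] at this; linarith
  have k1 := key s b hb
  have k2 := key s a ha
  have k3 := key (b + s) a ha
  have k4 := key (a + s) b hb
  have e4 : b + (a + s) = a + (b + s) := by ring
  rw [e4] at k4
  simp only [zero_add]
  have hq : p * (1 - p) * 2 ≤ (1-p)^2 + p^2 := by nlinarith [sq_nonneg (1 - 2 * p)]
  have hpp : 0 ≤ p * (1 - p) := mul_nonneg hp0 (by linarith)
  by_cases c1 : |s| ≤ τ
  · rw [ind_true c1, ind_false (k1 c1), ind_false (k2 c1)]
    have := ind_le_one (|a + (b + s)| ≤ τ)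
    nlinarith [mul_nonneg hp0 hp0]
  · rw [ind_false c1]
    by_cases c2 : |a + (b + s)| ≤ τ
    · have : ¬ |b + s| ≤ τ := fun h => k3 h c2
      have h' : ¬ |a + s| ≤ τ := fun h => k4 h c2
      rw [ind_true c2, ind_false this, ind_false h']; nlinarith
    · rw [ind_false c2]
      have h1 := ind_le_one (|b + s| ≤ τ)
      have h2 := ind_le_one (|a + s| ≤ τ)
      nlinarith

theorem two_big {p : ℝ} (hp0 : 0 ≤ p) (hp : p ≤ 1/2) (Y : ι → ℝ) (τ : ℝ) {i0 i1 : ι} (hne : i1 ≠ i0)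
    (h0 : 2 * τ < |Y i0|) (h1 : 2 * τ < |Y i1|) :
    PP (wv ι p) (fun C => |XX Y C| ≤ τ) ≤ (1 - p) ^ 2 + p ^ 2 := by
  have hw : IsW (wv ι p) := isW_wv hp0 (by linarith)
  unfold PP
  rw [EE_resample hw i0, EE_resample hw i1]
  refine EE_le_const hw (fun C => ?_)
  have hX : ∀ a b, XX Y (Function.update (Function.update C i1 b) i0 a)
      = (if a then Y i0 else 0) + ((if b then Y i1 else 0)
        + XX Y (Function.update (Function.update C i0 false) i1 false)) := by
    intro a b
    rw [XX_update Y _ i0 a, Function.update_comm hne, XX_update Y _ i1 b]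
  simp only [hX]
  rw [sum_bw, sum_bw, sum_bw]
  simpa using four_val p τ (Y i0) (Y i1) _ hp0 hp h0 h1

end

theorem net_small_ball {n : ℕ} {p q θ ε : ℝ} (hq : 0 < q) (hqp : q ≤ p) (hp : p ≤ 1/2)
    (hε : 0 < ε) (hε2 : ε ^ 2 = q / 40960) (hτ : 6 ≤ ε * Real.sqrt n) (i0 : Fin n)
    (z : Fin n → ℤ) (hz : Net θ i0 z) :
    PP (wv (Fin n) p) (fun C => |XX (fun i => (z i : ℝ)) C| ≤ ε * Real.sqrt n) ≤ (1 - p) ^ 2 + p ^ 2 := by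
  obtain ⟨z1, z2, z3, z4⟩ := hz
  set τ := ε * Real.sqrt n with hτd
  have hp0 : 0 ≤ p := by linarith
  have hn0 : (0:ℝ) < n := by exact_mod_cast (Fin.pos i0)
  have hτ2 : τ ^ 2 = q / 40960 * n := by rw [hτd, mul_pow, hε2, Real.sq_sqrt hn0.le]
  by_cases hc : ∃ i1, i1 ≠ i0 ∧ 3 * τ + 2 ≤ |(z i1 : ℝ)|
  · obtain ⟨i1, hne, h1⟩ := hc
    have h4 : |(z i1 : ℝ)| ≤ |(z i0 : ℝ)| + 2 := by exact_mod_cast z4 i1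
    exact two_big hp0 hp _ τ hne (by show 2 * τ < |(z i0 : ℝ)|; linarith) (by show 2 * τ < |(z i1 : ℝ)|; linarith)
  · push Not at hc
    have hhalf : PP (wv (Fin n) p) (fun C => |XX (fun i => (z i : ℝ)) C| ≤ τ) ≤ 1/2 := by
      have hE := esseen (Ω := Fin n → Bool) (pw (wv (Fin n) p)) (pw_nonneg (isW_wv hp0 (by linarith)))
        (XX (fun i => (z i : ℝ))) τ 0 (by linarith) 16 (by norm_num)
      simp only [sub_zero] at hE
      unfold PP EE
      refine hE.trans ?_
      have hb : ∀ j ∈ Finset.Ioo (-((16:ℕ):ℤ)) ((16:ℕ):ℤ), ‖∑ C : Fin n → Bool, (pw (wv (Fin n) p) C : ℂ) *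
          cx (j / (((16:ℕ):ℝ) * τ) * XX (fun i => (z i : ℝ)) C)‖ ≤ if j = 0 then 1 else 1/40 := by
        intro j hj
        rw [Finset.mem_Ioo] at hj
        have hj15 : |(j:ℝ)| ≤ 15 := by
          have : |j| ≤ 15 := by rw [abs_le]; push_cast at hj; omega
          exact_mod_cast this
        have hc1 := char_le p (j / (((16:ℕ):ℝ) * τ)) hp0 hp (fun i => (z i : ℝ)) (univ.erase i0) (by
          intro i hi
          have h1 := hc i (Finset.ne_of_mem_erase hi)
          rw [abs_mul, abs_div, abs_of_pos (a := ((16:ℕ):ℝ) * τ) (by push_cast; linarith)]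
          rw [div_mul_eq_mul_div, div_le_iff₀ (by push_cast; linarith)]
          have hpi := Real.pi_gt_d2
          push_cast
          calc |(j:ℝ)| * |(z i : ℝ)| ≤ 15 * (3 * τ + 2) := by gcongr
            _ ≤ 3.14 * (16 * τ) := by nlinarith
            _ ≤ _ := by gcongr)
        refine hc1.trans ?_
        split_ifs with h0
        · rw [h0]; simp
        · simp only [mul_pow, ← Finset.mul_sum]
          have hj1 : (1:ℝ) ≤ (j:ℝ) ^ 2 := by
            have : 1 ≤ j ^ 2 := by
              have := sq_nonneg j; have : j ^ 2 ≠ 0 := by positivity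
              omega
            exact_mod_cast this
          have h5 : (4:ℝ) ≤ p / 10 * ((j / (((16:ℕ):ℝ) * τ)) ^ 2 * ∑ i ∈ univ.erase i0, (z i : ℝ) ^ 2) := by
            rw [div_pow, mul_pow, hτ2]
            push_cast
            have : p / 10 * ((j:ℝ) ^ 2 / (16 ^ 2 * (q / 40960 * n)) * ∑ i ∈ univ.erase i0, (z i : ℝ) ^ 2)
              = (p * (j:ℝ)^2 * ∑ i ∈ univ.erase i0, (z i : ℝ) ^ 2) * 16 / (q * n) := by
              field_simp; ring
            rw [this, le_div_iff₀ (by positivity)]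
            have : q * (1:ℝ) * (n/4) ≤ p * (j:ℝ)^2 * ∑ i ∈ univ.erase i0, (z i : ℝ) ^ 2 := by gcongr
            linarith
          calc Real.exp (-(p / 10) * ((j / (((16:ℕ):ℝ) * τ)) ^ 2 * ∑ i ∈ univ.erase i0, (z i : ℝ) ^ 2))
              ≤ Real.exp (-4) := by
                apply Real.exp_le_exp.2; linarith
            _ ≤ 1/40 := by
              rw [Real.exp_neg, inv_le_comm₀ (Real.exp_pos _) (by norm_num)]
              have h1 := Real.exp_one_gt_d9
              have : Real.exp 4 = Real.exp 1 ^ 4 := by rw [← Real.exp_nat_mul]; norm_num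
              rw [this]
              calc ((1:ℝ)/40)⁻¹ ≤ 2.7182818283 ^ 4 := by norm_num
                _ ≤ _ := by gcongr
      calc _ ≤ 4 / ((16:ℕ):ℝ) * ∑ j ∈ Finset.Ioo (-((16:ℕ):ℤ)) ((16:ℕ):ℤ), (if j = 0 then (1:ℝ) else 1/40) :=
            mul_le_mul_of_nonneg_left (Finset.sum_le_sum hb) (by norm_num)
        _ ≤ 1/2 := by
          have h1 : ∀ j : ℤ, (if j = 0 then (1:ℝ) else 1/40) ≤ (if j = 0 then 1 else 0) + 1/40 := by
            intro j; split_ifs <;> norm_num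
          have h2 := Finset.sum_le_sum (fun j (_ : j ∈ Finset.Ioo (-((16:ℕ):ℤ)) ((16:ℕ):ℤ)) => h1 j)
          rw [Finset.sum_add_distrib] at h2
          simp at h2
          push_cast
          norm_num at h2 ⊢
          linarith
    nlinarith [sq_nonneg (1 - 2 * p)]

theorem tensorize {κ ι : Type*} [Fintype κ] [DecidableEq κ] [Fintype ι] [DecidableEq ι]
    {p : ℝ} (hp0 : 0 ≤ p) (hp : p ≤ 1) (X : (ι → Bool) → ℝ) (τ B K l : ℝ) (hτ : 0 ≤ τ) (hK : 0 < K)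
    (hl : 0 ≤ l) (hB : PP (wv ι p) (fun C => |X C| ≤ τ) ≤ B) :
    PP (wm κ ι p) (fun A => ∑ r, (X (A r)) ^ 2 ≤ K)
      ≤ Real.exp l * (B + Real.exp (-(l / K * τ ^ 2))) ^ (Fintype.card κ) := by
  have hwv : IsW (wv ι p) := isW_wv hp0 hp
  have hwm : IsW (wm κ ι p) := isW_wm hp0 hp
  have h1 : PP (wm κ ι p) (fun A => ∑ r, (X (A r)) ^ 2 ≤ K)
      ≤ EE (wm κ ι p) (fun A => Real.exp l * ∏ r, Real.exp (-(l / K * (X (A r)) ^ 2))) := by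
    refine EE_mono hwm (fun A => ?_)
    by_cases h : ∑ r, (X (A r)) ^ 2 ≤ K
    · rw [ind_true h, ← Real.exp_sum, ← Real.exp_add]
      apply Real.one_le_exp
      rw [Finset.sum_neg_distrib, ← Finset.mul_sum]
      have : l / K * ∑ r, (X (A r)) ^ 2 ≤ l / K * K := by gcongr
      rw [div_mul_cancel₀ _ hK.ne'] at this; linarith
    · rw [ind_false h]; positivity
  refine h1.trans ?_
  rw [EE_smul, EE_prod (wm κ ι p) (fun r C => Real.exp (-(l / K * (X C) ^ 2)))]
  refine mul_le_mul_of_nonneg_left ?_ (Real.exp_nonneg _)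
  show ∏ _i : κ, EE (wv ι p) (fun C => Real.exp (-(l / K * (X C) ^ 2))) ≤ _
  rw [Finset.prod_const, Finset.card_univ]
  have h2 : EE (wv ι p) (fun C => Real.exp (-(l / K * (X C) ^ 2))) ≤ B + Real.exp (-(l / K * τ ^ 2)) := by
    have : EE (wv ι p) (fun C => Real.exp (-(l / K * (X C) ^ 2)))
       ≤ EE (wv ι p) (fun C => ind (|X C| ≤ τ) + Real.exp (-(l / K * τ ^ 2))) := by
      refine EE_mono hwv (fun C => ?_)
      by_cases h : |X C| ≤ τ
      · rw [ind_true h]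
        have : Real.exp (-(l / K * (X C) ^ 2)) ≤ 1 := by
          apply Real.exp_le_one_iff.2
          have : 0 ≤ l / K * (X C)^2 := by positivity
          linarith
        linarith [Real.exp_nonneg (-(l / K * τ ^ 2))]
      · rw [ind_false h, zero_add]
        apply Real.exp_le_exp.2
        push Not at h
        have : τ ^ 2 ≤ (X C) ^ 2 := by rw [← sq_abs (X C)]; gcongr
        have : l / K * τ ^ 2 ≤ l / K * (X C) ^ 2 := by gcongr
        linarith
    rw [EE_add, EE_const hwv] at this
    unfold PP at hB; linarith
  exact pow_le_pow_left₀ (EE_nonneg hwv (fun _ => Real.exp_nonneg _)) h2 _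

theorem geom_int (x : ℝ) (hx0 : 0 ≤ x) (hx1 : x < 1) (K : ℕ) :
    ∑ a ∈ Finset.Icc (-(K:ℤ)) K, x ^ a.natAbs ≤ (1 + x) / (1 - x) := by
  have hsub : Finset.Icc (-(K:ℤ)) K ⊆ (range (K+1)).image (fun j : ℕ => (j:ℤ)) ∪
      (range K).image (fun j : ℕ => -((j:ℤ) + 1)) := by
    intro a ha
    rw [Finset.mem_Icc] at ha
    rw [Finset.mem_union, Finset.mem_image, Finset.mem_image]
    rcases le_or_gt 0 a with h | h
    · left; exact ⟨a.toNat, by rw [Finset.mem_range]; omega, by omega⟩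
    · right; exact ⟨(-a-1).toNat, by rw [Finset.mem_range]; omega, by omega⟩
  have hg : ∀ M : ℕ, ∑ j ∈ range M, x ^ j ≤ 1 / (1 - x) := by
    intro M
    rw [le_div_iff₀ (by linarith), geom_sum_mul_neg]
    linarith [pow_nonneg hx0 M]
  calc _ ≤ ∑ a ∈ (range (K+1)).image (fun j : ℕ => (j:ℤ)) ∪
      (range K).image (fun j : ℕ => -((j:ℤ) + 1)), x ^ a.natAbs :=
        Finset.sum_le_sum_of_subset_of_nonneg hsub (fun _ _ _ => by positivity)
    _ ≤ ∑ a ∈ (range (K+1)).image (fun j : ℕ => (j:ℤ)), x ^ a.natAbs +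
      ∑ a ∈ (range K).image (fun j : ℕ => -((j:ℤ) + 1)), x ^ a.natAbs := by
        rw [← Finset.sum_union_inter]
        have : 0 ≤ ∑ x_1 ∈ image (fun j : ℕ => (j:ℤ)) (range (K + 1)) ∩ image (fun j : ℕ => -((j:ℤ) + 1)) (range K), x ^ x_1.natAbs :=
          Finset.sum_nonneg (fun _ _ => by positivity)
        linarith
    _ = ∑ j ∈ range (K+1), x ^ j + x * ∑ j ∈ range K, x ^ j := by
        rw [Finset.sum_image (by intro a _ b _ h; simpa using h), Finset.sum_image (by intro a _ b _ h; simpa using h)]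
        congr 1
        rw [Finset.mul_sum]
        refine Finset.sum_congr rfl (fun j _ => ?_)
        rw [← pow_succ']; congr 1
    _ ≤ 1 / (1 - x) + x * (1 / (1 - x)) := by
        gcongr
        · exact hg _
        · exact hg _
    _ = _ := by ring

theorem card_l1 {ι : Type*} [Fintype ι] [DecidableEq ι] (Z : Finset (ι → ℤ)) (S : Finset ι) (K : ℕ)
    (T x : ℝ) (hx0 : 0 < x) (hx1 : x < 1) (hT : ∀ z ∈ Z, ∑ i ∈ S, |(z i : ℝ)| ≤ T)
    (hK : ∀ z ∈ Z, ∀ i, |z i| ≤ K) :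
    (Z.card : ℝ) ≤ (2 * K + 1) ^ (Sᶜ).card * (x⁻¹ ^ T * ((1 + x) / (1 - x)) ^ S.card) := by
  have hsub : Z ⊆ Fintype.piFinset (fun _ : ι => Finset.Icc (-(K:ℤ)) K) := by
    intro z hz; rw [Fintype.mem_piFinset]; intro i
    rw [Finset.mem_Icc]; exact abs_le.1 (hK z hz i)
  have h1 : ∀ z ∈ Z, (1:ℝ) ≤ x⁻¹ ^ T * ∏ i, (if i ∈ S then x ^ (z i).natAbs else 1) := by
    intro z hz
    rw [Finset.prod_ite_mem, Finset.univ_inter, Finset.prod_pow_eq_pow_sum]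
    have : x ^ (∑ i ∈ S, (z i).natAbs) = (x⁻¹ ^ (∑ i ∈ S, |(z i : ℝ)|))⁻¹ := by
      rw [Real.inv_rpow hx0.le, inv_inv]
      rw [← Real.rpow_natCast]; congr 1; push_cast
      refine Finset.sum_congr rfl (fun i _ => ?_)
      rw [Nat.cast_natAbs]; push_cast; rfl
    rw [this, ← div_eq_mul_inv, one_le_div (by positivity)]
    exact Real.rpow_le_rpow_of_exponent_le ((one_le_inv₀ hx0).2 hx1.le) (hT z hz)
  calc (Z.card : ℝ) = ∑ z ∈ Z, (1:ℝ) := by simp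
    _ ≤ ∑ z ∈ Z, x⁻¹ ^ T * ∏ i, (if i ∈ S then x ^ (z i).natAbs else 1) := Finset.sum_le_sum h1
    _ ≤ ∑ z ∈ Fintype.piFinset (fun _ : ι => Finset.Icc (-(K:ℤ)) K),
        x⁻¹ ^ T * ∏ i, (if i ∈ S then x ^ (z i).natAbs else 1) :=
          Finset.sum_le_sum_of_subset_of_nonneg hsub (fun z _ _ => by
            refine mul_nonneg (by positivity) (Finset.prod_nonneg (fun i _ => by split_ifs <;> positivity)))
    _ = x⁻¹ ^ T * ∏ i, ∑ a ∈ Finset.Icc (-(K:ℤ)) K, (if i ∈ S then x ^ a.natAbs else 1) := by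
        rw [← Finset.mul_sum, Finset.prod_univ_sum]
    _ ≤ x⁻¹ ^ T * ∏ i, (if i ∈ S then (1 + x) / (1 - x) else (2 * K + 1)) := by
        refine mul_le_mul_of_nonneg_left ?_ (by positivity)
        refine Finset.prod_le_prod (fun i _ => Finset.sum_nonneg (fun a _ => by split_ifs <;> positivity)) (fun i _ => ?_)
        split_ifs with h
        · exact geom_int x hx0.le hx1 K
        · simp only [Finset.sum_const, Int.card_Icc, nsmul_eq_mul, mul_one]
          have : ((K:ℤ) + 1 - -(K:ℤ)).toNat = 2 * K + 1 := by omega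
          rw [this]; push_cast; exact le_refl _
    _ = _ := by
        rw [← Finset.prod_mul_prod_compl S]
        have a1 : ∏ i ∈ S, (if i ∈ S then (1 + x) / (1 - x) else (2 * (K:ℝ) + 1)) = ((1 + x) / (1 - x)) ^ S.card := by
          rw [Finset.prod_congr rfl (fun i hi => if_pos hi), Finset.prod_const]
        have a2 : ∏ i ∈ Sᶜ, (if i ∈ S then (1 + x) / (1 - x) else (2 * (K:ℝ) + 1)) = (2 * (K:ℝ) + 1) ^ (Sᶜ).card := by
          rw [Finset.prod_congr rfl (fun i hi => if_neg (Finset.mem_compl.1 hi)), Finset.prod_const]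
        rw [a1, a2]; ring

end SCP

namespace SCP

theorem ind_forall {κ : Type*} [Fintype κ] (S : κ → Prop) : ind (∀ r, S r) = ∏ r, ind (S r) := by
  by_cases h : ∀ r, S r
  · rw [ind_true h]; simp [fun r => ind_true (h r)]
  · rw [ind_false h]
    push Not at h
    obtain ⟨r, hr⟩ := h
    exact (Finset.prod_eq_zero (Finset.mem_univ r) (ind_false hr)).symm

theorem zero_col_prob {κ ι : Type*} [Fintype κ] [DecidableEq κ] [Fintype ι] [DecidableEq ι]
    {p : ℝ} (hp0 : 0 ≤ p) (hp : p ≤ 1) (i : ι) :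
    PP (wm κ ι p) (fun A => ∀ r, A r i = false) = (1 - p) ^ (Fintype.card κ) := by
  unfold PP
  simp only [ind_forall]
  rw [EE_prod (wm κ ι p) (fun r C => ind (C i = false))]
  have : ∀ r : κ, ∑ a, wm κ ι p r a * ind (a i = false) = 1 - p := by
    intro r
    have := EE_coord (isW_wv (ι := ι) hp0 hp) i (fun b => ind (b = false))
    rw [sum_bw] at this
    have h2 : ∑ a, wm κ ι p r a * ind (a i = false) = EE (wv ι p) (fun f => ind (f i = false)) := rfl
    rw [h2, this]; simp [ind]
  simp only [this, Finset.prod_const, Finset.card_univ]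

theorem struct_prob {n : ℕ} {p q θ : ℝ} (hq : 0 < q) (hqp : q ≤ p) (hp : p ≤ 1/4)
    (hθ : θ = q ^ 3 / 2 ^ 31) (hn : 1 ≤ θ * n) :
    PP (wm (Fin n) (Fin n) p) (StructBad θ) ≤
      n * (1 - p) ^ n + n * (8 * n + 3) * ((1 - p) ^ n * Real.exp (-(q / 4) * n)) := by
  classical
  have hp0 : 0 ≤ p := by linarith
  have hp1 : p ≤ 1 := by linarith
  have hq1 : q ≤ 1/4 := by linarith
  have hθ0 : 0 < θ := by rw [hθ]; positivity
  have hq2 : q ^ 2 ≤ 1/16 := by nlinarith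
  have hq3 : q ^ 3 ≤ q := by nlinarith
  have hθ1 : θ ≤ 1/16 := by rw [hθ]; linarith
  have hn0 : (0:ℝ) < n := by
    by_contra h; nlinarith
  have hwm := isW_wm (κ := Fin n) (ι := Fin n) hp0 hp1
  set ε := Real.sqrt (q / 40960) with hεd
  have hε : 0 < ε := Real.sqrt_pos.2 (by positivity)
  have hε2 : ε ^ 2 = q / 40960 := Real.sq_sqrt (by positivity)
  have hτ2 : (ε * Real.sqrt n) ^ 2 = q / 40960 * n := by
    rw [mul_pow, hε2, Real.sq_sqrt hn0.le]
  have hτ : 6 ≤ ε * Real.sqrt n := by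
    refine le_of_sq_le_sq ?_ (by positivity)
    rw [hτ2]
    rw [hθ] at hn
    nlinarith
  set Z : Fin n → Finset (Fin n → ℤ) := fun i0 =>
    (Fintype.piFinset (fun _ : Fin n => Finset.Icc (-((4 * n + 1 : ℕ):ℤ)) ((4 * n + 1 : ℕ) : ℤ))).filter (fun z => Net θ i0 z)
  have hZ : ∀ i0 z, Net θ i0 z → z ∈ Z i0 := by
    intro i0 z hz
    simp only [Z, Finset.mem_filter, Fintype.mem_piFinset, Finset.mem_Icc]
    refine ⟨fun i => ?_, hz⟩
    obtain ⟨z1, z2, z3, z4⟩ := hz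
    rw [← abs_le]
    by_cases hi : i = i0
    · rw [hi]; push_cast; exact z1
    · have : |(z i : ℝ)| ≤ 4 * θ * n := le_trans
        (Finset.single_le_sum (f := fun i => |(z i : ℝ)|) (fun _ _ => abs_nonneg _) (Finset.mem_erase.2 ⟨hi, Finset.mem_univ i⟩)) z2
      have : |(z i : ℝ)| ≤ ((4 * n + 1 : ℕ) : ℝ) := by push_cast; nlinarith
      exact_mod_cast this
  -- union
  have hU : PP (wm (Fin n) (Fin n) p) (StructBad θ) ≤
      PP (wm (Fin n) (Fin n) p) (fun A => ∃ i0 ∈ (univ : Finset (Fin n)), ∀ r, A r i0 = false) +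
      PP (wm (Fin n) (Fin n) p) (fun A => ∃ i0 ∈ (univ : Finset (Fin n)), ∃ z ∈ Z i0,
        ∑ r, (XX (fun i => (z i : ℝ)) (A r)) ^ 2 ≤ 32 * θ * n ^ 2) := by
    refine le_trans (PP_mono hwm (fun A hA => ?_)) (PP_or hwm _ _)
    rcases struct_dichotomy hθ0 hθ1 hn A hA with ⟨i0, h⟩ | ⟨i0, z, hz, h⟩
    · exact Or.inl ⟨i0, Finset.mem_univ _, h⟩
    · exact Or.inr ⟨i0, Finset.mem_univ _, z, hZ i0 z hz, h⟩
  have h1 : PP (wm (Fin n) (Fin n) p) (fun A => ∃ i0 ∈ (univ : Finset (Fin n)), ∀ r, A r i0 = false)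
      ≤ n * (1 - p) ^ n := by
    refine (PP_exists hwm _ _).trans ?_
    simp only [zero_col_prob hp0 hp1]; simp
  -- single vector
  have hone : ∀ i0 : Fin n, ∀ z ∈ Z i0, PP (wm (Fin n) (Fin n) p)
      (fun A => ∑ r, (XX (fun i => (z i : ℝ)) (A r)) ^ 2 ≤ 32 * θ * n ^ 2) ≤
      Real.exp (q / 16 * n) * ((1 - p) ^ n * Real.exp (-(15 * q / 32) * n)) := by
    intro i0 z hz
    have hnet : Net θ i0 z := (Finset.mem_filter.1 hz).2
    have hsb := net_small_ball hq hqp (by linarith) hε hε2 hτ i0 z hnet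
    have ht := tensorize (κ := Fin n) hp0 hp1 (XX (fun i => (z i : ℝ))) (ε * Real.sqrt n) _
      (32 * θ * n ^ 2) (q / 16 * n) (by positivity) (by positivity) (by positivity) hsb
    refine ht.trans ?_
    refine mul_le_mul_of_nonneg_left ?_ (Real.exp_nonneg _)
    rw [Fintype.card_fin]
    have hexp : Real.exp (-(q / 16 * n / (32 * θ * n ^ 2) * (ε * Real.sqrt n) ^ 2)) ≤ q / 64 := by
      have e1 : q / 16 * n / (32 * θ * n ^ 2) * (ε * Real.sqrt n) ^ 2 = 2 ^ 9 / (5 * q) := by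
        rw [hτ2, hθ]; field_simp; norm_num
      rw [e1, Real.exp_neg]
      have e2 := Real.add_one_le_exp ((2:ℝ) ^ 9 / (5 * q))
      rw [inv_le_comm₀ (Real.exp_pos _) (by positivity)]
      refine le_trans ?_ e2
      have : (q / 64)⁻¹ = 64 / q := by rw [inv_div]
      rw [this]
      have : (2:ℝ) ^ 9 / (5 * q) = (2^9/5) / q := by field_simp
      rw [this]
      have : 64 / q ≤ (2^9/5) / q := by gcongr; norm_num
      linarith
    have hbase : (1 - p) ^ 2 + p ^ 2 + Real.exp (-(q / 16 * n / (32 * θ * n ^ 2) * (ε * Real.sqrt n) ^ 2))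
        ≤ (1 - p) * Real.exp (-(15 * q / 32)) := by
      have e3 := Real.add_one_le_exp (-(15 * q / 32))
      have : (1 - p) * (-(15 * q / 32) + 1) ≤ (1 - p) * Real.exp (-(15 * q / 32)) := by
        gcongr
      nlinarith
    calc _ ≤ ((1 - p) * Real.exp (-(15 * q / 32))) ^ n := pow_le_pow_left₀ (by positivity) hbase n
      _ = _ := by rw [mul_pow, ← Real.exp_nat_mul]; congr 2; ring
  have hcard : ∀ i0 : Fin n, ((Z i0).card : ℝ) ≤ (8 * n + 3) * (Real.exp (q / 16 * n) * Real.exp (q / 16 * n)) := by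
    intro i0
    have hx1 : q / 64 < 1 := by linarith
    have := card_l1 (Z i0) (univ.erase i0) (4 * n + 1) (4 * θ * n) (q / 64) (by positivity) hx1
      (fun z hz => (Finset.mem_filter.1 hz).2.2.1)
      (fun z hz i => by
        have := (Finset.mem_filter.1 hz).1
        rw [Fintype.mem_piFinset] at this
        have := this i
        rw [Finset.mem_Icc] at this
        exact abs_le.2 this)
    refine this.trans ?_
    have hc : ((univ.erase i0)ᶜ).card = 1 := by
      rw [Finset.compl_erase]; simp
    rw [hc, pow_one]
    push_cast
    have e1 : (q / 64)⁻¹ ^ (4 * θ * n) ≤ Real.exp (q / 16 * n) := by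
      rw [Real.rpow_def_of_pos (by positivity)]
      apply Real.exp_le_exp.2
      have l1 : Real.log (q / 64)⁻¹ ≤ (q / 64)⁻¹ := (Real.log_le_sub_one_of_pos (by positivity)).trans (by linarith)
      calc Real.log (q / 64)⁻¹ * (4 * θ * n) ≤ (q / 64)⁻¹ * (4 * θ * n) := by gcongr
        _ = (256 * q ^ 2 / 2 ^ 31) * n := by rw [hθ]; field_simp; norm_num
        _ ≤ q / 16 * n := mul_le_mul_of_nonneg_right (by nlinarith) hn0.le
    have e2 : ((1 + q / 64) / (1 - q / 64)) ^ (univ.erase i0).card ≤ Real.exp (q / 16 * n) := by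
      have e3 : (1 + q / 64) / (1 - q / 64) ≤ Real.exp (q / 16) := by
        refine le_trans ?_ (Real.add_one_le_exp _)
        rw [div_le_iff₀ (by linarith)]; nlinarith
      have e4 : (1:ℝ) ≤ (1 + q / 64) / (1 - q / 64) := by
        rw [le_div_iff₀ (by linarith)]; linarith
      calc _ ≤ ((1 + q / 64) / (1 - q / 64)) ^ n := by
            refine pow_le_pow_right₀ e4 ?_
            have := Finset.card_le_univ (univ.erase i0); simpa using this
        _ ≤ (Real.exp (q / 16)) ^ n := pow_le_pow_left₀ (by linarith) e3 n
        _ = _ := by rw [← Real.exp_nat_mul]; congr 1; ring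
    have e5 : (2:ℝ) * (4 * n + 1) + 1 = 8 * n + 3 := by ring
    rw [e5]
    gcongr
  have h2 : PP (wm (Fin n) (Fin n) p) (fun A => ∃ i0 ∈ (univ : Finset (Fin n)), ∃ z ∈ Z i0,
        ∑ r, (XX (fun i => (z i : ℝ)) (A r)) ^ 2 ≤ 32 * θ * n ^ 2)
      ≤ n * (8 * n + 3) * ((1 - p) ^ n * Real.exp (-(q / 4) * n)) := by
    refine (PP_exists hwm _ _).trans ?_
    have : ∀ i0 ∈ (univ : Finset (Fin n)), PP (wm (Fin n) (Fin n) p) (fun A => ∃ z ∈ Z i0,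
        ∑ r, (XX (fun i => (z i : ℝ)) (A r)) ^ 2 ≤ 32 * θ * n ^ 2) ≤
        (8 * n + 3) * ((1 - p) ^ n * Real.exp (-(q / 4) * n)) := by
      intro i0 _
      refine (PP_exists hwm _ _).trans ?_
      refine (Finset.sum_le_sum (hone i0)).trans ?_
      rw [Finset.sum_const, nsmul_eq_mul]
      have hpn : 0 ≤ (1 - p) ^ n := pow_nonneg (by linarith) n
      calc _ ≤ (8 * n + 3) * (Real.exp (q / 16 * n) * Real.exp (q / 16 * n)) *
          (Real.exp (q / 16 * n) * ((1 - p) ^ n * Real.exp (-(15 * q / 32) * n))) := by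
            gcongr; exact hcard i0
        _ = (8 * n + 3) * ((1 - p) ^ n * Real.exp (q / 16 * n + q / 16 * n + q / 16 * n + -(15 * q / 32) * n)) := by
            rw [Real.exp_add, Real.exp_add, Real.exp_add]; ring
        _ ≤ _ := by
            gcongr
            nlinarith
    refine (Finset.sum_le_sum this).trans ?_
    simp; ring_nf; rfl
  linarith

end SCP

namespace SCP

section Blocks
variable {β κ ρ ι α : Type*} [Fintype β] [DecidableEq β] [Fintype κ] [DecidableEq κ]
  [Fintype ρ] [DecidableEq ρ] [Fintype ι] [DecidableEq ι] [Fintype α]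

/-- reindexing of functions by blocks -/
def blkEquiv (α : Type*) (e : (β × κ) ⊕ ρ ≃ ι) : (ι → α) ≃ (β → κ → α) × (ρ → α) where
  toFun f := (fun b i => f (e (Sum.inl (b, i))), fun r => f (e (Sum.inr r)))
  invFun g := fun w => Sum.elim (fun x : β × κ => g.1 x.1 x.2) g.2 (e.symm w)
  left_inv f := by
    funext w
    obtain ⟨x, rfl⟩ := e.surjective w
    rcases x with ⟨b, i⟩ | r <;> simp
  right_inv g := by
    ext <;> simp

theorem block_sum {R : Type*} [CommSemiring R] (e : (β × κ) ⊕ ρ ≃ ι) (F : β → (κ → α) → R)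
    (H : ρ → α → R) :
    ∑ f : ι → α, (∏ b, F b (fun i => f (e (Sum.inl (b, i))))) * ∏ r, H r (f (e (Sum.inr r)))
      = (∏ b, ∑ g : κ → α, F b g) * ∏ r, ∑ a, H r a := by
  rw [← sum_prod_eq F, ← sum_prod_eq H, Finset.sum_mul_sum, ← Fintype.sum_prod_type']
  exact Fintype.sum_equiv (blkEquiv α e) _ _ (fun f => rfl)

theorem block_prod {R : Type*} [CommMonoid R] (e : (β × κ) ⊕ ρ ≃ ι) (h : ι → R) :
    ∏ w, h w = (∏ b, ∏ i, h (e (Sum.inl (b, i)))) * ∏ r, h (e (Sum.inr r)) := by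
  rw [← Fintype.prod_equiv e (fun x => h (e x)) h (fun x => rfl), Fintype.prod_sum_type,
    Fintype.prod_prod_type]

/-- one-hot vector -/
def oneHot (i : κ) : κ → Bool := fun j => decide (j = i)

/-- exactly one 1 -/
def one (g : κ → Bool) : Prop := ∃ i, g = oneHot i

theorem oneHot_inj : Function.Injective (oneHot : κ → κ → Bool) := by
  intro i j h
  have := congrFun h i
  simpa [oneHot] using this

theorem sum_one {R : Type*} [CommSemiring R] (h : (κ → Bool) → R) (c : (κ → Bool) → R)
    (hc1 : ∀ g, one g → c g = 1) (hc0 : ∀ g, ¬ one g → c g = 0) :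
    ∑ g, h g * c g = ∑ i, h (oneHot i) := by
  classical
  rw [← Finset.sum_image (s := univ) (g := oneHot) (f := h) (by intro a _ b _ hab; exact oneHot_inj hab)]
  rw [← Finset.sum_subset (Finset.subset_univ (univ.image oneHot))]
  · refine Finset.sum_congr rfl (fun g hg => ?_)
    rw [Finset.mem_image] at hg
    obtain ⟨i, _, rfl⟩ := hg
    rw [hc1 _ ⟨i, rfl⟩, mul_one]
  · intro g _ hg
    rw [hc0, mul_zero]
    rintro ⟨i, rfl⟩
    exact hg (Finset.mem_image_of_mem _ (Finset.mem_univ i))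

theorem pw_oneHot (p : ℝ) (i : κ) : pw (wv κ p) (oneHot i) = p * (1 - p) ^ (Fintype.card κ - 1) := by
  unfold pw
  rw [← Finset.mul_prod_erase _ _ (Finset.mem_univ i)]
  congr 1
  · simp [oneHot, bw]
  · have : ∀ x ∈ univ.erase i, wv κ p x (oneHot i x) = 1 - p := by
      intro x hx
      have := Finset.ne_of_mem_erase hx
      simp [oneHot, bw, this]
    rw [Finset.prod_congr rfl this, Finset.prod_const, Finset.card_erase_of_mem (Finset.mem_univ i), Finset.card_univ]

theorem XX_oneHot (Y : κ → ℝ) (i : κ) : XX Y (oneHot i) = Y i := by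
  unfold XX oneHot; simp

/-- probability of exactly one -/
noncomputable def pone (κ : Type*) [Fintype κ] (p : ℝ) : ℝ :=
  (Fintype.card κ) * (p * (1 - p) ^ (Fintype.card κ - 1))

theorem prob_one (p : ℝ) : ∑ g : κ → Bool, pw (wv κ p) g * ind (one g) = pone κ p := by
  rw [sum_one (pw (wv κ p)) (fun g => ind (one g)) (fun g h => ind_true h) (fun g h => ind_false h)]
  simp only [pw_oneHot]; simp [pone]

theorem prob_not_one {p : ℝ} (h0 : 0 ≤ p) (h1 : p ≤ 1) :
    ∑ g : κ → Bool, pw (wv κ p) g * ind (¬ one g) = 1 - pone κ p := by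
  simp only [ind_not, mul_sub, mul_one, Finset.sum_sub_distrib, prob_one]
  have := EE_one (isW_wv (ι := κ) h0 h1)
  unfold EE at this; simp only [mul_one] at this
  rw [this]

theorem pone_mem {p : ℝ} (h0 : 0 ≤ p) (h1 : p ≤ 1) : 0 ≤ pone κ p ∧ pone κ p ≤ 1 := by
  constructor
  · rw [← prob_one]
    exact Finset.sum_nonneg (fun g _ => mul_nonneg (pw_nonneg (isW_wv h0 h1) g) (ind_nonneg _))
  · have : 0 ≤ 1 - pone κ p := by
      rw [← prob_not_one h0 h1]
      exact Finset.sum_nonneg (fun g _ => mul_nonneg (pw_nonneg (isW_wv h0 h1) g) (ind_nonneg _))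
    linarith

/-- block restriction -/
def blk {α : Type*} (e : (β × κ) ⊕ ρ ≃ ι) (f : ι → α) (b : β) : κ → α := fun i => f (e (Sum.inl (b, i)))

open Classical in
/-- set of blocks with exactly one 1 -/
noncomputable def GG (e : (β × κ) ⊕ ρ ≃ ι) (C : ι → Bool) : Finset β :=
  univ.filter (fun b => one (blk e C b))

/-- good columns -/
def Good (e : (β × κ) ⊕ ρ ≃ ι) (C : ι → Bool) : Prop := Fintype.card β ≤ 10 * (GG e C).card

theorem ind_GG (e : (β × κ) ⊕ ρ ≃ ι) (C : ι → Bool) (G : Finset β) :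
    ind (GG e C = G) = ∏ b, (if b ∈ G then ind (one (blk e C b)) else ind (¬ one (blk e C b))) := by
  have hmem : ∀ b, b ∈ GG e C ↔ one (blk e C b) := by
    intro b; unfold GG; simp
  have : (GG e C = G) ↔ ∀ b, (if b ∈ G then one (blk e C b) else ¬ one (blk e C b)) := by
    constructor
    · rintro rfl b
      split_ifs with h
      · exact (hmem b).1 h
      · intro h'; exact h ((hmem b).2 h')
    · intro h
      ext b
      have hb := h b
      rw [hmem]
      split_ifs at hb with h'
      · simp [h', hb]
      · simp [h', hb]
  rw [show ind (GG e C = G) = ind (∀ b, (if b ∈ G then one (blk e C b) else ¬ one (blk e C b))) by rw [this],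
    ind_forall]
  refine Finset.prod_congr rfl (fun b _ => ?_)
  split_ifs <;> rfl

theorem pw_block (e : (β × κ) ⊕ ρ ≃ ι) (p : ℝ) (C : ι → Bool) :
    pw (wv ι p) C = (∏ b, pw (wv κ p) (blk e C b)) * ∏ r, bw p (C (e (Sum.inr r))) := by
  unfold pw; rw [block_prod e]; rfl

theorem prob_GG (e : (β × κ) ⊕ ρ ≃ ι) {p : ℝ} (h0 : 0 ≤ p) (h1 : p ≤ 1) (G : Finset β) :
    ∑ C, pw (wv ι p) C * ind (GG e C = G) =
      pone κ p ^ G.card * (1 - pone κ p) ^ (Fintype.card β - G.card) := by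
  have h : ∀ C, pw (wv ι p) C * ind (GG e C = G) =
      (∏ b, (fun b g => pw (wv κ p) g * (if b ∈ G then ind (one g) else ind (¬ one g))) b
        (fun i => C (e (Sum.inl (b, i))))) * ∏ r, (fun _ a => bw p a) r (C (e (Sum.inr r))) := by
    intro C
    rw [ind_GG, pw_block e]
    simp only [Finset.prod_mul_distrib]
    unfold blk
    ring
  rw [Finset.sum_congr rfl (fun C _ => h C),
    block_sum e (fun b g => pw (wv κ p) g * (if b ∈ G then ind (one g) else ind (¬ one g))) (fun _ a => bw p a)]
  have e1 : ∏ r : ρ, ∑ a, bw p a = 1 := by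
    refine Finset.prod_eq_one (fun r _ => ?_); simp [bw]
  rw [e1, mul_one, ← Finset.prod_mul_prod_compl G]
  have a1 : ∀ b ∈ G, ∑ g : κ → Bool, pw (wv κ p) g * (if b ∈ G then ind (one g) else ind (¬ one g)) = pone κ p := by
    intro b hb; simp only [if_pos hb]; exact prob_one p
  have a2 : ∀ b ∈ Gᶜ, ∑ g : κ → Bool, pw (wv κ p) g * (if b ∈ G then ind (one g) else ind (¬ one g)) = 1 - pone κ p := by
    intro b hb; simp only [if_neg (Finset.mem_compl.1 hb)]; exact prob_not_one h0 h1
  rw [Finset.prod_congr rfl a1, Finset.prod_congr rfl a2, Finset.prod_const, Finset.prod_const, Finset.card_compl]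

/-- product of block averages of characters -/
noncomputable def FG (e : (β × κ) ⊕ ρ ≃ ι) (z : ι → ℝ) (G : Finset β) (s : ℝ) : ℝ :=
  ∏ b ∈ G, (‖∑ i : κ, cx (s * z (e (Sum.inl (b, i))))‖ / Fintype.card κ)

theorem cx_block (e : (β × κ) ⊕ ρ ≃ ι) (s : ℝ) (z : ι → ℝ) (C : ι → Bool) :
    cx (s * XX z C) = (∏ b, cx (s * XX (blk e z b) (blk e C b))) *
      ∏ r, (if C (e (Sum.inr r)) then cx (s * z (e (Sum.inr r))) else 1) := by
  rw [cx_XX, block_prod e]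
  congr 1
  refine Finset.prod_congr rfl (fun b _ => ?_)
  rw [cx_XX]; rfl

theorem char_GG (e : (β × κ) ⊕ ρ ≃ ι) {p : ℝ} (h0 : 0 ≤ p) (h1 : p ≤ 1/2) (G : Finset β) (z : ι → ℝ) (s : ℝ)
    (hκ : 0 < Fintype.card κ) :
    ‖∑ C, ((pw (wv ι p) C * ind (GG e C = G) : ℝ) : ℂ) * cx (s * XX z C)‖ ≤
      (pone κ p ^ G.card * (1 - pone κ p) ^ (Fintype.card β - G.card)) * FG e z G s := by
  have hp1 : p ≤ 1 := by linarith
  have h : ∀ C, ((pw (wv ι p) C * ind (GG e C = G) : ℝ) : ℂ) * cx (s * XX z C) =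
      (∏ b, (fun b g => ((pw (wv κ p) g * (if b ∈ G then ind (one g) else ind (¬ one g)) : ℝ) : ℂ)
          * cx (s * XX (blk e z b) g)) b
        (fun i => C (e (Sum.inl (b, i))))) * ∏ r, (fun r (a : Bool) => (bw p a : ℂ) * (if a = true then cx (s * z (e (Sum.inr r))) else 1)) r (C (e (Sum.inr r))) := by
    intro C
    rw [ind_GG, pw_block e, cx_block e]
    simp only [Finset.prod_mul_distrib]
    unfold blk
    push_cast
    rw [Finset.prod_mul_distrib]
    ring
  rw [Finset.sum_congr rfl (fun C _ => h C),
    block_sum e (fun b g => ((pw (wv κ p) g * (if b ∈ G then ind (one g) else ind (¬ one g)) : ℝ) : ℂ)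
          * cx (s * XX (blk e z b) g)) (fun r (a : Bool) => (bw p a : ℂ) * (if a = true then cx (s * z (e (Sum.inr r))) else 1)), norm_mul, norm_prod, norm_prod]
  have e1 : ∏ r : ρ, ‖∑ a : Bool, (bw p a : ℂ) * (if a = true then cx (s * z (e (Sum.inr r))) else 1)‖ ≤ 1 := by
    refine Finset.prod_le_one (fun _ _ => norm_nonneg _) (fun r _ => ?_)
    rw [sum_bw_complex]
    simpa using phi_norm_le_one p (s * z (e (Sum.inr r))) h0 h1
  refine (mul_le_of_le_one_right (Finset.prod_nonneg (fun _ _ => norm_nonneg _)) e1).trans ?_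
  rw [← Finset.prod_mul_prod_compl G]
  have a1 : ∀ b ∈ G, ‖∑ g : κ → Bool, ((pw (wv κ p) g * (if b ∈ G then ind (one g) else ind (¬ one g)) : ℝ) : ℂ)
          * cx (s * XX (blk e z b) g)‖ = pone κ p * (‖∑ i : κ, cx (s * z (e (Sum.inl (b, i))))‖ / Fintype.card κ) := by
    intro b hb
    simp only [if_pos hb]
    have := sum_one (fun g : κ → Bool => (pw (wv κ p) g : ℂ) * cx (s * XX (blk e z b) g)) (fun g => (ind (one g) : ℂ))
      (fun g h => by rw [ind_true h]; simp) (fun g h => by rw [ind_false h]; simp)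
    have e2 : ∑ g : κ → Bool, ((pw (wv κ p) g * ind (one g) : ℝ) : ℂ) * cx (s * XX (blk e z b) g)
       = ∑ i : κ, (pw (wv κ p) (oneHot i) : ℂ) * cx (s * XX (blk e z b) (oneHot i)) := by
      rw [← this]; refine Finset.sum_congr rfl (fun g _ => ?_); push_cast; ring
    rw [e2]
    simp only [pw_oneHot, XX_oneHot]
    rw [← Finset.mul_sum, norm_mul, Complex.norm_real, Real.norm_of_nonneg (mul_nonneg h0 (pow_nonneg (by linarith) _))]
    unfold pone blk
    have : (Fintype.card κ : ℝ) ≠ 0 := by exact_mod_cast hκ.ne'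
    field_simp
  have a2 : ∀ b ∈ Gᶜ, ‖∑ g : κ → Bool, ((pw (wv κ p) g * (if b ∈ G then ind (one g) else ind (¬ one g)) : ℝ) : ℂ)
          * cx (s * XX (blk e z b) g)‖ ≤ 1 - pone κ p := by
    intro b hb
    simp only [if_neg (Finset.mem_compl.1 hb)]
    rw [← prob_not_one h0 hp1]
    refine (norm_sum_le _ _).trans (Finset.sum_le_sum (fun g _ => ?_))
    rw [norm_mul, cx_norm, mul_one, Complex.norm_real, Real.norm_of_nonneg]
    exact mul_nonneg (pw_nonneg (isW_wv h0 hp1) g) (ind_nonneg _)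
  rw [Finset.prod_congr rfl a1, Finset.prod_mul_distrib, Finset.prod_const]
  have a3 := Finset.prod_le_prod (fun _ _ => norm_nonneg _) a2
  rw [Finset.prod_const, Finset.card_compl] at a3
  unfold FG
  have : 0 ≤ ∏ b ∈ G, (‖∑ i : κ, cx (s * z (e (Sum.inl (b, i))))‖ / Fintype.card κ) :=
    Finset.prod_nonneg (fun _ _ => by positivity)
  have h3 : 0 ≤ pone κ p := (pone_mem h0 hp1).1
  calc _ ≤ pone κ p ^ G.card * (∏ b ∈ G, (‖∑ i : κ, cx (s * z (e (Sum.inl (b, i))))‖ / Fintype.card κ)) *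
        (1 - pone κ p) ^ (Fintype.card β - G.card) := mul_le_mul_of_nonneg_left a3 (by positivity)
    _ = _ := by ring

theorem sum_PG (x : ℝ) : ∑ G : Finset β, x ^ G.card * (1 - x) ^ (Fintype.card β - G.card) = 1 := by
  have := Fintype.sum_pow_mul_eq_add_pow β x (1 - x)
  rw [this]; simp

theorem not_good_prob (e : (β × κ) ⊕ ρ ≃ ι) {p : ℝ} (h0 : 0 ≤ p) (h1 : p ≤ 1) (hpi : 1/5 ≤ pone κ p) :
    PP (wv ι p) (fun C => ¬ Good e C) ≤ (965/1000) ^ (Fintype.card β) := by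
  have hw := isW_wv (ι := ι) h0 h1
  obtain ⟨p0, p1⟩ := pone_mem (κ := κ) h0 h1
  set x := pone κ p
  set u : ℝ := 107/100
  have h : PP (wv ι p) (fun C => ¬ Good e C) ≤ EE (wv ι p) (fun C => ∑ G : Finset β,
      (u ^ (Fintype.card β) * ((u ^ 10)⁻¹) ^ G.card) * ind (GG e C = G)) := by
    refine EE_mono hw (fun C => ?_)
    rw [Finset.sum_eq_single (GG e C)]
    · rw [ind_true rfl, mul_one]
      by_cases hg : Good e C
      · rw [ind_false (by simpa using hg)]; positivity
      · rw [ind_true hg]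
        unfold Good at hg
        push Not at hg
        rw [inv_pow, ← div_eq_mul_inv, one_le_div (by positivity), ← pow_mul]
        exact pow_le_pow_right₀ (by norm_num [u]) hg.le
    · intro G _ hG
      rw [ind_false (fun h => hG h.symm), mul_zero]
    · simp
  refine h.trans ?_
  rw [EE_sum]
  have h2 : ∀ G : Finset β, EE (wv ι p) (fun C => (u ^ (Fintype.card β) * ((u ^ 10)⁻¹) ^ G.card) * ind (GG e C = G))
      = u ^ (Fintype.card β) * ((x * (u ^ 10)⁻¹) ^ G.card * (1 - x) ^ (Fintype.card β - G.card)) := by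
    intro G
    rw [EE_smul]
    have := prob_GG e h0 h1 G
    unfold EE
    rw [this, mul_pow]; ring
  simp only [h2]
  rw [← Finset.mul_sum, Fintype.sum_pow_mul_eq_add_pow, ← mul_pow]
  refine pow_le_pow_left₀ ?_ ?_ _
  · have : (0:ℝ) ≤ (u ^ 10)⁻¹ := by positivity
    have : 0 ≤ x * (u ^ 10)⁻¹ := by positivity
    have : 0 ≤ 1 - x := by linarith
    positivity
  · have : (u ^ 10)⁻¹ ≤ 51/100 := by norm_num [u]
    have : x * (u ^ 10)⁻¹ ≤ x * (51/100) := by gcongr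
    simp only [u] at *
    linarith

end Blocks

end SCP

namespace SCP

theorem sum_Ioo_succ (N : ℕ) (hN : 1 ≤ N) (h : ℤ → ℝ) :
    ∑ j ∈ Ioo (-((N + 1 : ℕ) : ℤ)) ((N + 1 : ℕ) : ℤ), h j = ∑ j ∈ Ioo (-(N : ℤ)) N, h j + h N + h (-N) := by
  have : Ioo (-((N + 1 : ℕ) : ℤ)) ((N + 1 : ℕ) : ℤ) = insert (N : ℤ) (insert (-(N : ℤ)) (Ioo (-(N : ℤ)) N)) := by
    ext j; simp only [mem_Ioo, mem_insert]; push_cast; omega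
  rw [this, Finset.sum_insert, Finset.sum_insert]
  · ring
  · simp
  · simp; omega

theorem sum_g_le (N : ℕ) (hN : 1 ≤ N) : ∑ j ∈ Ioo (-(N : ℤ)) N, 1 / (1 + (j : ℝ) ^ 2) ≤ 5 - 4 / (N : ℝ) := by
  induction N, hN using Nat.le_induction with
  | base =>
    have : Ioo (-((1 : ℕ) : ℤ)) (1 : ℕ) = {0} := by decide
    rw [this]; norm_num
  | succ N hN ih =>
    rw [sum_Ioo_succ N hN]
    have hN' : (1 : ℝ) ≤ N := by exact_mod_cast hN
    have h1 : 1 / (1 + (N : ℝ) ^ 2) + 1 / (1 + (-(N : ℝ)) ^ 2) ≤ 4 / N - 4 / (N + 1) := by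
      rw [neg_sq, ← two_mul, div_sub_div _ _ (by positivity) (by positivity), mul_one_div,
        div_le_div_iff₀ (by positivity) (by positivity)]
      nlinarith
    push_cast
    linarith

theorem sum_exp_le (a : ℝ) (ha : 0 < a) (N : ℕ) (hN : 1 ≤ N) :
    ∑ j ∈ Ioo (-(N : ℤ)) N, Real.exp (-a * (j : ℝ) ^ 2) ≤ 1 + 2 / a * (1 - Real.exp (-a * ((N : ℝ) - 1))) := by
  induction N, hN using Nat.le_induction with
  | base =>
    have : Ioo (-((1 : ℕ) : ℤ)) (1 : ℕ) = {0} := by decide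
    rw [this]; norm_num
  | succ N hN ih =>
    rw [sum_Ioo_succ N hN]
    have hN' : (1 : ℝ) ≤ N := by exact_mod_cast hN
    have h1 : Real.exp (-a * (N : ℝ) ^ 2) ≤ Real.exp (-a * N) := by
      apply Real.exp_le_exp.2; nlinarith [mul_nonneg ha.le (by nlinarith : 0 ≤ (N:ℝ)^2 - N)]
    have h2 : Real.exp (-a * ((N : ℝ) - 1)) = Real.exp (-a * N) * Real.exp a := by
      rw [← Real.exp_add]; congr 1; ring
    have h3 : a + 1 ≤ Real.exp a := Real.add_one_le_exp a
    have h4 := Real.exp_pos (-a * N)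
    have h5 : Real.exp (-a * N) ≤ 1 / a * (Real.exp (-a * ((N : ℝ) - 1)) - Real.exp (-a * N)) := by
      rw [h2, one_div, inv_mul_eq_div, le_div_iff₀ ha]
      nlinarith
    have e1 : ((-(N : ℤ) : ℤ) : ℝ) ^ 2 = (N : ℝ) ^ 2 := by push_cast; ring
    rw [e1]
    push_cast at *
    have e2 : -a * ((N : ℝ) + 1 - 1) = -a * N := by ring
    rw [e2]
    have e3 : 2 / a * (1 - Real.exp (-a * N)) = 2 / a * (1 - Real.exp (-a * ((N : ℝ) - 1))) +
      2 * (1 / a * (Real.exp (-a * ((N : ℝ) - 1)) - Real.exp (-a * N))) := by ring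
    rw [e3]
    linarith

theorem card_abs_le (s : Finset ℤ) (x : ℝ) (hx : 0 ≤ x) (h : ∀ j ∈ s, |(j : ℝ)| ≤ x) : (s.card : ℝ) ≤ 2 * x + 1 := by
  have : s ⊆ Icc (-⌊x⌋) ⌊x⌋ := by
    intro j hj
    have := h j hj
    rw [← Int.cast_abs] at this
    have := Int.le_floor.2 this
    rw [mem_Icc]; exact abs_le.1 this
  have h1 := Finset.card_le_card this
  rw [Int.card_Icc] at h1
  have hf : 0 ≤ ⌊x⌋ := Int.floor_nonneg.2 hx
  have h2 : (s.card : ℤ) ≤ 2 * ⌊x⌋ + 1 := by omega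
  have h3 : (s.card : ℝ) ≤ 2 * ⌊x⌋ + 1 := by exact_mod_cast h2
  have := Int.floor_le x
  linarith

/-- kernel -/
noncomputable def gk (x : ℝ) : ℝ := 1 / (1 + x ^ 2)

theorem gk_pos (x : ℝ) : 0 < gk x := by unfold gk; positivity
theorem gk_le_one (x : ℝ) : gk x ≤ 1 := by
  unfold gk; rw [div_le_one (by positivity)]; nlinarith

section LO
variable {β κ ρ ι : Type*} [Fintype β] [DecidableEq β] [Fintype κ] [DecidableEq κ]
  [Fintype ρ] [DecidableEq ρ] [Fintype ι] [DecidableEq ι]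

theorem sum_good (e : (β × κ) ⊕ ρ ≃ ι) (C : ι → Bool) :
    ind (Good e C) = ∑ G ∈ univ.filter (fun G : Finset β => Fintype.card β ≤ 10 * G.card), ind (GG e C = G) := by
  by_cases h : Good e C
  · rw [ind_true h, Finset.sum_eq_single (GG e C)]
    · rw [ind_true rfl]
    · intro G _ hG; exact ind_false (fun h => hG h.symm)
    · intro h'; exact absurd (by simpa [Good] using h) h'
  · rw [ind_false h]
    symm
    refine Finset.sum_eq_zero (fun G hG => ind_false ?_)
    rintro rfl
    exact h (by unfold Good; simpa using hG)

theorem char_good (e : (β × κ) ⊕ ρ ≃ ι) {p : ℝ} (h0 : 0 ≤ p) (h1 : p ≤ 1/2) (z : ι → ℝ) (s : ℝ)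
    (hκ : 0 < Fintype.card κ) :
    ‖∑ C, ((pw (wv ι p) C * ind (Good e C) : ℝ) : ℂ) * cx (s * XX z C)‖ ≤
     ∑ G ∈ univ.filter (fun G : Finset β => Fintype.card β ≤ 10 * G.card),
      (pone κ p ^ G.card * (1 - pone κ p) ^ (Fintype.card β - G.card)) * FG e z G s := by
  have : ∀ C, ((pw (wv ι p) C * ind (Good e C) : ℝ) : ℂ) * cx (s * XX z C) =
      ∑ G ∈ univ.filter (fun G : Finset β => Fintype.card β ≤ 10 * G.card),
       ((pw (wv ι p) C * ind (GG e C = G) : ℝ) : ℂ) * cx (s * XX z C) := by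
    intro C
    rw [sum_good, Finset.mul_sum, ← Finset.sum_mul]
    push_cast; rfl
  rw [Finset.sum_congr rfl (fun C _ => this C), Finset.sum_comm]
  refine (norm_sum_le _ _).trans (Finset.sum_le_sum (fun G _ => char_GG e h0 h1 G z s hκ))

theorem char_good2 (e : (β × κ) ⊕ ρ ≃ ι) {p : ℝ} (h0 : 0 ≤ p) (h1 : p ≤ 1/2) (z : ι → ℝ) (s : ℝ) :
    ‖∑ C, ((pw (wv ι p) C * ind (Good e C) : ℝ) : ℂ) * cx (s * XX z C)‖ ≤
     ‖∑ C, (pw (wv ι p) C : ℂ) * cx (s * XX z C)‖ + PP (wv ι p) (fun C => ¬ Good e C) := by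
  have hw := isW_wv (ι := ι) h0 (by linarith : p ≤ 1)
  have : ∑ C, ((pw (wv ι p) C * ind (Good e C) : ℝ) : ℂ) * cx (s * XX z C) =
     ∑ C, (pw (wv ι p) C : ℂ) * cx (s * XX z C) - ∑ C, ((pw (wv ι p) C * ind (¬ Good e C) : ℝ) : ℂ) * cx (s * XX z C) := by
    rw [← Finset.sum_sub_distrib]
    refine Finset.sum_congr rfl (fun C _ => ?_)
    rw [ind_not]; push_cast; ring
  rw [this]
  refine (norm_sub_le _ _).trans (add_le_add le_rfl ?_)
  refine (norm_sum_le _ _).trans (Finset.sum_le_sum (fun C _ => ?_))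
  rw [norm_mul, cx_norm, mul_one, Complex.norm_real, Real.norm_of_nonneg]
  exact mul_nonneg (pw_nonneg hw C) (ind_nonneg _)

/-- niceness of a vector at scale N -/
def Nice (e : (β × κ) ⊕ ρ ≃ ι) (N : ℕ) (sn c : ℝ) (z : ι → ℝ) : Prop :=
  ∀ G : Finset β, Fintype.card β ≤ 10 * G.card →
    ∑ j ∈ (Ioo (-(N : ℤ)) N).filter (fun j : ℤ => c * sn < |(j : ℝ)|), FG e z G ((j : ℝ) / (N * sn)) ≤ 1

theorem FG_nonneg (e : (β × κ) ⊕ ρ ≃ ι) (z : ι → ℝ) (G : Finset β) (s : ℝ) : 0 ≤ FG e z G s :=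
  Finset.prod_nonneg (fun _ _ => by positivity)

theorem lo_window (e : (β × κ) ⊕ ρ ≃ ι) {p q θ δ sn : ℝ} (hκ : 0 < Fintype.card κ)
    (hq : 0 < q) (hqp : q ≤ p) (h1 : p ≤ 1/2) (hθ : 0 < θ) (hδ : 0 < δ) (hsn : 0 < sn) (N : ℕ) (hN : 1 ≤ N)
    (z : ι → ℝ) (S : Finset ι) (hS : δ * sn ^ 2 ≤ S.card)
    (hz : ∀ w ∈ S, θ / 4 * N ≤ |z w| ∧ |z w| ≤ 5 / θ * N)
    (hnice : Nice e N sn (θ / 2) z)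
    (hng : (θ * sn + 1) * PP (wv ι p) (fun C => ¬ Good e C) ≤ 1) (v : ℝ) :
    EE (wv ι p) (fun C => ind (Good e C) * ind (|XX z C - v| ≤ sn)) ≤
      4 / N * (3 + 2 / (q * δ * θ ^ 2 / 160)) := by
  have h0 : 0 ≤ p := by linarith
  have hw := isW_wv (ι := ι) h0 (by linarith : p ≤ 1)
  have hN' : (0 : ℝ) < N := by exact_mod_cast hN
  set a := q * δ * θ ^ 2 / 160 with ha
  have ha0 : 0 < a := by positivity
  have hes := esseen (fun C => pw (wv ι p) C * ind (Good e C)) (fun C => mul_nonneg (pw_nonneg hw C) (ind_nonneg _))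
    (XX z) sn v hsn N hN
  have e0 : EE (wv ι p) (fun C => ind (Good e C) * ind (|XX z C - v| ≤ sn)) =
     ∑ C, pw (wv ι p) C * ind (Good e C) * ind (|XX z C - v| ≤ sn) := by
    unfold EE; refine Finset.sum_congr rfl (fun C _ => by ring)
  rw [e0]
  refine hes.trans ?_
  refine mul_le_mul_of_nonneg_left ?_ (by positivity)
  rw [← Finset.sum_filter_add_sum_filter_not _ (fun j : ℤ => θ / 2 * sn < |(j : ℝ)|)]
  have hA : ∑ j ∈ (Ioo (-(N : ℤ)) N).filter (fun j : ℤ => θ / 2 * sn < |(j : ℝ)|),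
      ‖∑ C, ((pw (wv ι p) C * ind (Good e C) : ℝ) : ℂ) * cx ((j : ℝ) / (N * sn) * XX z C)‖ ≤ 1 := by
    refine (Finset.sum_le_sum (fun j _ => char_good e h0 h1 z _ hκ)).trans ?_
    rw [Finset.sum_comm]
    refine le_of_le_of_eq ?_ (sum_PG (β := β) (pone κ p))
    obtain ⟨p0, p1⟩ := pone_mem (κ := κ) h0 (by linarith : p ≤ 1)
    have hnn : ∀ G : Finset β, 0 ≤ pone κ p ^ G.card * (1 - pone κ p) ^ (Fintype.card β - G.card) := by
      intro G; have : 0 ≤ 1 - pone κ p := by linarith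
      positivity
    refine (Finset.sum_le_sum (fun G hG => ?_)).trans (Finset.sum_le_univ_sum_of_nonneg hnn)
    rw [← Finset.mul_sum]
    exact mul_le_of_le_one_right (hnn G) (hnice G (by simpa using hG))
  have hB : ∑ j ∈ (Ioo (-(N : ℤ)) N).filter (fun j : ℤ => ¬ θ / 2 * sn < |(j : ℝ)|),
      ‖∑ C, ((pw (wv ι p) C * ind (Good e C) : ℝ) : ℂ) * cx ((j : ℝ) / (N * sn) * XX z C)‖ ≤ 2 + 2 / a := by
    have hb : ∀ j ∈ (Ioo (-(N : ℤ)) N).filter (fun j : ℤ => ¬ θ / 2 * sn < |(j : ℝ)|),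
       ‖∑ C, ((pw (wv ι p) C * ind (Good e C) : ℝ) : ℂ) * cx ((j : ℝ) / (N * sn) * XX z C)‖
        ≤ Real.exp (-a * (j : ℝ) ^ 2) + PP (wv ι p) (fun C => ¬ Good e C) := by
      intro j hj
      rw [Finset.mem_filter, not_lt] at hj
      refine (char_good2 e h0 h1 z _).trans (add_le_add ?_ le_rfl)
      have hsmall : ∀ w ∈ S, |(j : ℝ) / (N * sn) * z w| ≤ Real.pi := by
        intro w hw
        rw [abs_mul, abs_div, abs_of_pos (by positivity : 0 < N * sn)]
        have h3 : |(j : ℝ)| / (N * sn) * |z w| ≤ (θ / 2 * sn) / (N * sn) * (5 / θ * N) := by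
          have := (hz w hw).2
          gcongr
          exact hj.2
        have h4 : (θ / 2 * sn) / (N * sn) * (5 / θ * N) = 5 / 2 := by field_simp
        have := Real.pi_gt_three
        linarith
      refine (char_le p _ h0 h1 z S hsmall).trans ?_
      apply Real.exp_le_exp.2
      have h5 : ∑ w ∈ S, ((j : ℝ) / (N * sn) * z w) ^ 2 ≥ S.card * ((j : ℝ) ^ 2 / (N * sn) ^ 2 * (θ / 4 * N) ^ 2) := by
        rw [ge_iff_le, ← nsmul_eq_mul (S.card)]
        refine Finset.card_nsmul_le_sum _ _ _ (fun w hw => ?_)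
        rw [mul_pow ((j : ℝ) / (N * sn)), div_pow]
        refine mul_le_mul_of_nonneg_left ?_ (by positivity)
        rw [← sq_abs (z w)]
        exact pow_le_pow_left₀ (by positivity) (hz w hw).1 2
      have h6 : (S.card : ℝ) * ((j : ℝ) ^ 2 / (N * sn) ^ 2 * (θ / 4 * N) ^ 2) ≥
         (δ * sn ^ 2) * ((j : ℝ) ^ 2 / (N * sn) ^ 2 * (θ / 4 * N) ^ 2) :=
        mul_le_mul_of_nonneg_right hS (by positivity)
      have h7 : (δ * sn ^ 2) * ((j : ℝ) ^ 2 / (N * sn) ^ 2 * (θ / 4 * N) ^ 2) = δ * θ ^ 2 / 16 * (j : ℝ) ^ 2 := by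
        field_simp; ring
      rw [h7] at h6
      have h8 := h6.le.trans h5.le
      have h9 : a * (j : ℝ) ^ 2 ≤ p / 10 * (δ * θ ^ 2 / 16 * (j : ℝ) ^ 2) := by
        have : a * (j : ℝ) ^ 2 = q / 10 * (δ * θ ^ 2 / 16 * (j : ℝ) ^ 2) := by rw [ha]; ring
        rw [this]; gcongr
      have h10 : p / 10 * (δ * θ ^ 2 / 16 * (j : ℝ) ^ 2) ≤ p / 10 * ∑ w ∈ S, ((j : ℝ) / (N * sn) * z w) ^ 2 :=
        mul_le_mul_of_nonneg_left h8 (by positivity)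
      linarith
    refine (Finset.sum_le_sum hb).trans ?_
    rw [Finset.sum_add_distrib, Finset.sum_const, nsmul_eq_mul]
    have c1 : ∑ j ∈ (Ioo (-(N : ℤ)) N).filter (fun j : ℤ => ¬ θ / 2 * sn < |(j : ℝ)|), Real.exp (-a * (j : ℝ) ^ 2)
        ≤ 1 + 2 / a := by
      refine (Finset.sum_le_sum_of_subset_of_nonneg (Finset.filter_subset _ _) (fun _ _ _ => (Real.exp_pos _).le)).trans ?_
      refine (sum_exp_le a ha0 N hN).trans ?_
      have := Real.exp_pos (-a * ((N : ℝ) - 1))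
      have h2a : 0 < 2 / a := by positivity
      nlinarith
    have c2 := card_abs_le ((Ioo (-(N : ℤ)) N).filter (fun j : ℤ => ¬ θ / 2 * sn < |(j : ℝ)|)) (θ / 2 * sn) (by positivity)
      (fun j hj => by rw [Finset.mem_filter, not_lt] at hj; exact hj.2)
    have c3 := mul_le_mul_of_nonneg_right c2 (PP_nonneg hw (fun C => ¬ Good e C))
    have c4 : (2 * (θ / 2 * sn) + 1) = θ * sn + 1 := by ring
    rw [c4] at c3
    linarith
  linarith

theorem gk_le_windows (x : ℝ) (R : Finset ℤ) (hR : round (x / 2) ∈ R) :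
    gk x ≤ ∑ s ∈ R, 1 / (1 + (s : ℝ) ^ 2) * ind (|x - 2 * s| ≤ 1) := by
  have h1 : |x - 2 * (round (x / 2) : ℝ)| ≤ 1 := by
    have := abs_sub_round (x / 2)
    rw [abs_le] at *; constructor <;> linarith [this.1, this.2]
  refine le_trans ?_ (Finset.single_le_sum (f := fun s : ℤ => 1 / (1 + (s : ℝ) ^ 2) * ind (|x - 2 * s| ≤ 1))
    (fun s _ => mul_nonneg (by positivity) (ind_nonneg _)) hR)
  simp only [ind_true h1, mul_one]
  unfold gk
  set s := round (x / 2)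
  apply one_div_le_one_div_of_le (by positivity)
  have h2 : (s : ℝ) ^ 2 ≤ x ^ 2 := by
    rw [sq_le_sq]
    by_cases hs : s = 0
    · simp [hs]
    · have h3 : (1 : ℝ) ≤ |(s : ℝ)| := by
        rw [← Int.cast_abs]; exact_mod_cast Int.one_le_abs hs
      have h4 : |2 * (s : ℝ)| - |x| ≤ |2 * (s : ℝ) - x| := abs_sub_abs_le_abs_sub _ _
      rw [abs_sub_comm, abs_mul, abs_two] at h4
      linarith
  linarith

theorem window_to_gk {p : ℝ} (h0 : 0 ≤ p) (h1 : p ≤ 1) (Gd : (ι → Bool) → Prop) (X : (ι → Bool) → ℝ) {sn W : ℝ} (hsn : 0 < sn)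
    (hW : ∀ v, EE (wv ι p) (fun C => ind (Gd C) * ind (|X C - v| ≤ sn)) ≤ W) (v : ℝ) :
    EE (wv ι p) (fun C => ind (Gd C) * gk ((X C - v) / sn)) ≤ 5 * W := by
  classical
  have hw := isW_wv (ι := ι) h0 h1
  set R : Finset ℤ := univ.image (fun C : ι → Bool => round ((X C - v) / sn / 2))
  have hW0 : 0 ≤ W := (EE_nonneg hw (fun C => mul_nonneg (ind_nonneg _) (ind_nonneg _))).trans (hW 0)
  have hstep : EE (wv ι p) (fun C => ind (Gd C) * gk ((X C - v) / sn)) ≤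
      EE (wv ι p) (fun C => ∑ s ∈ R, 1 / (1 + (s : ℝ) ^ 2) * (ind (Gd C) * ind (|X C - (v + 2 * s * sn)| ≤ sn))) := by
    refine EE_mono hw (fun C => ?_)
    have := gk_le_windows ((X C - v) / sn) R (Finset.mem_image_of_mem _ (Finset.mem_univ C))
    refine (mul_le_mul_of_nonneg_left this (ind_nonneg _)).trans (le_of_eq ?_)
    rw [Finset.mul_sum]
    refine Finset.sum_congr rfl (fun s _ => ?_)
    have : (|(X C - v) / sn - 2 * s| ≤ 1) ↔ (|X C - (v + 2 * s * sn)| ≤ sn) := by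
      have : X C - (v + 2 * s * sn) = ((X C - v) / sn - 2 * s) * sn := by field_simp; ring
      rw [this, abs_mul, abs_of_pos hsn]
      constructor
      · intro h; nlinarith
      · intro h; by_contra h'; push Not at h'; nlinarith
    simp only [this]; ring
  refine hstep.trans ?_
  rw [EE_sum]
  have : ∀ s ∈ R, EE (wv ι p) (fun C => 1 / (1 + (s : ℝ) ^ 2) * (ind (Gd C) * ind (|X C - (v + 2 * s * sn)| ≤ sn)))
     ≤ 1 / (1 + (s : ℝ) ^ 2) * W := by
    intro s _
    rw [EE_smul]
    exact mul_le_mul_of_nonneg_left (hW _) (by positivity)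
  refine (Finset.sum_le_sum this).trans ?_
  rw [← Finset.sum_mul]
  refine mul_le_mul_of_nonneg_right ?_ hW0
  obtain ⟨K, hK1, hK⟩ : ∃ K : ℕ, 1 ≤ K ∧ R ⊆ Ioo (-(K : ℤ)) K := by
    refine ⟨∑ s ∈ R, s.natAbs + 1, by omega, fun s hs => ?_⟩
    have := Finset.single_le_sum (f := Int.natAbs) (fun s _ => Nat.zero_le _) hs
    rw [mem_Ioo]; omega
  refine (Finset.sum_le_sum_of_subset_of_nonneg hK (fun _ _ _ => by positivity)).trans ?_
  refine (sum_g_le K hK1).trans ?_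
  have : (0 : ℝ) ≤ 4 / K := by positivity
  linarith

theorem lo_gk (e : (β × κ) ⊕ ρ ≃ ι) {p q θ δ sn : ℝ} (hκ : 0 < Fintype.card κ)
    (hq : 0 < q) (hqp : q ≤ p) (h1 : p ≤ 1/2) (hθ : 0 < θ) (hδ : 0 < δ) (hsn : 0 < sn) (N : ℕ) (hN : 1 ≤ N)
    (z : ι → ℝ) (S : Finset ι) (hS : δ * sn ^ 2 ≤ S.card)
    (hz : ∀ w ∈ S, θ / 4 * N ≤ |z w| ∧ |z w| ≤ 5 / θ * N)
    (hnice : Nice e N sn (θ / 2) z)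
    (hng : (θ * sn + 1) * PP (wv ι p) (fun C => ¬ Good e C) ≤ 1) (v : ℝ) :
    EE (wv ι p) (fun C => ind (Good e C) * gk ((XX z C - v) / sn)) ≤
      20 * (3 + 2 / (q * δ * θ ^ 2 / 160)) / N := by
  have := window_to_gk (p := p) (by linarith) (by linarith) (Good e) (XX z) hsn
    (lo_window e hκ hq hqp h1 hθ hδ hsn N hN z S hS hz hnice hng) v
  refine this.trans (le_of_eq ?_)
  ring

end LO

end SCP

namespace SCP

/-- uniform weights on Fin Q -/
noncomputable def uw (ι : Type*) (Q : ℕ) : ι → Fin Q → ℝ := fun _ _ => 1 / (Q : ℝ)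

theorem isW_uw (ι : Type*) {Q : ℕ} (hQ : 1 ≤ Q) : IsW (uw ι Q) := by
  constructor
  · intro i a; unfold uw; positivity
  · intro i
    have : (Q : ℝ) ≠ 0 := by positivity
    simp [uw, this]

/-- point of a cube -/
def zz {ι : Type*} {Q : ℕ} (a : ι → ℤ) (f : ι → Fin Q) : ι → ℝ := fun w => (a w : ℝ) * Q + ((f w : ℕ) : ℝ)

/-- normalized Dirichlet sum -/
noncomputable def DD (Q : ℕ) (b : ℝ) : ℂ := ∑ t : Fin Q, ((1 / (Q : ℝ) : ℝ) : ℂ) * cx (b * (t : ℕ))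

theorem DD_le_one {Q : ℕ} (hQ : 1 ≤ Q) (b : ℝ) : ‖DD Q b‖ ≤ 1 := by
  unfold DD
  refine (norm_sum_le _ _).trans ?_
  have : ∀ t : Fin Q, ‖((1 / (Q : ℝ) : ℝ) : ℂ) * cx (b * (t : ℕ))‖ = 1 / (Q : ℝ) := by
    intro t
    rw [norm_mul, cx_norm, mul_one, Complex.norm_real, Real.norm_of_nonneg (by positivity)]
  have h : (Q : ℝ) ≠ 0 := by positivity
  rw [Finset.sum_congr rfl (fun t _ => this t)]
  simp [h]

theorem cx_nsmul (b : ℝ) (t : ℕ) : cx (b * t) = cx b ^ t := by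
  induction t with
  | zero => simp [cx_zero]
  | succ t ih => rw [pow_succ, ← ih, ← cx_add]; push_cast; ring_nf

theorem cx_sub_one_ge (b : ℝ) (hb : |b| ≤ Real.pi) : 2 / Real.pi * |b| ≤ ‖cx b - 1‖ := by
  have hpi := Real.pi_pos
  have h1 : ‖cx b - 1‖ ^ 2 = (2 * Real.sin (b / 2)) ^ 2 := by
    rw [← Complex.normSq_eq_norm_sq, Complex.normSq_apply]
    simp only [Complex.sub_re, Complex.sub_im, cx_re, cx_im, Complex.one_re, Complex.one_im]
    have h := Real.cos_sq_add_sin_sq b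
    have h2 := Real.cos_sq' (b / 2)
    rw [Real.cos_sq] at h2
    have e : 2 * (b / 2) = b := by ring
    rw [e] at h2
    nlinarith
  have h2 : ‖cx b - 1‖ = |2 * Real.sin (b / 2)| := by
    rw [← abs_of_nonneg (norm_nonneg (cx b - 1))]
    exact (sq_eq_sq_iff_abs_eq_abs _ _).1 h1
  rw [h2, abs_mul, abs_two]
  have h3 := Real.mul_abs_le_abs_sin (x := b / 2) (by rw [abs_div, abs_two]; linarith)
  rw [abs_div, abs_two] at h3
  linarith

theorem DD_le {Q : ℕ} (hQ : 1 ≤ Q) (b : ℝ) (hb0 : b ≠ 0) (hb : |b| ≤ Real.pi) : ‖DD Q b‖ ≤ Real.pi / (Q * |b|) := by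
  have hQ' : (0 : ℝ) < Q := by positivity
  have hpi := Real.pi_pos
  have h0 : 0 < |b| := abs_pos.2 hb0
  have h1 : DD Q b = ((1 / (Q : ℝ) : ℝ) : ℂ) * ∑ t ∈ range Q, cx b ^ t := by
    unfold DD
    rw [← Finset.mul_sum, ← Fin.sum_univ_eq_sum_range (fun t => cx b ^ t)]
    simp only [cx_nsmul]
  have h2 : (∑ t ∈ range Q, cx b ^ t) * (cx b - 1) = cx b ^ Q - 1 := geom_sum_mul _ _
  have h3 : ‖cx b ^ Q - 1‖ ≤ 2 := by
    refine (norm_sub_le _ _).trans ?_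
    rw [norm_pow, cx_norm]; norm_num
  rw [← h2, norm_mul] at h3
  have h4 := cx_sub_one_ge b hb
  have h5 : ‖∑ t ∈ range Q, cx b ^ t‖ * (2 / Real.pi * |b|) ≤ 2 :=
    (mul_le_mul_of_nonneg_left h4 (norm_nonneg _)).trans h3
  rw [h1, norm_mul, Complex.norm_real, Real.norm_of_nonneg (by positivity), le_div_iff₀ (by positivity)]
  have : 1 / (Q : ℝ) * ‖∑ t ∈ range Q, cx b ^ t‖ * (Q * |b|) =
     (‖∑ t ∈ range Q, cx b ^ t‖ * (2 / Real.pi * |b|)) * (Real.pi / 2) := by field_simp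
  rw [this]
  calc _ ≤ 2 * (Real.pi / 2) := mul_le_mul_of_nonneg_right h5 (by positivity)
    _ = _ := by ring

section U
variable {β κ ρ ι : Type*} [Fintype β] [DecidableEq β] [Fintype κ] [DecidableEq κ]
  [Fintype ρ] [DecidableEq ρ] [Fintype ι] [DecidableEq ι]

theorem charU {Q : ℕ} (a : κ → ℤ) (b : κ → ℝ) :
    ‖∑ f : κ → Fin Q, (pw (uw κ Q) f : ℂ) * cx (∑ w, b w * zz a f w)‖ = ∏ w, ‖DD Q (b w)‖ := by
  have h : ∀ f : κ → Fin Q, (pw (uw κ Q) f : ℂ) * cx (∑ w, b w * zz a f w) =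
      (∏ w, cx (b w * ((a w : ℝ) * Q))) * ∏ w, (((1 / (Q : ℝ) : ℝ) : ℂ) * cx (b w * ((f w : ℕ) : ℝ))) := by
    intro f
    rw [cx_sum, ← Finset.prod_mul_distrib]
    unfold pw uw
    rw [Complex.ofReal_prod, ← Finset.prod_mul_distrib]
    refine Finset.prod_congr rfl (fun w _ => ?_)
    unfold zz
    rw [mul_add, cx_add]; ring
  rw [Finset.sum_congr rfl (fun f _ => h f), ← Finset.mul_sum,
    sum_prod_eq (fun w (t : Fin Q) => (((1 / (Q : ℝ) : ℝ) : ℂ) * cx (b w * ((t : ℕ) : ℝ)))), norm_mul, norm_prod, norm_prod]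
  simp only [cx_norm, Finset.prod_const_one, one_mul]
  rfl

theorem EE_normsq_le {Q : ℕ} (hQ : 1 ≤ Q) (a : κ → ℤ) {σ : Type*} (s : Finset σ) (B : σ → κ → ℝ) :
    EE (uw κ Q) (fun f => ‖∑ x ∈ s, cx (∑ w, B x w * zz a f w)‖ ^ 2) ≤
      ∑ x ∈ s, ∑ y ∈ s, ∏ w, ‖DD Q (B x w - B y w)‖ := by
  have h : ∀ f : κ → Fin Q, ((‖∑ x ∈ s, cx (∑ w, B x w * zz a f w)‖ ^ 2 : ℝ) : ℂ) =
      ∑ x ∈ s, ∑ y ∈ s, cx (∑ w, (B x w - B y w) * zz a f w) := by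
    intro f
    push_cast
    rw [← Complex.mul_conj', map_sum, Finset.sum_mul_sum]
    refine Finset.sum_congr rfl (fun x _ => Finset.sum_congr rfl (fun y _ => ?_))
    rw [cx_conj, ← cx_add]
    congr 1
    simp only [sub_mul, Finset.sum_sub_distrib]; ring
  have h2 : ((EE (uw κ Q) (fun f => ‖∑ x ∈ s, cx (∑ w, B x w * zz a f w)‖ ^ 2) : ℝ) : ℂ) =
      ∑ x ∈ s, ∑ y ∈ s, ∑ f : κ → Fin Q, (pw (uw κ Q) f : ℂ) * cx (∑ w, (B x w - B y w) * zz a f w) := by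
    unfold EE
    rw [Complex.ofReal_sum]
    simp only [Complex.ofReal_mul, h, Finset.mul_sum]
    rw [Finset.sum_comm]
    refine Finset.sum_congr rfl (fun x _ => ?_)
    rw [Finset.sum_comm]
  have h3 : EE (uw κ Q) (fun f => ‖∑ x ∈ s, cx (∑ w, B x w * zz a f w)‖ ^ 2) ≤
     ‖((EE (uw κ Q) (fun f => ‖∑ x ∈ s, cx (∑ w, B x w * zz a f w)‖ ^ 2) : ℝ) : ℂ)‖ := by
    rw [Complex.norm_real]; exact Real.le_norm_self _
  refine h3.trans ?_
  rw [h2]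
  refine (norm_sum_le _ _).trans (Finset.sum_le_sum (fun x _ => ?_))
  refine (norm_sum_le _ _).trans (Finset.sum_le_sum (fun y _ => ?_))
  exact (charU a (fun w => B x w - B y w)).le

theorem prod_DD_le {Q : ℕ} (hQ : 1 ≤ Q) (b : κ → ℝ) (w : κ) : ∏ w, ‖DD Q (b w)‖ ≤ ‖DD Q (b w)‖ := by
  rw [← Finset.mul_prod_erase _ _ (Finset.mem_univ w)]
  exact mul_le_of_le_one_right (norm_nonneg _) (Finset.prod_le_one (fun _ _ => norm_nonneg _) (fun _ _ => DD_le_one hQ _))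

theorem prod_DD_le2 {Q : ℕ} (hQ : 1 ≤ Q) (b : κ → ℝ) {w v : κ} (h : w ≠ v) :
    ∏ w, ‖DD Q (b w)‖ ≤ ‖DD Q (b w)‖ * ‖DD Q (b v)‖ := by
  rw [← Finset.mul_prod_erase _ _ (Finset.mem_univ w)]
  refine mul_le_mul_of_nonneg_left ?_ (norm_nonneg _)
  rw [← Finset.mul_prod_erase _ _ (Finset.mem_erase.2 ⟨h.symm, Finset.mem_univ v⟩)]
  exact mul_le_of_le_one_right (norm_nonneg _) (Finset.prod_le_one (fun _ _ => norm_nonneg _) (fun _ _ => DD_le_one hQ _))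

/-- tuple second moment -/
theorem tuple_moment {Q : ℕ} (hQ : 1 ≤ Q) (a : κ → ℤ) (l : ℕ) (al : Fin l → ℝ) (η : ℝ) (hη : 0 ≤ η)
    (hgen : ∀ ε : Fin l → ℤ, (∀ i, |ε i| ≤ 1) → ε ≠ 0 → ‖DD Q (∑ i, ε i * al i)‖ ≤ η)
    (hk : 0 < Fintype.card κ) (hηk : η ≤ 1 / (Fintype.card κ : ℝ) ^ l) :
    EE (uw κ Q) (fun f => ∏ i, (‖∑ u : κ, cx (al i * zz a f u)‖ / Fintype.card κ) ^ 2) ≤ 2 / (Fintype.card κ : ℝ) ^ l := by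
  set k : ℝ := (Fintype.card κ : ℝ) with hkdef
  have hk' : 0 < k := by rw [hkdef]; exact_mod_cast hk
  set B : (Fin l → κ) → κ → ℝ := fun u w => ∑ i, al i * (if u i = w then 1 else 0) with hB
  have h1 : ∀ f : κ → Fin Q, ∏ i, (‖∑ u : κ, cx (al i * zz a f u)‖ / k) ^ 2 =
      1 / k ^ (2 * l) * ‖∑ u : Fin l → κ, cx (∑ w, B u w * zz a f w)‖ ^ 2 := by
    intro f
    have : ∑ u : Fin l → κ, cx (∑ w, B u w * zz a f w) = ∏ i, ∑ u : κ, cx (al i * zz a f u) := by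
      rw [← sum_prod_eq (fun i u => cx (al i * zz a f u))]
      refine Finset.sum_congr rfl (fun u _ => ?_)
      rw [← cx_sum]
      congr 1
      simp only [hB, Finset.sum_mul]
      rw [Finset.sum_comm]
      refine Finset.sum_congr rfl (fun i _ => ?_)
      rw [Finset.sum_eq_single (u i)]
      · simp
      · intro w _ hw; simp [hw.symm]
      · simp
    rw [this, norm_prod, Finset.prod_pow, Finset.prod_div_distrib, div_pow, Finset.prod_const, Finset.card_univ, Fintype.card_fin,
      ← pow_mul, mul_comm l 2]
    ring
  have h2 : EE (uw κ Q) (fun f => ∏ i, (‖∑ u : κ, cx (al i * zz a f u)‖ / k) ^ 2) =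
     1 / k ^ (2 * l) * EE (uw κ Q) (fun f => ‖∑ u : Fin l → κ, cx (∑ w, B u w * zz a f w)‖ ^ 2) := by
    rw [← EE_smul]; congr 1; funext f; exact h1 f
  rw [h2]
  have h3 := EE_normsq_le hQ a (univ : Finset (Fin l → κ)) B
  have h4 : ∀ x y : Fin l → κ, ∏ w, ‖DD Q (B x w - B y w)‖ ≤ (if x = y then 1 else 0) + η := by
    intro x y
    split_ifs with hxy
    · have := Finset.prod_le_one (s := univ) (f := fun w => ‖DD Q (B x w - B y w)‖) (fun _ _ => norm_nonneg _) (fun _ _ => DD_le_one hQ _)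
      linarith
    · obtain ⟨i, hi⟩ := Function.ne_iff.1 hxy
      refine (prod_DD_le hQ (fun w => B x w - B y w) (x i)).trans ?_
      have := hgen (fun i' => (if x i' = x i then 1 else 0) - (if y i' = x i then 1 else 0))
        (by intro i'; split_ifs <;> simp) (by
          intro h0
          have := congrFun h0 i
          simp [hi.symm] at this)
      rw [zero_add]
      refine le_trans (le_of_eq ?_) this
      congr 2
      simp only [hB, ← Finset.sum_sub_distrib]
      refine Finset.sum_congr rfl (fun i' _ => ?_)
      push_cast; ring
  have h5 : ∑ x : Fin l → κ, ∑ y : Fin l → κ, ∏ w, ‖DD Q (B x w - B y w)‖ ≤ k ^ l + k ^ (2 * l) * η := by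
    refine (Finset.sum_le_sum (fun x _ => Finset.sum_le_sum (fun y _ => h4 x y))).trans (le_of_eq ?_)
    simp only [Finset.sum_add_distrib, Finset.sum_ite_eq, Finset.mem_univ, if_true, Finset.sum_const, Finset.card_univ,
      Fintype.card_fun, Fintype.card_fin, nsmul_eq_mul]
    push_cast
    rw [← hkdef]; ring
  have h6 : k ^ (2 * l) * η ≤ k ^ l := by
    calc k ^ (2 * l) * η ≤ k ^ (2 * l) * (1 / k ^ l) := mul_le_mul_of_nonneg_left hηk (by positivity)
      _ = k ^ l := by rw [two_mul, pow_add]; field_simp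
  calc _ ≤ 1 / k ^ (2 * l) * (k ^ l + k ^ l) := mul_le_mul_of_nonneg_left (by linarith) (by positivity)
    _ = 2 / k ^ l := by rw [two_mul, pow_add]; field_simp; ring

theorem cx_pow_sub_one (b : ℝ) (h : ℕ) : ‖cx b ^ h - 1‖ ≤ h * ‖cx b - 1‖ := by
  induction h with
  | zero => simp
  | succ h ih =>
    have : cx b ^ (h + 1) - 1 = (cx b ^ h - 1) * cx b + (cx b - 1) := by ring
    rw [this]
    refine (norm_add_le _ _).trans ?_
    rw [norm_mul, cx_norm, mul_one]; push_cast; linarith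

/-- dichotomy for the phase -/
theorem phase_dich (H : ℕ) (hH : 1 ≤ H) (φ : ℝ) :
    1 / 4 ≤ ‖∑ h ∈ range H, cx (h * φ)‖ ^ 2 / (H : ℝ) ^ 2 ∨ ‖1 + cx φ‖ ≤ 2 - 1 / (4 * (H : ℝ) ^ 2) := by
  have hH' : (1 : ℝ) ≤ H := by exact_mod_cast hH
  by_cases hc : ‖cx φ - 1‖ ≤ 1 / H
  · left
    have h1 : (H : ℝ) / 2 ≤ ‖∑ h ∈ range H, cx (h * φ)‖ := by
      have e1 : (H : ℂ) = ∑ h ∈ range H, cx (h * φ) - ∑ h ∈ range H, (cx (h * φ) - 1) := by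
        rw [← Finset.sum_sub_distrib]; simp
      have e2 : (H : ℝ) ≤ ‖∑ h ∈ range H, cx (h * φ)‖ + ‖∑ h ∈ range H, (cx (h * φ) - 1)‖ := by
        have := norm_sub_le (∑ h ∈ range H, cx (h * φ)) (∑ h ∈ range H, (cx (h * φ) - 1))
        rw [← e1] at this
        simpa using this
      have e3 : ‖∑ h ∈ range H, (cx (h * φ) - 1)‖ ≤ ∑ h ∈ range H, (h : ℝ) * (1 / H) := by
        refine (norm_sum_le _ _).trans (Finset.sum_le_sum (fun h _ => ?_))
        rw [mul_comm, cx_nsmul]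
        exact (cx_pow_sub_one φ h).trans (mul_le_mul_of_nonneg_left hc (by positivity))
      have e4 : ∑ h ∈ range H, (h : ℝ) * (1 / H) ≤ H / 2 := by
        rw [← Finset.sum_mul]
        have : ∑ h ∈ range H, (h : ℝ) ≤ (H : ℝ) ^ 2 / 2 := by
          clear hc e1 e2 e3 hH' hH
          induction H with
          | zero => simp
          | succ H ih => rw [Finset.sum_range_succ]; push_cast; nlinarith
        calc _ ≤ (H : ℝ) ^ 2 / 2 * (1 / H) := mul_le_mul_of_nonneg_right this (by positivity)
          _ = _ := by field_simp
      linarith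
    rw [le_div_iff₀ (by positivity)]
    nlinarith
  · right
    push Not at hc
    have h1 : ‖1 + cx φ‖ ^ 2 = 4 - ‖cx φ - 1‖ ^ 2 := by
      rw [← Complex.normSq_eq_norm_sq, ← Complex.normSq_eq_norm_sq, Complex.normSq_apply, Complex.normSq_apply]
      simp only [Complex.sub_re, Complex.sub_im, Complex.add_re, Complex.add_im, cx_re, cx_im, Complex.one_re, Complex.one_im]
      have h := Real.cos_sq_add_sin_sq φ
      nlinarith
    have h2 : (1 / (H : ℝ)) ^ 2 ≤ ‖cx φ - 1‖ ^ 2 := pow_le_pow_left₀ (by positivity) hc.le 2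
    have h3 : (1 / (H : ℝ)) ^ 2 = 1 / (H : ℝ) ^ 2 := by rw [div_pow, one_pow]
    have h4 : 1 / (4 * (H : ℝ) ^ 2) = 1 / (H : ℝ) ^ 2 / 4 := by field_simp
    have h5 : 1 / (H : ℝ) ^ 2 ≤ 1 := by rw [div_le_one (by positivity)]; nlinarith
    rw [h4]
    rw [h3] at h2
    set y := 1 / (H : ℝ) ^ 2
    have hy : 0 ≤ y := by positivity
    refine abs_le_of_sq_le_sq' ?_ (by linarith) |>.2
    nlinarith

/-- high moment of the block average -/
theorem avg_moment {Q : ℕ} (hQ : 1 ≤ Q) (a : κ → ℤ) {i1 i2 : κ} (hi : i1 ≠ i2) (al : ℝ) (H lam : ℕ) (hH : 1 ≤ H)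
    (hal : 1 ≤ Q * |al|) (hHal : H * |al| ≤ Real.pi) :
    EE (uw κ Q) (fun f => (‖∑ u : κ, cx (al * zz a f u)‖ / Fintype.card κ) ^ lam) ≤
      400 / H + (1 - 1 / (4 * (H : ℝ) ^ 2 * Fintype.card κ)) ^ lam := by
  have hw := isW_uw κ hQ
  have hH' : (1 : ℝ) ≤ H := by exact_mod_cast hH
  set k : ℝ := (Fintype.card κ : ℝ) with hkdef
  have hk2 : 2 ≤ Fintype.card κ := by
    have := Fintype.one_lt_card_iff.2 ⟨i1, i2, hi⟩; omega
  have hk' : 2 ≤ k := by rw [hkdef]; exact_mod_cast hk2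
  set B : ℕ → κ → ℝ := fun h w => h * al * ((if i1 = w then 1 else 0) - (if i2 = w then 1 else 0)) with hB
  have hBs : ∀ (f : κ → Fin Q) (h : ℕ), ∑ w, B h w * zz a f w = h * (al * (zz a f i1 - zz a f i2)) := by
    intro f h
    simp only [hB, mul_sub, sub_mul, Finset.sum_sub_distrib, mul_ite, mul_one, mul_zero, ite_mul, zero_mul, Finset.sum_ite_eq,
      Finset.mem_univ, if_true]
    ring
  have hpt : ∀ f : κ → Fin Q, (‖∑ u : κ, cx (al * zz a f u)‖ / k) ^ lam ≤
      4 / (H : ℝ) ^ 2 * ‖∑ h ∈ range H, cx (∑ w, B h w * zz a f w)‖ ^ 2 + (1 - 1 / (4 * (H : ℝ) ^ 2 * k)) ^ lam := by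
    intro f
    simp only [hBs]
    set φ := al * (zz a f i1 - zz a f i2) with hφ
    have hone : ‖∑ u : κ, cx (al * zz a f u)‖ ≤ k := by
      refine (norm_sum_le _ _).trans ?_
      simp [cx_norm, hkdef]
    have hsmall : 0 ≤ 1 - 1 / (4 * (H : ℝ) ^ 2 * k) := by
      rw [sub_nonneg, div_le_one (by positivity)]
      nlinarith
    rcases phase_dich H hH φ with h | h
    · have h1 : (‖∑ u : κ, cx (al * zz a f u)‖ / k) ^ lam ≤ 1 :=
        pow_le_one₀ (by positivity) (by rw [div_le_one (by linarith)]; exact hone)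
      have h2 : 0 ≤ (1 - 1 / (4 * (H : ℝ) ^ 2 * k)) ^ lam := pow_nonneg hsmall _
      have h3 : 4 / (H : ℝ) ^ 2 * ‖∑ h ∈ range H, cx (h * φ)‖ ^ 2 = 4 * (‖∑ h ∈ range H, cx (h * φ)‖ ^ 2 / (H : ℝ) ^ 2) := by ring
      rw [h3]; linarith
    · have h1 : ‖∑ u : κ, cx (al * zz a f u)‖ ≤ k - 1 / (4 * (H : ℝ) ^ 2) := by
        have e1 : ∑ u : κ, cx (al * zz a f u) = (cx (al * zz a f i1) + cx (al * zz a f i2)) +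
            ∑ u ∈ (univ.erase i1).erase i2, cx (al * zz a f u) := by
          rw [← Finset.add_sum_erase _ _ (Finset.mem_univ i1),
            ← Finset.add_sum_erase _ _ (Finset.mem_erase.2 ⟨hi.symm, Finset.mem_univ i2⟩)]
          ring
        have e2 : ‖∑ u ∈ (univ.erase i1).erase i2, cx (al * zz a f u)‖ ≤ k - 2 := by
          refine (norm_sum_le _ _).trans ?_
          simp only [cx_norm, Finset.sum_const, nsmul_eq_mul, mul_one]
          rw [Finset.card_erase_of_mem (Finset.mem_erase.2 ⟨hi.symm, Finset.mem_univ i2⟩), Finset.card_erase_of_mem (Finset.mem_univ _),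
            Finset.card_univ, Nat.sub_sub, Nat.cast_sub hk2]
          norm_num [hkdef]
        have e3 : cx (al * zz a f i1) + cx (al * zz a f i2) = cx (al * zz a f i2) * (1 + cx φ) := by
          rw [mul_add, ← cx_add, hφ]; ring_nf
        rw [e1]
        refine (norm_add_le _ _).trans ?_
        rw [e3, norm_mul, cx_norm, one_mul]
        linarith
      have h2 : ‖∑ u : κ, cx (al * zz a f u)‖ / k ≤ 1 - 1 / (4 * (H : ℝ) ^ 2 * k) := by
        rw [div_le_iff₀ (by linarith)]
        refine h1.trans (le_of_eq ?_)
        field_simp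
      have h3 := pow_le_pow_left₀ (by positivity) h2 lam
      have : 0 ≤ 4 / (H : ℝ) ^ 2 * ‖∑ h ∈ range H, cx (h * φ)‖ ^ 2 := by positivity
      linarith
  refine (EE_mono hw hpt).trans ?_
  rw [EE_add, EE_const hw, EE_smul]
  refine add_le_add ?_ le_rfl
  have h3 := EE_normsq_le hQ a (range H) B
  have h4 : ∀ x ∈ range H, ∀ y ∈ range H, ∏ w, ‖DD Q (B x w - B y w)‖ ≤ 20 * gk ((x : ℝ) - y) := by
    intro x hx y hy
    rw [mem_range] at hx hy
    refine (prod_DD_le2 hQ (fun w => B x w - B y w) hi).trans ?_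
    have e1 : B x i1 - B y i1 = ((x : ℝ) - y) * al := by simp [hB, hi.symm]; ring
    have e2 : B x i2 - B y i2 = -(((x : ℝ) - y) * al) := by simp [hB, hi]; ring
    simp only [e1, e2]
    by_cases hxy : x = y
    · subst hxy
      have a1 := DD_le_one hQ (((x : ℝ) - x) * al)
      have a2 := DD_le_one hQ (-(((x : ℝ) - x) * al))
      have := mul_le_one₀ a1 (norm_nonneg _) a2
      simp only [gk, sub_self] at *
      norm_num at *
      linarith
    · set d := (x : ℝ) - y with hd
      have hd0 : d ≠ 0 := by rw [hd, sub_ne_zero]; exact_mod_cast hxy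
      have hal0 : 0 < |al| := by
        by_contra h; have : |al| = 0 := le_antisymm (not_lt.1 h) (abs_nonneg _)
        rw [this] at hal; norm_num at hal
      have hd1 : 1 ≤ |d| := by
        have : ((x : ℤ) - y) ≠ 0 := by omega
        have h := Int.one_le_abs this
        have h' : ((1 : ℤ) : ℝ) ≤ ((|(x : ℤ) - y| : ℤ) : ℝ) := by exact_mod_cast h
        push_cast at h'; exact h'
      have hdH : |d| ≤ H := by
        have hx' : (x : ℝ) < H := by exact_mod_cast hx
        have hy' : (y : ℝ) < H := by exact_mod_cast hy
        have : (0 : ℝ) ≤ x := by positivity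
        have : (0 : ℝ) ≤ y := by positivity
        rw [abs_le]; constructor <;> linarith
      have hb : |d * al| ≤ Real.pi := by
        rw [abs_mul]; exact (mul_le_mul_of_nonneg_right hdH (abs_nonneg _)).trans hHal
      have hne : d * al ≠ 0 := mul_ne_zero hd0 (abs_pos.1 hal0)
      have b1 := DD_le hQ (d * al) hne hb
      have b2 := DD_le hQ (-(d * al)) (neg_ne_zero.2 hne) (by rwa [abs_neg])
      rw [abs_neg] at b2
      have b3 : Real.pi / (Q * |d * al|) ≤ Real.pi / |d| := by
        have : |d| ≤ Q * |d * al| := by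
          rw [abs_mul]; nlinarith
        exact div_le_div_of_nonneg_left Real.pi_pos.le (by linarith) this
      have b4 := mul_le_mul (b1.trans b3) (b2.trans b3) (norm_nonneg _) (by positivity)
      refine b4.trans ?_
      unfold gk
      rw [← sq_abs d]
      have hpi : Real.pi ^ 2 ≤ 10 := by
        have := Real.pi_lt_d2; have := Real.pi_pos; nlinarith
      rw [div_mul_div_comm, mul_one_div, div_le_div_iff₀ (by positivity) (by positivity)]
      nlinarith [mul_nonneg (sub_nonneg.2 hpi) (sq_nonneg |d|), mul_self_nonneg Real.pi]
  have h5 : ∑ x ∈ range H, ∑ y ∈ range H, ∏ w, ‖DD Q (B x w - B y w)‖ ≤ H * 100 := by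
    have : ∀ x ∈ range H, ∑ y ∈ range H, ∏ w, ‖DD Q (B x w - B y w)‖ ≤ 100 := by
      intro x hx
      refine (Finset.sum_le_sum (h4 x hx)).trans ?_
      rw [← Finset.mul_sum]
      have e1 : ∑ y ∈ range H, gk ((x : ℝ) - y) = ∑ j ∈ (range H).image (fun y : ℕ => (x : ℤ) - y), 1 / (1 + (j : ℝ) ^ 2) := by
        rw [Finset.sum_image (by intro a _ b _ h; simpa using h)]
        refine Finset.sum_congr rfl (fun y _ => ?_)
        unfold gk; push_cast; rfl
      have e2 : (range H).image (fun y : ℕ => (x : ℤ) - y) ⊆ Ioo (-(H : ℤ)) H := by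
        intro j hj
        rw [Finset.mem_image] at hj
        obtain ⟨y, hy, rfl⟩ := hj
        rw [mem_range] at hx hy
        rw [mem_Ioo]; omega
      have e3 := Finset.sum_le_sum_of_subset_of_nonneg (f := fun j : ℤ => 1 / (1 + (j : ℝ) ^ 2)) e2 (fun _ _ _ => by positivity)
      have e4 := sum_g_le H hH
      have : (0 : ℝ) ≤ 4 / H := by positivity
      linarith
    refine (Finset.sum_le_sum this).trans (le_of_eq ?_)
    simp
  calc _ ≤ 4 / (H : ℝ) ^ 2 * (H * 100) := mul_le_mul_of_nonneg_left (h3.trans h5) (by positivity)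
    _ = 400 / H := by field_simp; ring

end U

end SCP

namespace SCP

/-- generic tuples -/
def Gen (l : ℕ) (W : ℕ) (j : Fin l → ℤ) : Prop :=
  ∀ ε : Fin l → ℤ, (∀ i, |ε i| ≤ 1) → ε ≠ 0 → (W : ℤ) ≤ |∑ i, ε i * j i|

theorem greedy (W : ℕ) (T : Finset ℤ) (l : ℕ) (h : 3 ^ l * (2 * W + 1) ≤ T.card) :
    ∃ j : Fin l → ℤ, (∀ i, j i ∈ T) ∧ Gen l W j := by
  classical
  induction l with
  | zero =>
    refine ⟨Fin.elim0, fun i => i.elim0, fun ε _ hε => ?_⟩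
    exact absurd (Subsingleton.elim _ _) hε
  | succ l ih =>
    obtain ⟨j, hj, hg⟩ := ih (le_trans (Nat.mul_le_mul_right _ (Nat.pow_le_pow_right (by norm_num) (Nat.le_succ l))) h)
    set bad : Finset ℤ := (Fintype.piFinset (fun _ : Fin l => Icc (-1 : ℤ) 1)).biUnion
      (fun ε => Ioo (∑ i, ε i * j i - W) (∑ i, ε i * j i + W)) with hbad
    have hcard : bad.card ≤ 3 ^ l * (2 * W) := by
      refine (Finset.card_biUnion_le_card_mul _ _ (2 * W) (fun ε _ => ?_)).trans ?_
      · rw [Int.card_Ioo]; omega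
      · rw [Fintype.card_piFinset]; simp
    have hlt : bad.card < T.card := by
      refine lt_of_lt_of_le ?_ h
      have : 0 < 3 ^ l := by positivity
      rw [pow_succ]; nlinarith
    obtain ⟨x, hxT, hxb⟩ := Finset.exists_mem_notMem_of_card_lt_card hlt
    have hx : ∀ ε : Fin l → ℤ, (∀ i, |ε i| ≤ 1) → (W : ℤ) ≤ |x - ∑ i, ε i * j i| := by
      intro ε hε
      by_contra hc
      push Not at hc
      apply hxb
      rw [hbad, Finset.mem_biUnion]
      refine ⟨ε, ?_, ?_⟩
      · rw [Fintype.mem_piFinset]; intro i; rw [mem_Icc]; exact abs_le.1 (hε i)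
      · rw [abs_lt] at hc; rw [mem_Ioo]; constructor <;> linarith [hc.1, hc.2]
    refine ⟨Fin.cons x j, ?_, ?_⟩
    · intro i
      refine Fin.cases ?_ (fun i => ?_) i
      · simpa using hxT
      · simpa using hj i
    · intro ε hε hε0
      rw [Fin.sum_univ_succ]
      simp only [Fin.cons_zero, Fin.cons_succ]
      have h0 := hε 0
      rw [abs_le] at h0
      have hcases : ε 0 = 0 ∨ ε 0 = 1 ∨ ε 0 = -1 := by omega
      rcases hcases with h1 | h1 | h1
      · rw [h1, zero_mul, zero_add]
        refine hg (fun i => ε i.succ) (fun i => hε _) ?_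
        intro hz
        apply hε0
        funext i
        refine Fin.cases h1 (fun i => ?_) i
        exact congrFun hz i
      · have := hx (fun i => - ε i.succ) (fun i => by rw [abs_neg]; exact hε _)
        simp only [neg_mul, Finset.sum_neg_distrib, sub_neg_eq_add] at this
        rw [h1, one_mul]; exact this
      · have := hx (fun i => ε i.succ) (fun i => hε _)
        rw [h1, abs_sub_comm] at *
        refine this.trans (le_of_eq ?_)
        congr 1; ring

section U
variable {β κ ρ ι : Type*} [Fintype β] [DecidableEq β] [Fintype κ] [DecidableEq κ]
  [Fintype ρ] [DecidableEq ρ] [Fintype ι] [DecidableEq ι]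

theorem EE_blocks {Q : ℕ} (hQ : 1 ≤ Q) (e : (β × κ) ⊕ ρ ≃ ι) (G : Finset β) (T : β → (κ → Fin Q) → ℝ) :
    EE (uw ι Q) (fun f => ∏ b ∈ G, T b (blk e f b)) = ∏ b ∈ G, EE (uw κ Q) (T b) := by
  have hw := isW_uw κ hQ
  have h : ∀ f : ι → Fin Q, pw (uw ι Q) f * ∏ b ∈ G, T b (blk e f b) =
      (∏ b, (fun b g => pw (uw κ Q) g * (if b ∈ G then T b g else 1)) b
        (fun i => f (e (Sum.inl (b, i))))) * ∏ r, (fun (_ : ρ) (_ : Fin Q) => 1 / (Q : ℝ)) r (f (e (Sum.inr r))) := by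
    intro f
    have e1 : ∏ b ∈ G, T b (blk e f b) = ∏ b, (if b ∈ G then T b (blk e f b) else 1) := by
      rw [Finset.prod_ite_mem, Finset.univ_inter]
    rw [e1]
    unfold pw
    rw [block_prod e]
    simp only [Finset.prod_mul_distrib]
    unfold blk uw
    ring
  unfold EE
  rw [Finset.sum_congr rfl (fun f _ => h f),
    block_sum e (fun b g => pw (uw κ Q) g * (if b ∈ G then T b g else 1)) (fun _ _ => 1 / (Q : ℝ))]
  have hQ0 : (Q : ℝ) ≠ 0 := by positivity
  have e1 : ∏ r : ρ, ∑ a : Fin Q, 1 / (Q : ℝ) = 1 := by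
    refine Finset.prod_eq_one (fun r _ => ?_); simp [hQ0]
  rw [e1, mul_one]
  have e2 : ∀ b, ∑ g, pw (uw κ Q) g * (if b ∈ G then T b g else 1) = if b ∈ G then ∑ g, pw (uw κ Q) g * T b g else 1 := by
    intro b
    split_ifs with hb
    · rfl
    · exact EE_one hw
  rw [Finset.prod_congr rfl (fun b _ => e2 b), Finset.prod_ite_mem, Finset.univ_inter]

theorem blk_zz {Q : ℕ} (e : (β × κ) ⊕ ρ ≃ ι) (a : ι → ℤ) (f : ι → Fin Q) (b : β) (i : κ) :
    zz a f (e (Sum.inl (b, i))) = zz (blk e a b) (blk e f b) i := rfl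

theorem FG_pow_prob {Q : ℕ} (hQ : 1 ≤ Q) (e : (β × κ) ⊕ ρ ≃ ι) (a : ι → ℤ) {i1 i2 : κ} (hi : i1 ≠ i2) (al : ℝ) (H lam : ℕ) (hH : 1 ≤ H)
    (hal : 1 ≤ Q * |al|) (hHal : H * |al| ≤ Real.pi) (G : Finset β) (s0 : ℝ) (hs0 : 0 < s0) :
    PP (uw ι Q) (fun f => s0 ≤ FG e (zz a f) G al) ≤
      (400 / H + (1 - 1 / (4 * (H : ℝ) ^ 2 * Fintype.card κ)) ^ lam) ^ G.card / s0 ^ lam := by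
  have hw := isW_uw ι hQ
  have hwk := isW_uw κ hQ
  have h1 : PP (uw ι Q) (fun f => s0 ≤ FG e (zz a f) G al) ≤ PP (uw ι Q) (fun f => s0 ^ lam ≤ FG e (zz a f) G al ^ lam) :=
    PP_mono hw (fun f h => pow_le_pow_left₀ hs0.le h _)
  refine h1.trans ((PP_markov hw (fun f => pow_nonneg (FG_nonneg _ _ _ _) _) (pow_pos hs0 _)).trans ?_)
  refine div_le_div_of_nonneg_right ?_ (by positivity)
  have h2 : ∀ f : ι → Fin Q, FG e (zz a f) G al ^ lam = ∏ b ∈ G,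
     (fun b (g : κ → Fin Q) => (‖∑ u : κ, cx (al * zz (blk e a b) g u)‖ / Fintype.card κ) ^ lam) b (blk e f b) := by
    intro f
    unfold FG
    rw [Finset.prod_pow]; rfl
  have h3 : EE (uw ι Q) (fun f => FG e (zz a f) G al ^ lam) = EE (uw ι Q) (fun f => ∏ b ∈ G,
     (fun b (g : κ → Fin Q) => (‖∑ u : κ, cx (al * zz (blk e a b) g u)‖ / Fintype.card κ) ^ lam) b (blk e f b)) := by
    congr 1; funext f; exact h2 f
  rw [h3, EE_blocks hQ e G (fun b (g : κ → Fin Q) => (‖∑ u : κ, cx (al * zz (blk e a b) g u)‖ / Fintype.card κ) ^ lam)]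
  rw [← Finset.prod_const]
  refine Finset.prod_le_prod (fun b _ => EE_nonneg hwk (fun g => by positivity)) (fun b _ => ?_)
  exact avg_moment hQ (blk e a b) hi al H lam hH hal hHal

theorem FG_tuple_prob {Q : ℕ} (hQ : 1 ≤ Q) (e : (β × κ) ⊕ ρ ≃ ι) (a : ι → ℤ) (hk : 0 < Fintype.card κ)
    (N : ℕ) (hN : 1 ≤ N) (hNQ : N ≤ Q) (sn : ℝ) (hsn : 0 < sn) (l W : ℕ) (hlsn : (l : ℝ) ≤ 3 * sn) (hW1 : 1 ≤ W)
    (hW : Real.pi * sn * (Fintype.card κ : ℝ) ^ l ≤ W) (j : Fin l → ℤ) (hjN : ∀ i, |(j i : ℝ)| ≤ N) (hj : Gen l W j)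
    (G : Finset β) :
    PP (uw ι Q) (fun f => ∀ i, 1 / (4 * (N : ℝ)) ≤ FG e (zz a f) G ((j i : ℝ) / (N * sn))) ≤
      (4 * (N : ℝ)) ^ (2 * l) * (2 / (Fintype.card κ : ℝ) ^ l) ^ G.card := by
  have hw := isW_uw ι hQ
  have hwk := isW_uw κ hQ
  have hN' : (1 : ℝ) ≤ N := by exact_mod_cast hN
  have hQ' : (1 : ℝ) ≤ Q := by exact_mod_cast hQ
  have hk' : (0 : ℝ) < Fintype.card κ := by exact_mod_cast hk
  set al : Fin l → ℝ := fun i => (j i : ℝ) / (N * sn) with hal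
  have h1 : PP (uw ι Q) (fun f => ∀ i, 1 / (4 * (N : ℝ)) ≤ FG e (zz a f) G ((j i : ℝ) / (N * sn))) ≤
    PP (uw ι Q) (fun f => (1 / (4 * (N : ℝ))) ^ (2 * l) ≤ ∏ i, FG e (zz a f) G (al i) ^ 2) := by
    refine PP_mono hw (fun f h => ?_)
    have : (1 / (4 * (N : ℝ))) ^ (2 * l) = ∏ i : Fin l, (1 / (4 * (N : ℝ))) ^ 2 := by
      rw [Finset.prod_const, Finset.card_univ, Fintype.card_fin, ← pow_mul]
    rw [this]
    exact Finset.prod_le_prod (fun i _ => by positivity) (fun i _ => pow_le_pow_left₀ (by positivity) (h i) 2)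
  refine h1.trans ((PP_markov hw (fun f => Finset.prod_nonneg (fun i _ => by positivity)) (by positivity)).trans ?_)
  have e0 : ∀ x : ℝ, x / (1 / (4 * (N : ℝ))) ^ (2 * l) = (4 * (N : ℝ)) ^ (2 * l) * x := by
    intro x; rw [div_pow, one_pow]; field_simp
  rw [e0]
  refine mul_le_mul_of_nonneg_left ?_ (by positivity)
  have h2 : ∀ f : ι → Fin Q, ∏ i, FG e (zz a f) G (al i) ^ 2 = ∏ b ∈ G,
     (fun b (g : κ → Fin Q) => ∏ i, (‖∑ u : κ, cx (al i * zz (blk e a b) g u)‖ / Fintype.card κ) ^ 2) b (blk e f b) := by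
    intro f
    unfold FG
    simp only [← Finset.prod_pow]
    rw [Finset.prod_comm]
    rfl
  have h3 : EE (uw ι Q) (fun f => ∏ i, FG e (zz a f) G (al i) ^ 2) = EE (uw ι Q) (fun f => ∏ b ∈ G,
     (fun b (g : κ → Fin Q) => ∏ i, (‖∑ u : κ, cx (al i * zz (blk e a b) g u)‖ / Fintype.card κ) ^ 2) b (blk e f b)) := by
    congr 1; funext f; exact h2 f
  rw [h3, EE_blocks hQ e G (fun b (g : κ → Fin Q) => ∏ i, (‖∑ u : κ, cx (al i * zz (blk e a b) g u)‖ / Fintype.card κ) ^ 2)]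
  rw [← Finset.prod_const]
  refine Finset.prod_le_prod (fun b _ => EE_nonneg hwk (fun g => by positivity)) (fun b _ => ?_)
  refine tuple_moment hQ (blk e a b) l al (1 / (Fintype.card κ : ℝ) ^ l) (by positivity) ?_ hk le_rfl
  intro ε hε hε0
  have hg := hj ε hε hε0
  set s : ℤ := ∑ i, ε i * j i with hs
  have hsum : ∑ i, (ε i : ℝ) * al i = (s : ℝ) / (N * sn) := by
    rw [hs, hal]; push_cast; rw [Finset.sum_div]
    refine Finset.sum_congr rfl (fun i _ => by ring)
  have hs1 : (W : ℝ) ≤ |(s : ℝ)| := by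
    have : ((W : ℤ) : ℝ) ≤ ((|s| : ℤ) : ℝ) := by exact_mod_cast hg
    push_cast at this; exact this
  have hs2 : |(s : ℝ)| ≤ l * N := by
    rw [hs]; push_cast
    refine (Finset.abs_sum_le_sum_abs _ _).trans ?_
    have : ∀ i ∈ (univ : Finset (Fin l)), |(ε i : ℝ) * j i| ≤ N := by
      intro i _
      rw [abs_mul]
      have h1 : |(ε i : ℝ)| ≤ 1 := by
        have := hε i
        have h' : ((|ε i| : ℤ) : ℝ) ≤ ((1 : ℤ) : ℝ) := by exact_mod_cast this
        push_cast at h'; exact h'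
      have := mul_le_mul h1 (hjN i) (abs_nonneg _) zero_le_one
      linarith
    refine (Finset.sum_le_sum this).trans (le_of_eq ?_)
    simp
  have hW' : (1 : ℝ) ≤ W := by exact_mod_cast hW1
  have hspos : 0 < |(s : ℝ)| := by linarith
  rw [hsum]
  have hb : |(s : ℝ) / (N * sn)| = |(s : ℝ)| / (N * sn) := by
    rw [abs_div, abs_of_pos (by positivity : (0 : ℝ) < N * sn)]
  have hD := DD_le hQ ((s : ℝ) / (N * sn)) (by
      apply div_ne_zero (abs_pos.1 hspos) (by positivity)) (by
      rw [hb, div_le_iff₀ (by positivity)]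
      have := Real.pi_gt_three
      calc |(s : ℝ)| ≤ l * N := hs2
        _ ≤ (3 * sn) * N := by gcongr
        _ ≤ Real.pi * (N * sn) := by nlinarith [mul_pos hsn (by linarith : (0 : ℝ) < N)])
  refine hD.trans ?_
  rw [hb, div_le_div_iff₀ (by
    have : 0 < |(s : ℝ)| / (N * sn) := by positivity
    positivity) (by positivity), one_mul]
  calc Real.pi * (Fintype.card κ : ℝ) ^ l = (Real.pi * sn * (Fintype.card κ : ℝ) ^ l) / sn := by field_simp
    _ ≤ |(s : ℝ)| / sn := by gcongr; linarith
    _ = N * (|(s : ℝ)| / (N * sn)) := by field_simp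
    _ ≤ Q * (|(s : ℝ)| / (N * sn)) := by gcongr

theorem nonnice {Q : ℕ} (hQ : 1 ≤ Q) (e : (β × κ) ⊕ ρ ≃ ι) (a : ι → ℤ) {i1 i2 : κ} (hi : i1 ≠ i2)
    (N : ℕ) (hN : 1 ≤ N) (hNQ : N ≤ Q) (sn c : ℝ) (hsn : 0 < sn) (hc : 0 < c) (hcQ : N ≤ Q * c)
    (l W H lam : ℕ) (hlsn : (l : ℝ) ≤ 3 * sn) (hW1 : 1 ≤ W)
    (hW : Real.pi * sn * (Fintype.card κ : ℝ) ^ l ≤ W) (hH : 1 ≤ H) (hHsn : (H : ℝ) ≤ 3 * sn) (ρ0 : ℝ)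
    (hρ : 400 / H + (1 - 1 / (4 * (H : ℝ) ^ 2 * Fintype.card κ)) ^ lam ≤ ρ0) (hρ1 : ρ0 ≤ 1)
    (g0 : ℕ) (hg0 : 10 * g0 ≤ Fintype.card β + 9) :
    PP (uw ι Q) (fun f => ¬ Nice e N sn c (zz a f)) ≤
      2 ^ (Fintype.card β) * (2 * (N : ℝ) * (ρ0 ^ g0 * (2 * (3 ^ l * (2 * W + 1))) ^ lam)) +
      2 ^ (Fintype.card β) * ((2 * (N : ℝ)) ^ l * ((4 * (N : ℝ)) ^ (2 * l) * (2 / (Fintype.card κ : ℝ) ^ l) ^ g0)) := by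
  classical
  have hw := isW_uw ι hQ
  have hN' : (1 : ℝ) ≤ N := by exact_mod_cast hN
  have hk2 : 2 ≤ Fintype.card κ := by
    have := Fintype.one_lt_card_iff.2 ⟨i1, i2, hi⟩; omega
  have hk' : (2 : ℝ) ≤ Fintype.card κ := by exact_mod_cast hk2
  set J := (Ioo (-(N : ℤ)) N).filter (fun j : ℤ => c * sn < |(j : ℝ)|) with hJ
  set GS := univ.filter (fun G : Finset β => Fintype.card β ≤ 10 * G.card) with hGS
  set R : ℝ := 3 ^ l * (2 * W + 1) with hR
  have hR0 : 0 < R := by positivity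
  set s0 : ℝ := 1 / (2 * R) with hs0d
  have hs0 : 0 < s0 := by positivity
  set TT : Finset (Fin l → ℤ) := (Fintype.piFinset (fun _ : Fin l => J)).filter (Gen l W) with hTT
  have hJabs : ∀ j ∈ J, |(j : ℝ)| ≤ N := by
    intro j hj
    rw [hJ, Finset.mem_filter, mem_Ioo] at hj
    have h1 : |j| ≤ N := abs_le.2 ⟨hj.1.1.le, hj.1.2.le⟩
    have : ((|j| : ℤ) : ℝ) ≤ ((N : ℤ) : ℝ) := by exact_mod_cast h1
    push_cast at this; exact this
  have hJcard : J.card ≤ 2 * N := by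
    refine (Finset.card_filter_le _ _).trans ?_
    rw [Int.card_Ioo]; omega
  have hincl : ∀ f : ι → Fin Q, ¬ Nice e N sn c (zz a f) →
      (∃ G ∈ GS, ∃ j ∈ J, s0 ≤ FG e (zz a f) G ((j : ℝ) / (N * sn))) ∨
      (∃ G ∈ GS, ∃ t ∈ TT, ∀ i, 1 / (4 * (N : ℝ)) ≤ FG e (zz a f) G ((t i : ℝ) / (N * sn))) := by
    intro f hf
    by_contra hcon
    push Not at hcon
    obtain ⟨hc1, hc2⟩ := hcon
    apply hf
    intro G hG
    have hGm : G ∈ GS := by rw [hGS, Finset.mem_filter]; exact ⟨Finset.mem_univ _, hG⟩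
    set T := J.filter (fun j : ℤ => 1 / (4 * (N : ℝ)) ≤ FG e (zz a f) G ((j : ℝ) / (N * sn))) with hT
    have hTc : T.card < 3 ^ l * (2 * W + 1) := by
      by_contra hh
      push Not at hh
      obtain ⟨t, ht1, ht2⟩ := greedy W T l hh
      obtain ⟨i, hi'⟩ := hc2 G hGm t (by
        rw [hTT, Finset.mem_filter, Fintype.mem_piFinset]
        exact ⟨fun i => (Finset.mem_filter.1 (ht1 i)).1, ht2⟩)
      exact absurd (Finset.mem_filter.1 (ht1 i)).2 (not_le.2 hi')
    have hTc' : (T.card : ℝ) ≤ R := by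
      rw [hR]; exact_mod_cast hTc.le
    rw [← Finset.sum_filter_add_sum_filter_not J (fun j : ℤ => 1 / (4 * (N : ℝ)) ≤ FG e (zz a f) G ((j : ℝ) / (N * sn)))]
    have s1 : ∑ j ∈ T, FG e (zz a f) G ((j : ℝ) / (N * sn)) ≤ 1 / 2 := by
      have : ∀ j ∈ T, FG e (zz a f) G ((j : ℝ) / (N * sn)) ≤ s0 := fun j hj => (hc1 G hGm j (Finset.mem_filter.1 hj).1).le
      refine (Finset.sum_le_card_nsmul _ _ _ this).trans ?_
      rw [nsmul_eq_mul]
      calc (T.card : ℝ) * s0 ≤ R * s0 := by gcongr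
        _ = 1 / 2 := by rw [hs0d]; field_simp
    have s2 : ∑ j ∈ J.filter (fun j : ℤ => ¬ 1 / (4 * (N : ℝ)) ≤ FG e (zz a f) G ((j : ℝ) / (N * sn))), FG e (zz a f) G ((j : ℝ) / (N * sn)) ≤ 1 / 2 := by
      have : ∀ j ∈ J.filter (fun j : ℤ => ¬ 1 / (4 * (N : ℝ)) ≤ FG e (zz a f) G ((j : ℝ) / (N * sn))),
         FG e (zz a f) G ((j : ℝ) / (N * sn)) ≤ 1 / (4 * (N : ℝ)) := fun j hj => (not_le.1 (Finset.mem_filter.1 hj).2).le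
      refine (Finset.sum_le_card_nsmul _ _ _ this).trans ?_
      rw [nsmul_eq_mul]
      have hc' : ((J.filter (fun j : ℤ => ¬ 1 / (4 * (N : ℝ)) ≤ FG e (zz a f) G ((j : ℝ) / (N * sn)))).card : ℝ) ≤ 2 * N := by
        exact_mod_cast (Finset.card_filter_le _ _).trans hJcard
      calc _ ≤ (2 * N) * (1 / (4 * (N : ℝ))) := by gcongr
        _ = 1 / 2 := by field_simp; norm_num
    linarith
  refine (PP_mono hw hincl).trans ((PP_or hw _ _).trans (add_le_add ?_ ?_))
  · refine (PP_exists hw GS _).trans ?_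
    have hG : ∀ G ∈ GS, PP (uw ι Q) (fun f => ∃ j ∈ J, s0 ≤ FG e (zz a f) G ((j : ℝ) / (N * sn))) ≤
       2 * (N : ℝ) * (ρ0 ^ g0 * (2 * R) ^ lam) := by
      intro G hG
      rw [hGS, Finset.mem_filter] at hG
      have hgG : g0 ≤ G.card := by omega
      have hρ0 : 0 ≤ 400 / H + (1 - 1 / (4 * (H : ℝ) ^ 2 * Fintype.card κ)) ^ lam := by
        have hH' : (1 : ℝ) ≤ H := by exact_mod_cast hH
        have hsmall : 0 ≤ 1 - 1 / (4 * (H : ℝ) ^ 2 * Fintype.card κ) := by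
          rw [sub_nonneg, div_le_one (by positivity)]
          nlinarith
        positivity
      refine (PP_exists hw J _).trans ?_
      have hj : ∀ j ∈ J, PP (uw ι Q) (fun f => s0 ≤ FG e (zz a f) G ((j : ℝ) / (N * sn))) ≤ ρ0 ^ g0 * (2 * R) ^ lam := by
        intro j hj
        have hjN := hJabs j hj
        have hjc := (Finset.mem_filter.1 hj).2
        have habs : |(j : ℝ) / (N * sn)| = |(j : ℝ)| / (N * sn) := by
          rw [abs_div, abs_of_pos (by positivity : (0 : ℝ) < N * sn)]
        refine (FG_pow_prob hQ e a hi ((j : ℝ) / (N * sn)) H lam hH ?_ ?_ G s0 hs0).trans ?_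
        · rw [habs, mul_div_assoc', le_div_iff₀ (by positivity), one_mul]
          calc (N : ℝ) * sn ≤ (Q * c) * sn := by gcongr
            _ = Q * (c * sn) := by ring
            _ ≤ _ := by gcongr
        · rw [habs]
          have := Real.pi_gt_three
          calc (H : ℝ) * (|(j : ℝ)| / (N * sn)) ≤ (3 * sn) * (N / (N * sn)) := by gcongr
            _ = 3 := by field_simp
            _ ≤ Real.pi := this.le
        · have e1 : ∀ x : ℝ, x / s0 ^ lam = x * (2 * R) ^ lam := by
            intro x; rw [hs0d, div_pow, one_pow]; field_simp
          rw [e1]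
          refine mul_le_mul_of_nonneg_right ?_ (by positivity)
          exact (pow_le_pow_left₀ hρ0 hρ _).trans (pow_le_pow_of_le_one (hρ0.trans hρ) hρ1 hgG)
      refine (Finset.sum_le_card_nsmul _ _ _ hj).trans ?_
      rw [nsmul_eq_mul]
      have : (J.card : ℝ) ≤ 2 * N := by exact_mod_cast hJcard
      have hnn : 0 ≤ ρ0 ^ g0 * (2 * R) ^ lam := by
        have := hρ0.trans hρ
        positivity
      exact mul_le_mul_of_nonneg_right this hnn
    refine (Finset.sum_le_card_nsmul _ _ _ hG).trans ?_
    rw [nsmul_eq_mul]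
    have hGc : (GS.card : ℝ) ≤ 2 ^ (Fintype.card β) := by
      have := Finset.card_filter_le (univ : Finset (Finset β)) (fun G : Finset β => Fintype.card β ≤ 10 * G.card)
      rw [Finset.card_univ, Fintype.card_finset] at this
      exact_mod_cast this
    refine mul_le_mul_of_nonneg_right hGc ?_
    have h400 : 0 ≤ ρ0 := by
      refine le_trans ?_ hρ
      have hH' : (1 : ℝ) ≤ H := by exact_mod_cast hH
      have hsmall : 0 ≤ 1 - 1 / (4 * (H : ℝ) ^ 2 * Fintype.card κ) := by
        rw [sub_nonneg, div_le_one (by positivity)]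
        nlinarith
      positivity
    positivity
  · refine (PP_exists hw GS _).trans ?_
    have hG : ∀ G ∈ GS, PP (uw ι Q) (fun f => ∃ t ∈ TT, ∀ i, 1 / (4 * (N : ℝ)) ≤ FG e (zz a f) G ((t i : ℝ) / (N * sn))) ≤
       (2 * (N : ℝ)) ^ l * ((4 * (N : ℝ)) ^ (2 * l) * (2 / (Fintype.card κ : ℝ) ^ l) ^ g0) := by
      intro G hG
      rw [hGS, Finset.mem_filter] at hG
      have hgG : g0 ≤ G.card := by omega
      refine (PP_exists hw TT _).trans ?_
      have ht : ∀ t ∈ TT, PP (uw ι Q) (fun f => ∀ i, 1 / (4 * (N : ℝ)) ≤ FG e (zz a f) G ((t i : ℝ) / (N * sn))) ≤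
          (4 * (N : ℝ)) ^ (2 * l) * (2 / (Fintype.card κ : ℝ) ^ l) ^ g0 := by
        intro t ht
        rw [hTT, Finset.mem_filter, Fintype.mem_piFinset] at ht
        by_cases hl : l = 0
        · subst hl
          refine (PP_le_one hw _).trans ?_
          simp only [mul_zero, pow_zero, one_mul, div_one]
          exact one_le_pow₀ (by norm_num)
        refine (FG_tuple_prob hQ e a (by omega) N hN hNQ sn hsn l W hlsn hW1 hW t (fun i => hJabs _ (ht.1 i)) ht.2 G).trans ?_
        refine mul_le_mul_of_nonneg_left ?_ (by positivity)
        refine pow_le_pow_of_le_one (by positivity) ?_ hgG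
        rw [div_le_one (by positivity)]
        calc (2 : ℝ) ≤ Fintype.card κ := hk'
          _ = (Fintype.card κ : ℝ) ^ 1 := (pow_one _).symm
          _ ≤ _ := pow_le_pow_right₀ (by linarith) (by omega)
      refine (Finset.sum_le_card_nsmul _ _ _ ht).trans ?_
      rw [nsmul_eq_mul]
      refine mul_le_mul_of_nonneg_right ?_ (by positivity)
      have : TT.card ≤ (2 * N) ^ l := by
        refine (Finset.card_filter_le _ _).trans ?_
        rw [Fintype.card_piFinset]
        simp only [Finset.prod_const, Finset.card_univ, Fintype.card_fin]
        exact Nat.pow_le_pow_left hJcard l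
      exact_mod_cast this
    refine (Finset.sum_le_card_nsmul _ _ _ hG).trans ?_
    rw [nsmul_eq_mul]
    have hGc : (GS.card : ℝ) ≤ 2 ^ (Fintype.card β) := by
      have := Finset.card_filter_le (univ : Finset (Finset β)) (fun G : Finset β => Fintype.card β ≤ 10 * G.card)
      rw [Finset.card_univ, Fintype.card_finset] at this
      exact_mod_cast this
    exact mul_le_mul_of_nonneg_right hGc (by positivity)

end U

end SCP

namespace SCP

section FixedZ
variable {β κ ρ ι ν : Type*} [Fintype β] [DecidableEq β] [Fintype κ] [DecidableEq κ] [Fintype ρ] [DecidableEq ρ]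
  [Fintype ι] [DecidableEq ι] [Fintype ν] [DecidableEq ν]

open Classical in
/-- number of non-good columns besides `j` -/
noncomputable def nbad (e : (β × κ) ⊕ ρ ≃ ι) (j : ν) (A : ν → ι → Bool) : ℕ :=
  ((univ.erase j).filter (fun i => ¬ Good e (A i))).card

/-- smoothed concentration functional -/
noncomputable def Phi (e : (β × κ) ⊕ ρ ≃ ι) (p sn v : ℝ) (z : ι → ℝ) : ℝ :=
  EE (wv ι p) (fun C => ind (Good e C) * gk ((XX z C - v) / sn))

theorem exp_le_gk (x : ℝ) : Real.exp (-x ^ 2) ≤ gk x := by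
  unfold gk
  rw [Real.exp_neg, ← one_div]
  apply one_div_le_one_div_of_le (by positivity)
  have := Real.add_one_le_exp (x ^ 2)
  linarith

theorem fixed_z (e : (β × κ) ⊕ ρ ≃ ι) {p : ℝ} (h0 : 0 ≤ p) (h1 : p ≤ 1) (j : ν) {N B R sn : ℝ} (hN : 1 ≤ N)
    (hB0 : 0 ≤ B) (hsn : 0 < sn) (D : ℕ) (z : ι → ℝ) (hB : Phi e p sn 0 z ≤ B / N) :
    PP (wm ν ι p) (fun A => ∑ i ∈ univ.erase j, (XX z (A i)) ^ 2 ≤ R * sn ^ 2 ∧ nbad e j A < D) ≤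
      Real.exp R * N ^ D * ((B + 1) / N) ^ (Fintype.card ν - 1) := by
  classical
  have hN0 : 0 < N := by linarith
  set h : (ι → Bool) → ℝ := fun C => ind (Good e C) * gk ((XX z C - 0) / sn) + ind (¬ Good e C) * (1 / N) with hh
  set H : ν → (ι → Bool) → ℝ := fun i C => if i = j then 1 else h C with hH
  have hhpos : ∀ C, 0 ≤ h C := fun C => by
    have := gk_pos ((XX z C - 0) / sn)
    have := ind_nonneg (Good e C)
    have := ind_nonneg (¬ Good e C)
    simp only [hh]; positivity
  have hprod : ∀ A : ν → ι → Bool, ∏ i, H i (A i) = ∏ i ∈ univ.erase j, h (A i) := fun A => by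
    rw [← Finset.mul_prod_erase univ _ (mem_univ j)]
    simp only [hH, if_true, one_mul]
    apply prod_congr rfl
    intro i hi
    rw [if_neg (ne_of_mem_erase hi)]
  have key : ∀ A : ν → ι → Bool, ind (∑ i ∈ univ.erase j, (XX z (A i)) ^ 2 ≤ R * sn ^ 2 ∧ nbad e j A < D) ≤
      Real.exp R * N ^ D * ∏ i, H i (A i) := fun A => by
    rw [hprod]
    by_cases hA : ∑ i ∈ univ.erase j, (XX z (A i)) ^ 2 ≤ R * sn ^ 2 ∧ nbad e j A < D
    · rw [ind_true hA]
      have hi : ∀ i ∈ univ.erase j, Real.exp (-(XX z (A i) / sn) ^ 2) * (if ¬ Good e (A i) then 1 / N else 1) ≤ h (A i) := by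
        intro i _
        by_cases hg : Good e (A i)
        · simp only [hh, hg, not_true, if_false, mul_one, sub_zero]
          rw [ind_true trivial, ind_false (by simp)]
          have := exp_le_gk (XX z (A i) / sn)
          linarith
        · simp only [hh, hg, not_false_eq_true, if_true]
          rw [ind_true trivial, ind_false (by simp), zero_mul, zero_add, one_mul]
          have : Real.exp (-(XX z (A i) / sn) ^ 2) ≤ 1 := Real.exp_le_one_iff.mpr (by nlinarith [sq_nonneg (XX z (A i) / sn)])
          have h1N : 0 ≤ 1 / N := by positivity
          nlinarith
      have h2 : ∏ i ∈ univ.erase j, (Real.exp (-(XX z (A i) / sn) ^ 2) * (if ¬ Good e (A i) then 1 / N else 1)) ≤ ∏ i ∈ univ.erase j, h (A i) := by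
        apply prod_le_prod
        · intro i _
          have : 0 ≤ (if ¬ Good e (A i) then 1 / N else 1) := by split_ifs <;> positivity
          positivity
        · exact hi
      rw [prod_mul_distrib, ← Real.exp_sum, Finset.prod_ite, prod_const, prod_const_one, mul_one] at h2
      have h3 : Real.exp (-R) ≤ Real.exp (∑ i ∈ univ.erase j, -(XX z (A i) / sn) ^ 2) := by
        apply Real.exp_le_exp.mpr
        rw [Finset.sum_neg_distrib]
        have : ∑ i ∈ univ.erase j, (XX z (A i) / sn) ^ 2 = (∑ i ∈ univ.erase j, (XX z (A i)) ^ 2) / sn ^ 2 := by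
          rw [sum_div]; exact sum_congr rfl (fun i _ => by rw [div_pow])
        rw [this]
        have : (∑ i ∈ univ.erase j, (XX z (A i)) ^ 2) / sn ^ 2 ≤ R := by
          rw [div_le_iff₀ (by positivity)]; exact hA.1
        linarith
      have h4 : (1 / N) ^ D ≤ (1 / N) ^ (nbad e j A) :=
        pow_le_pow_of_le_one (by positivity) (by rw [div_le_one hN0]; exact hN) hA.2.le
      have h5 : Real.exp (-R) * (1 / N) ^ D ≤ ∏ i ∈ univ.erase j, h (A i) := by
        refine le_trans (mul_le_mul h3 h4 (by positivity) (by positivity)) ?_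
        refine le_trans (le_of_eq ?_) h2
        unfold nbad
        congr!
      calc (1 : ℝ) = Real.exp R * N ^ D * (Real.exp (-R) * (1 / N) ^ D) := by
            rw [Real.exp_neg, one_div, inv_pow]
            field_simp
        _ ≤ _ := mul_le_mul_of_nonneg_left h5 (by positivity)
    · rw [ind_false hA]
      have := prod_nonneg (fun i (_ : i ∈ univ.erase j) => hhpos (A i))
      positivity
  have hw : IsW (wm ν ι p) := isW_wm h0 h1
  have hwv : IsW (wv ι p) := isW_wv h0 h1
  unfold PP
  refine le_trans (EE_mono hw key) ?_
  rw [EE_smul, EE_prod]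
  apply mul_le_mul_of_nonneg_left _ (by positivity)
  have hs : ∀ i, ∑ a, wm ν ι p i a * H i a = if i = j then 1 else EE (wv ι p) h := by
    intro i
    by_cases hij : i = j
    · simp only [hH, hij, if_true, mul_one]
      exact hw.2 j
    · simp only [hH, hij, if_false]
      rfl
  simp only [hs]
  rw [← Finset.mul_prod_erase univ _ (mem_univ j), if_pos rfl, one_mul]
  have : ∏ x ∈ univ.erase j, (if x = j then (1:ℝ) else EE (wv ι p) h) = EE (wv ι p) h ^ (Fintype.card ν - 1) := by
    rw [prod_congr rfl (fun i hi => if_neg (ne_of_mem_erase hi)), prod_const, card_erase_of_mem (mem_univ j)]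
    rfl
  rw [this]
  apply pow_le_pow_left₀ (EE_nonneg hwv hhpos)
  simp only [hh]
  rw [EE_add]
  have e1 : EE (wv ι p) (fun C => ind (¬ Good e C) * (1 / N)) ≤ 1 / N := by
    apply EE_le_const hwv
    intro C
    have := ind_le_one (¬ Good e C)
    have h1N : 0 ≤ 1 / N := by positivity
    nlinarith
  unfold Phi at hB
  rw [add_div]
  linarith

theorem EE_comm {κ' α' κ2 α2 : Type*} [Fintype κ'] [DecidableEq κ'] [Fintype α'] [Fintype κ2] [DecidableEq κ2] [Fintype α2]
    (w : κ' → α' → ℝ) (w' : κ2 → α2 → ℝ) (F : (κ' → α') → (κ2 → α2) → ℝ) :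
    EE w (fun f => EE w' (fun C => F f C)) = EE w' (fun C => EE w (fun f => F f C)) := by
  simp only [EE, mul_sum]
  rw [sum_comm]
  exact sum_congr rfl (fun _ _ => sum_congr rfl (fun _ _ => by ring))

theorem gk_pert (a ζ : ℝ) : gk (a + ζ) ≤ 2 * (1 + ζ ^ 2) * gk a := by
  unfold gk
  rw [mul_one_div, div_le_div_iff₀ (by positivity) (by positivity)]
  nlinarith [sq_nonneg (a + 2 * ζ), sq_nonneg (ζ * (a + ζ)), sq_nonneg ζ, sq_nonneg a]

theorem gk_pert2 (a ζ : ℝ) : gk a * (1 - ζ ^ 2) / 2 ≤ gk (a + ζ) := by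
  have h := gk_pert (a + ζ) (-ζ)
  rw [add_neg_cancel_right, neg_sq] at h
  have := gk_pos (a + ζ)
  by_cases h1 : ζ ^ 2 ≤ 1
  · have : gk a * (1 - ζ ^ 2) ≤ 2 * (1 + ζ ^ 2) * gk (a + ζ) * (1 - ζ ^ 2) :=
      mul_le_mul_of_nonneg_right h (by linarith)
    nlinarith [sq_nonneg (ζ ^ 2)]
  · have := gk_pos a
    nlinarith

theorem round_exists (e : (β × κ) ⊕ ρ ≃ ι) {p : ℝ} (h0 : 0 ≤ p) (h1 : p ≤ 1) {sn v K : ℝ} (hsn : 0 < sn)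
    (hcard : (Fintype.card ι : ℝ) = sn ^ 2) (z : ι → ℝ) (hΦ : 0 < Phi e p sn v z) (hK : 0 < K)
    (hΦ0 : Phi e p sn 0 z ≤ K) (S : Finset ν) (hS : (S.card : ℝ) ≤ sn ^ 2) (A : ν → ι → Bool)
    (hA : ∀ i ∈ S, XX z (A i) = 0) :
    ∃ f, Phi e p sn v z / 8 ≤ Phi e p sn v (fun i => (rd z f i : ℝ)) ∧
      Phi e p sn 0 (fun i => (rd z f i : ℝ)) ≤ 10 * K ∧
      ∑ i ∈ S, (XX (fun i => (rd z f i : ℝ)) (A i)) ^ 2 ≤ sn ^ 2 * sn ^ 2 := by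
  have hwr := isW_rwt z
  have hwv : IsW (wv ι p) := isW_wv h0 h1
  set zt : (ι → Bool) → (ι → Bool) → ℝ := fun f C => (XX (fun i => (rd z f i : ℝ)) C - XX z C) / sn with hzt
  have hzE : ∀ C, EE (rwt z) (fun f => zt f C ^ 2) ≤ 1 / 4 := by
    intro C
    have := rd_var_le z C
    simp only [hzt, div_pow]
    rw [EE_div, div_le_iff₀ (by positivity)]
    rw [hcard] at this
    linarith
  set Δ : (ι → Bool) → ℝ := fun f => EE (wv ι p) (fun C => ind (Good e C) * gk ((XX z C - v) / sn) * zt f C ^ 2) with hΔ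
  have hgg : ∀ v C, 0 ≤ ind (Good e C) * gk ((XX z C - v) / sn) := fun v C =>
    mul_nonneg (ind_nonneg _) (gk_pos _).le
  have hΔE : EE (rwt z) Δ ≤ 1 / 4 * Phi e p sn v z := by
    simp only [hΔ]
    rw [EE_comm]
    unfold Phi
    rw [← EE_smul]
    apply EE_mono hwv
    intro C
    rw [EE_smul]
    have := hzE C
    have := hgg v C
    nlinarith
  have hdec : ∀ v f C, (XX (fun i => (rd z f i : ℝ)) C - v) / sn = (XX z C - v) / sn + zt f C := by
    intro v f C; simp only [hzt]; ring
  have hlow : ∀ f, (Phi e p sn v z - Δ f) / 2 ≤ Phi e p sn v (fun i => (rd z f i : ℝ)) := by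
    intro f
    simp only [hΔ]
    unfold Phi
    rw [← EE_sub, ← EE_div]
    apply EE_mono hwv
    intro C
    rw [hdec]
    have := gk_pert2 ((XX z C - v) / sn) (zt f C)
    have := mul_le_mul_of_nonneg_left this (ind_nonneg (Good e C))
    linarith
  have hup : EE (rwt z) (fun f => Phi e p sn 0 (fun i => (rd z f i : ℝ))) ≤ 5 / 2 * K := by
    unfold Phi
    rw [EE_comm]
    refine le_trans ?_ (mul_le_mul_of_nonneg_left hΦ0 (by norm_num))
    unfold Phi
    rw [← EE_smul]
    apply EE_mono hwv
    intro C
    rw [EE_smul]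
    have h2 : EE (rwt z) (fun f => gk ((XX (fun i => (rd z f i : ℝ)) C - 0) / sn)) ≤ 5 / 2 * gk ((XX z C - 0) / sn) := by
      have h3 : EE (rwt z) (fun f => gk ((XX (fun i => (rd z f i : ℝ)) C - 0) / sn)) ≤
        EE (rwt z) (fun f => (2 * gk ((XX z C - 0) / sn)) * (1 + zt f C ^ 2)) := by
        apply EE_mono hwr
        intro f
        rw [hdec]
        have := gk_pert ((XX z C - 0) / sn) (zt f C)
        linarith
      rw [EE_smul, EE_add, EE_const hwr] at h3
      have := hzE C
      have := gk_pos ((XX z C - 0) / sn)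
      nlinarith
    have := mul_le_mul_of_nonneg_left h2 (ind_nonneg (Good e C))
    linarith
  have hcol : EE (rwt z) (fun f => ∑ i ∈ S, (XX (fun i => (rd z f i : ℝ)) (A i)) ^ 2) ≤ 1 / 4 * (sn ^ 2 * sn ^ 2) := by
    rw [EE_sum]
    have : ∀ i ∈ S, EE (rwt z) (fun f => (XX (fun i => (rd z f i : ℝ)) (A i)) ^ 2) ≤ sn ^ 2 / 4 := by
      intro i hi
      have := rd_var_le z (A i)
      rw [hcard] at this
      simpa only [hA i hi, sub_zero] using this
    refine le_trans (sum_le_card_nsmul _ _ _ this) ?_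
    rw [nsmul_eq_mul]
    nlinarith [sq_nonneg sn]
  have hsn4 : 0 < sn ^ 2 * sn ^ 2 := by positivity
  have hT : EE (rwt z) (fun f => Δ f / (3 / 4 * Phi e p sn v z) + Phi e p sn 0 (fun i => (rd z f i : ℝ)) / (10 * K) +
      (∑ i ∈ S, (XX (fun i => (rd z f i : ℝ)) (A i)) ^ 2) / (sn ^ 2 * sn ^ 2)) < 1 := by
    rw [EE_add, EE_add, EE_div, EE_div, EE_div]
    have a1 : EE (rwt z) Δ / (3 / 4 * Phi e p sn v z) ≤ 1 / 3 := by
      rw [div_le_iff₀ (by positivity)]; linarith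
    have a2 : EE (rwt z) (fun f => Phi e p sn 0 (fun i => (rd z f i : ℝ))) / (10 * K) ≤ 1 / 4 := by
      rw [div_le_iff₀ (by positivity)]; linarith
    have a3 : EE (rwt z) (fun f => ∑ i ∈ S, (XX (fun i => (rd z f i : ℝ)) (A i)) ^ 2) / (sn ^ 2 * sn ^ 2) ≤ 1 / 4 := by
      rw [div_le_iff₀ (by positivity)]; linarith
    have a1' : EE (rwt z) (fun f => Δ f) / (3 / 4 * Phi e p sn v z) ≤ 1 / 3 := a1
    linarith
  obtain ⟨f, hf⟩ := exists_lt_of_EE_lt hwr hT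
  have b1 : 0 ≤ Δ f / (3 / 4 * Phi e p sn v z) := by
    apply div_nonneg _ (by positivity)
    exact EE_nonneg hwv (fun C => mul_nonneg (hgg v C) (sq_nonneg _))
  have b2 : 0 ≤ Phi e p sn 0 (fun i => (rd z f i : ℝ)) / (10 * K) := by
    apply div_nonneg _ (by positivity)
    exact EE_nonneg hwv (fun C => mul_nonneg (ind_nonneg _) (gk_pos _).le)
  have b3 : 0 ≤ (∑ i ∈ S, (XX (fun i => (rd z f i : ℝ)) (A i)) ^ 2) / (sn ^ 2 * sn ^ 2) :=
    div_nonneg (sum_nonneg (fun i _ => sq_nonneg _)) hsn4.le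
  refine ⟨f, ?_, ?_, ?_⟩
  · have : Δ f / (3 / 4 * Phi e p sn v z) ≤ 1 := by linarith
    rw [div_le_one (by positivity)] at this
    have := hlow f
    linarith
  · have : Phi e p sn 0 (fun i => (rd z f i : ℝ)) / (10 * K) ≤ 1 := by linarith
    rwa [div_le_one (by positivity)] at this
  · have : (∑ i ∈ S, (XX (fun i => (rd z f i : ℝ)) (A i)) ^ 2) / (sn ^ 2 * sn ^ 2) ≤ 1 := by linarith
    rwa [div_le_one (by positivity)] at this

end FixedZ
end SCP

namespace SCP

section HB
variable {β κ ρ : Type*} [Fintype β] [DecidableEq β] [Fintype κ] [DecidableEq κ] [Fintype ρ] [DecidableEq ρ]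

/-- good anti-concentration at scale N -/
def LOg {n : ℕ} (e : (β × κ) ⊕ ρ ≃ Fin n) (p sn L N : ℝ) (Y : Fin n → ℝ) : Prop :=
  ∀ v, Phi e p sn v (fun i => N * Y i) ≤ L / N

/-- exceptional event: a normal with bad anti-concentration -/
def Hbad {n : ℕ} (e : (β × κ) ⊕ ρ ≃ Fin n) (p sn θ L : ℝ) (i0 I D : ℕ) (j : Fin n) (A : Fin n → Fin n → Bool) : Prop :=
  ∃ Y : Fin n → ℝ, Grad θ Y ∧ (∀ i, i ≠ j → XX Y (A i) = 0) ∧ nbad e j A < D ∧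
    ∃ i, i0 ≤ i ∧ i ≤ I ∧ ¬ LOg e p sn L (2 ^ i) Y

theorem gk_anti {a b : ℝ} (h : |a| ≤ |b|) : gk b ≤ gk a := by
  unfold gk
  apply one_div_le_one_div_of_le (by positivity)
  have := sq_le_sq.mpr h
  linarith

theorem Phi_le_one {n : ℕ} (e : (β × κ) ⊕ ρ ≃ Fin n) {p : ℝ} (h0 : 0 ≤ p) (h1 : p ≤ 1) (sn v : ℝ) (z : Fin n → ℝ) :
    Phi e p sn v z ≤ 1 := by
  apply EE_le_const (isW_wv h0 h1)
  intro C
  have := gk_le_one ((XX z C - v) / sn)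
  have := gk_pos ((XX z C - v) / sn)
  have := ind_le_one (Good e C)
  have := ind_nonneg (Good e C)
  nlinarith

theorem hbad_witness {n : ℕ} (e : (β × κ) ⊕ ρ ≃ Fin n) {p q θ L sn : ℝ} (hκ : 0 < Fintype.card κ) (hq : 0 < q) (hqp : q ≤ p)
    (hp : p ≤ 1 / 2) (hθ : 0 < θ) (hθ1 : θ ≤ 1) (hsn : 0 < sn) (hn : (n : ℝ) = sn ^ 2) (i0 I D : ℕ)
    (hL2 : 8 * (20 * (3 + 2 / (q * (θ ^ 2 / 16) * θ ^ 2 / 160))) ≤ L) (hL0 : (2 : ℝ) ^ i0 ≤ L)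
    (hi0 : 4 / θ ≤ 2 ^ i0)
    (hng : (θ * sn + 1) * PP (wv (Fin n) p) (fun C => ¬ Good e C) ≤ 1) (j : Fin n) (A : Fin n → Fin n → Bool)
    (h : Hbad e p sn θ L i0 I D j A) :
    ∃ i ∈ range (I + 1), ∃ z : Fin n → ℤ, ∑ w, |(z w : ℝ)| ≤ 6 * 2 ^ i * n ∧ ¬ Nice e (2 ^ i) sn (θ / 2) (fun w => (z w : ℝ)) ∧
      Phi e p sn 0 (fun w => (z w : ℝ)) ≤ 20 * L / 2 ^ i ∧
      ∑ r ∈ univ.erase j, (XX (fun w => (z w : ℝ)) (A r)) ^ 2 ≤ n * sn ^ 2 ∧ nbad e j A < D := by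
  classical
  obtain ⟨Y, hG, hX, hnb, i, hi1, hi2, hbad⟩ := h
  have hp0 : 0 ≤ p := by linarith
  have hp1 : p ≤ 1 := by linarith
  have hLpos : 0 < L := lt_of_lt_of_le (by positivity) hL0
  -- first bad scale
  have hex : ∃ i, i0 ≤ i ∧ i ≤ I ∧ ¬ LOg e p sn L (2 ^ i) Y := ⟨i, hi1, hi2, hbad⟩
  obtain ⟨ha, hb, hc⟩ := Nat.find_spec hex
  have hmin := fun m => Nat.find_min hex (m := m)
  set k := Nat.find hex with hk
  have hk0 : k ≠ i0 := by
    intro hk0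
    apply hc
    intro v
    refine (Phi_le_one e hp0 hp1 sn v _).trans ?_
    rw [le_div_iff₀ (by positivity), one_mul, hk0]
    exact hL0
  have hprev : LOg e p sn L (2 ^ (k - 1)) Y := by
    by_contra hcon
    exact hmin (k - 1) (by omega) ⟨by omega, by omega, hcon⟩
  have hkpow : (2 : ℝ) ^ k = 2 * 2 ^ (k - 1) := by
    rw [← pow_succ']; congr 1; omega
  unfold LOg at hc
  push Not at hc
  obtain ⟨v, hv⟩ := hc
  set N : ℝ := 2 ^ k with hN
  have hNpos : 0 < N := by positivity
  have hNθ : 4 / θ ≤ N := hi0.trans (pow_le_pow_right₀ (by norm_num) ha)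
  have hNθ' : 4 ≤ N * θ := by rwa [div_le_iff₀ hθ] at hNθ
  have hN1 : 4 ≤ N := by nlinarith
  set z : Fin n → ℝ := fun i => N * Y i with hz
  have hΦ0 : Phi e p sn 0 z ≤ 2 * L / N := by
    have h1 := hprev 0
    have h2 : L / 2 ^ (k - 1) = 2 * L / N := by rw [hkpow]; field_simp
    rw [← h2]
    refine le_trans ?_ h1
    apply EE_mono (isW_wv hp0 hp1)
    intro C
    apply mul_le_mul_of_nonneg_left _ (ind_nonneg _)
    apply gk_anti
    rw [sub_zero, sub_zero, XX_smul, hz, XX_smul, abs_div, abs_div, abs_mul, abs_mul]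
    apply div_le_div_of_nonneg_right _ (abs_nonneg _)
    apply mul_le_mul_of_nonneg_right _ (abs_nonneg _)
    rw [abs_of_pos hNpos, abs_of_pos (by positivity), hkpow]
    have : (0:ℝ) < 2 ^ (k - 1) := by positivity
    linarith
  have hΦpos : 0 < Phi e p sn v z := lt_trans (by positivity) hv
  obtain ⟨f, hf1, hf2, hf3⟩ := round_exists e hp0 hp1 hsn (by rw [Fintype.card_fin]; exact hn) z hΦpos (K := 2 * L / N) (by positivity) hΦ0
    (univ.erase j) (by
      rw [← hn]; exact_mod_cast (card_le_univ _).trans (by rw [Fintype.card_fin])) A (by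
      intro i hi
      rw [hz, XX_smul, hX i (ne_of_mem_erase hi), mul_zero])
  refine ⟨k, by rw [mem_range]; omega, rd z f, ?_, ?_, ?_, ?_, hnb⟩
  · have : ∀ w, |(rd z f w : ℝ)| ≤ N * |Y w| + 1 := by
      intro w
      have h1 := rd_abs z f w
      have h2 : |(rd z f w : ℝ)| ≤ |(rd z f w : ℝ) - z w| + |z w| := by
        have := abs_add_le ((rd z f w : ℝ) - z w) (z w)
        simpa using this
      have h3 : |z w| = N * |Y w| := by rw [hz, abs_mul, abs_of_pos hNpos]
      linarith
    calc ∑ w, |(rd z f w : ℝ)| ≤ ∑ w, (N * |Y w| + 1) := sum_le_sum (fun w _ => this w)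
      _ = N * ∑ w, |Y w| + n := by rw [sum_add_distrib, ← mul_sum]; simp
      _ ≤ N * (5 * n) + n := by have := mul_le_mul_of_nonneg_left hG.1 hNpos.le; linarith
      _ ≤ 6 * N * n := by
        have : (0:ℝ) ≤ n := by positivity
        nlinarith
  · intro hnice
    have hS := hG.2
    rw [hn] at hS
    have := lo_gk e hκ hq hqp hp hθ (δ := θ ^ 2 / 16) (by positivity) hsn (2 ^ k) Nat.one_le_two_pow _ _ hS (by
      intro w hw
      rw [mem_filter] at hw
      obtain ⟨-, hw1, hw2⟩ := hw
      push_cast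
      rw [← hN]
      have h1 := rd_abs z f w
      have h2 : |(rd z f w : ℝ)| ≤ |(rd z f w : ℝ) - z w| + |z w| := by
        have := abs_add_le ((rd z f w : ℝ) - z w) (z w)
        simpa using this
      have h4 : |z w| ≤ |(rd z f w : ℝ)| + |(rd z f w : ℝ) - z w| := by
        have := abs_sub (rd z f w : ℝ) ((rd z f w : ℝ) - z w)
        simpa using this
      have h3 : |z w| = N * |Y w| := by rw [hz, abs_mul, abs_of_pos hNpos]
      constructor
      · nlinarith
      · have h5 : N * |Y w| ≤ N * (4 / θ) := mul_le_mul_of_nonneg_left hw2 hNpos.le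
        have h6 : 5 / θ * N = N * (4 / θ) + N * (1 / θ) := by ring
        have h7 : 1 ≤ N * (1 / θ) := by
          rw [mul_one_div, le_div_iff₀ hθ]; linarith
        linarith) hnice hng v
    have h8 : Phi e p sn v (fun i => (rd z f i : ℝ)) ≤ 20 * (3 + 2 / (q * (θ ^ 2 / 16) * θ ^ 2 / 160)) / ((2 ^ k : ℕ) : ℝ) := this
    push_cast at h8
    rw [← hN] at h8
    have h9 : 8 * (20 * (3 + 2 / (q * (θ ^ 2 / 16) * θ ^ 2 / 160))) / N ≤ L / N := div_le_div_of_nonneg_right hL2 hNpos.le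
    have h10 : 8 * (20 * (3 + 2 / (q * (θ ^ 2 / 16) * θ ^ 2 / 160))) / N = 8 * (20 * (3 + 2 / (q * (θ ^ 2 / 16) * θ ^ 2 / 160)) / N) := by ring
    linarith
  · have : 20 * L / 2 ^ k = 10 * (2 * L / N) := by rw [hN]; ring
    rw [this]; exact hf2
  · rw [hn]; exact hf3

theorem card_cubes (n : ℕ) (Z : Finset (Fin n → ℤ)) (hZ : ∀ z ∈ Z, ∑ i, |(z i : ℝ)| ≤ 2 * n) : (Z.card : ℝ) ≤ 12 ^ n := by
  have h := card_l1 Z univ (2 * n) (2 * n) (1 / 2) (by norm_num) (by norm_num) hZ (by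
    intro z hz i
    have h1 := hZ z hz
    have h2 : |(z i : ℝ)| ≤ ∑ i, |(z i : ℝ)| := single_le_sum (f := fun i => |(z i : ℝ)|) (fun _ _ => abs_nonneg _) (mem_univ i)
    have h3 : |(z i : ℝ)| ≤ 2 * n := by linarith
    have : ((|z i| : ℤ) : ℝ) ≤ ((2 * n : ℕ) : ℝ) := by push_cast; exact h3
    exact_mod_cast this)
  refine h.trans (le_of_eq ?_)
  rw [compl_univ, card_empty, pow_zero, one_mul, card_univ, Fintype.card_fin]
  have : ((1 / 2 : ℝ)⁻¹) ^ (2 * (n:ℝ)) = 4 ^ n := by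
    rw [show (2 * (n:ℝ)) = ((2 * n : ℕ) : ℝ) by push_cast; ring, Real.rpow_natCast, pow_mul]; norm_num
  rw [this, ← mul_pow]; norm_num

theorem PP_uw_card {ι : Type*} [Fintype ι] [DecidableEq ι] {Q : ℕ} (hQ : 1 ≤ Q) (S : (ι → Fin Q) → Prop) [DecidablePred S] :
    ((univ.filter S).card : ℝ) = (Q : ℝ) ^ (Fintype.card ι) * PP (uw ι Q) S := by
  unfold PP EE
  have hp : ∀ f, pw (uw ι Q) f = (1 / (Q:ℝ)) ^ (Fintype.card ι) := by
    intro f; simp [pw, uw]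
  simp only [hp]
  rw [← mul_sum, ← mul_assoc, ← mul_pow, mul_one_div_cancel (by positivity), one_pow, one_mul]
  rw [card_filter]
  push_cast
  apply sum_congr rfl
  intro f _
  unfold ind
  congr

theorem hbad_prob {n : ℕ} (e : (β × κ) ⊕ ρ ≃ Fin n) {p q θ L sn : ℝ} (hκ : 0 < Fintype.card κ) (hq : 0 < q) (hqp : q ≤ p)
    (hp : p ≤ 1 / 2) (hθ : 0 < θ) (hθ1 : θ ≤ 1) (hsn : 0 < sn) (hn : (n : ℝ) = sn ^ 2) (i0 I D : ℕ)
    (hL2 : 8 * (20 * (3 + 2 / (q * (θ ^ 2 / 16) * θ ^ 2 / 160))) ≤ L) (hL0 : (2 : ℝ) ^ i0 ≤ L)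
    (hi0 : 4 / θ ≤ 2 ^ i0)
    (hng : (θ * sn + 1) * PP (wv (Fin n) p) (fun C => ¬ Good e C) ≤ 1) (j : Fin n) (K : ℕ) (hK : 6 ≤ K) (η : ℝ) (hη0 : 0 ≤ η)
    (hη : ∀ i ≤ I, ∀ a : Fin n → ℤ, PP (uw (Fin n) (K * 2 ^ i)) (fun f => ¬ Nice e (2 ^ i) sn (θ / 2) (zz a f)) ≤ η) :
    PP (wm (Fin n) (Fin n) p) (Hbad e p sn θ L i0 I D j) ≤ (I + 1) * ((756 * K * L) ^ n * 2 ^ (I * (D + 1)) * η) := by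
  classical
  have hp0 : 0 ≤ p := by linarith
  have hp1 : p ≤ 1 := by linarith
  have hLpos : 1 ≤ L := le_trans (one_le_pow₀ (by norm_num)) hL0
  have hw : IsW (wm (Fin n) (Fin n) p) := isW_wm hp0 hp1
  have hnpos : 0 < n := j.pos
  set Z : Finset (Fin n → ℤ) := (Fintype.piFinset (fun _ : Fin n => Icc (-(2 * n : ℤ)) (2 * n))).filter
    (fun z => ∑ i, |(z i : ℝ)| ≤ 2 * n) with hZ
  set Ev : ℕ → (Fin n → ℝ) → (Fin n → Fin n → Bool) → Prop := fun i z A =>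
    Phi e p sn 0 z ≤ 20 * L / 2 ^ i ∧ (∑ r ∈ univ.erase j, (XX z (A r)) ^ 2 ≤ n * sn ^ 2 ∧ nbad e j A < D) with hEv
  have hcover : ∀ A, Hbad e p sn θ L i0 I D j A → ∃ i ∈ range (I + 1), ∃ a ∈ Z, ∃ f ∈ univ.filter
      (fun f : Fin n → Fin (K * 2 ^ i) => ¬ Nice e (2 ^ i) sn (θ / 2) (zz a f)), Ev i (zz a f) A := by
    intro A hA
    obtain ⟨i, hi, z, hz1, hz2, hz3, hz4, hz5⟩ := hbad_witness e hκ hq hqp hp hθ hθ1 hsn hn i0 I D hL2 hL0 hi0 hng j A hA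
    have hQ : 0 < K * 2 ^ i := by positivity
    have hQz : (0:ℤ) < ((K * 2 ^ i : ℕ) : ℤ) := by exact_mod_cast hQ
    have hmod : ∀ w, (z w % ((K * 2 ^ i : ℕ) : ℤ)).toNat < K * 2 ^ i := by
      intro w
      have h1 := Int.emod_lt_of_pos (z w) hQz
      have h2 := Int.emod_nonneg (z w) hQz.ne'
      omega
    set a : Fin n → ℤ := fun w => z w / ((K * 2 ^ i : ℕ) : ℤ) with ha
    set f : Fin n → Fin (K * 2 ^ i) := fun w => ⟨(z w % ((K * 2 ^ i : ℕ) : ℤ)).toNat, hmod w⟩ with hf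
    have hzz : zz a f = fun w => (z w : ℝ) := by
      funext w
      unfold zz
      have h2 := Int.emod_nonneg (z w) hQz.ne'
      have h1 := Int.mul_ediv_add_emod (z w) ((K * 2 ^ i : ℕ) : ℤ)
      have h3 : (((z w % ((K * 2 ^ i : ℕ) : ℤ)).toNat : ℕ) : ℤ) = z w % ((K * 2 ^ i : ℕ) : ℤ) := Int.toNat_of_nonneg h2
      have h4 : a w * ((K * 2 ^ i : ℕ) : ℤ) + ((f w : ℕ) : ℤ) = z w := by
        simp only [ha, hf]; rw [h3]; linarith
      exact_mod_cast h4
    have hQr : (0:ℝ) < ((K * 2 ^ i : ℕ) : ℝ) := by exact_mod_cast hQ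
    have habs : ∀ w, |(a w : ℝ)| ≤ |(z w : ℝ)| / ((K * 2 ^ i : ℕ) : ℝ) + 1 := by
      intro w
      have h1 : (z w : ℝ) = a w * ((K * 2 ^ i : ℕ) : ℝ) + ((f w : ℕ) : ℝ) := by
        have := congrFun hzz w; unfold zz at this; exact this.symm
      have h2 : ((f w : ℕ) : ℝ) ≤ ((K * 2 ^ i : ℕ) : ℝ) := by exact_mod_cast (f w).2.le
      have h3 : (0:ℝ) ≤ ((f w : ℕ) : ℝ) := by positivity
      have h4 : |(a w : ℝ)| * ((K * 2 ^ i : ℕ) : ℝ) ≤ |(z w : ℝ)| + ((K * 2 ^ i : ℕ) : ℝ) := by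
        rw [← abs_of_pos hQr, ← abs_mul, abs_of_pos hQr]
        have : (a w : ℝ) * ((K * 2 ^ i : ℕ) : ℝ) = z w - ((f w : ℕ) : ℝ) := by linarith
        rw [this]
        refine (abs_sub _ _).trans ?_
        rw [abs_of_nonneg h3]; linarith
      rw [← sub_le_iff_le_add, le_div_iff₀ hQr]
      linarith
    have hsum : ∑ w, |(a w : ℝ)| ≤ 2 * n := by
      calc ∑ w, |(a w : ℝ)| ≤ ∑ w, (|(z w : ℝ)| / ((K * 2 ^ i : ℕ) : ℝ) + 1) := sum_le_sum (fun w _ => habs w)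
        _ = (∑ w, |(z w : ℝ)|) / ((K * 2 ^ i : ℕ) : ℝ) + n := by rw [sum_add_distrib, ← sum_div]; simp
        _ ≤ n + n := by
          have : (∑ w, |(z w : ℝ)|) / ((K * 2 ^ i : ℕ) : ℝ) ≤ n := by
            rw [div_le_iff₀ hQr]
            refine hz1.trans ?_
            push_cast
            have hK' : (6:ℝ) ≤ K := by exact_mod_cast hK
            have h7 : (0:ℝ) ≤ 2 ^ i * n := by positivity
            nlinarith
          linarith
        _ = 2 * n := by ring
    refine ⟨i, hi, a, ?_, f, ?_, ?_⟩
    · rw [hZ, mem_filter, Fintype.mem_piFinset]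
      refine ⟨fun w => ?_, hsum⟩
      have h2 : |(a w : ℝ)| ≤ ∑ i, |(a i : ℝ)| := single_le_sum (f := fun i => |(a i : ℝ)|) (fun _ _ => abs_nonneg _) (mem_univ w)
      have h3 : |(a w : ℝ)| ≤ 2 * n := by linarith
      rw [mem_Icc]
      apply abs_le.mp
      have : ((|a w| : ℤ) : ℝ) ≤ ((2 * n : ℤ) : ℝ) := by push_cast; exact h3
      exact_mod_cast this
    · rw [mem_filter]
      refine ⟨mem_univ _, ?_⟩
      rw [hzz]; exact hz2
    · rw [hEv]
      simp only [hzz]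
      exact ⟨hz3, hz4, hz5⟩
  refine (PP_mono hw hcover).trans ?_
  refine (PP_exists hw _ _).trans ?_
  have hmain : ∀ i ∈ range (I + 1), PP (wm (Fin n) (Fin n) p) (fun A => ∃ a ∈ Z, ∃ f ∈ univ.filter
      (fun f : Fin n → Fin (K * 2 ^ i) => ¬ Nice e (2 ^ i) sn (θ / 2) (zz a f)), Ev i (zz a f) A) ≤
      (756 * K * L) ^ n * 2 ^ (I * (D + 1)) * η := by
    intro i hi
    rw [mem_range] at hi
    have hQ : 1 ≤ K * 2 ^ i := Nat.one_le_iff_ne_zero.mpr (by positivity)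
    set N : ℝ := 2 ^ i with hN
    have hN1 : 1 ≤ N := one_le_pow₀ (by norm_num)
    set E0 : ℝ := Real.exp n * N ^ D * ((20 * L + 1) / N) ^ (n - 1) with hE0
    have hE0pos : 0 ≤ E0 := by positivity
    have hev : ∀ z, PP (wm (Fin n) (Fin n) p) (Ev i z) ≤ E0 := by
      intro z
      by_cases hΦ : Phi e p sn 0 z ≤ 20 * L / N
      · have := fixed_z e hp0 hp1 j (R := n) hN1 (B := 20 * L) (by positivity) hsn D z hΦ
        rw [Fintype.card_fin] at this
        refine (PP_mono hw ?_).trans this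
        intro A hA; exact hA.2
      · refine le_trans (le_of_eq ?_) hE0pos
        unfold PP
        rw [← EE_const hw 0]
        congr 1
        funext A
        exact ind_false (fun hA => hΦ hA.1)
    have hcard : ∀ a : Fin n → ℤ, ((univ.filter (fun f : Fin n → Fin (K * 2 ^ i) => ¬ Nice e (2 ^ i) sn (θ / 2) (zz a f))).card : ℝ) ≤
        (K * N) ^ n * η := by
      intro a
      rw [PP_uw_card hQ, Fintype.card_fin]
      push_cast
      exact mul_le_mul_of_nonneg_left (hη i (by omega) a) (by positivity)
    refine (PP_exists hw _ _).trans ?_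
    have h2 : ∀ a ∈ Z, PP (wm (Fin n) (Fin n) p) (fun A => ∃ f ∈ univ.filter
      (fun f : Fin n → Fin (K * 2 ^ i) => ¬ Nice e (2 ^ i) sn (θ / 2) (zz a f)), Ev i (zz a f) A) ≤ (K * N) ^ n * η * E0 := by
      intro a _
      refine (PP_exists hw _ _).trans ?_
      refine (sum_le_card_nsmul _ _ _ (fun f _ => hev (zz a f))).trans ?_
      rw [nsmul_eq_mul]
      exact mul_le_mul_of_nonneg_right (hcard a) hE0pos
    refine (sum_le_card_nsmul _ _ _ h2).trans ?_
    rw [nsmul_eq_mul]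
    have hZc : (Z.card : ℝ) ≤ 12 ^ n := card_cubes n Z (fun z hz => (mem_filter.mp hz).2)
    have hX : (K * N) ^ n * E0 ≤ (63 * K * L) ^ n * 2 ^ (I * (D + 1)) := by
      have e1 : Real.exp n ≤ 3 ^ n := by
        rw [show (n:ℝ) = n * 1 by ring, Real.exp_nat_mul]
        exact pow_le_pow_left₀ (by positivity) (by have := Real.exp_one_lt_d9; linarith) n
      have e2 : ((20 * L + 1) / N) ^ (n - 1) ≤ (21 * L) ^ n * N / N ^ n := by
        rw [div_pow, show N ^ n = N ^ (n - 1) * N by rw [← pow_succ]; congr 1; omega]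
        rw [div_le_div_iff₀ (by positivity) (by positivity)]
        have : (20 * L + 1) ^ (n - 1) ≤ (21 * L) ^ n := by
          calc (20 * L + 1) ^ (n - 1) ≤ (21 * L) ^ (n - 1) := pow_le_pow_left₀ (by positivity) (by linarith) _
            _ ≤ (21 * L) ^ n := pow_le_pow_right₀ (by linarith) (by omega)
        calc _ = (20 * L + 1) ^ (n - 1) * (N ^ (n - 1) * N) := by ring
          _ ≤ (21 * L) ^ n * (N ^ (n - 1) * N) := mul_le_mul_of_nonneg_right this (by positivity)
          _ = _ := by ring
      have e3 : N ^ (D + 1) ≤ 2 ^ (I * (D + 1)) := by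
        rw [hN, ← pow_mul]
        exact pow_le_pow_right₀ (by norm_num) (Nat.mul_le_mul_right _ (by omega))
      calc (K * N) ^ n * E0 ≤ (K * N) ^ n * (3 ^ n * N ^ D * ((21 * L) ^ n * N / N ^ n)) := by
            rw [hE0]; gcongr
        _ = (63 * K * L) ^ n * N ^ (D + 1) := by
            rw [pow_succ, show (63 * (K:ℝ) * L) = 3 * (21 * L) * K by ring]
            rw [mul_pow (3 * (21 * L)) (K:ℝ), mul_pow 3 (21 * L), mul_pow (K:ℝ) N]
            field_simp
        _ ≤ _ := mul_le_mul_of_nonneg_left e3 (by positivity)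
    calc (Z.card : ℝ) * ((K * N) ^ n * η * E0) ≤ 12 ^ n * ((K * N) ^ n * η * E0) :=
          mul_le_mul_of_nonneg_right hZc (by positivity)
      _ = 12 ^ n * η * ((K * N) ^ n * E0) := by ring
      _ ≤ 12 ^ n * η * ((63 * K * L) ^ n * 2 ^ (I * (D + 1))) := mul_le_mul_of_nonneg_left hX (by positivity)
      _ = _ := by
          rw [show (756 * (K:ℝ) * L) = 12 * (63 * K * L) by ring, mul_pow 12]; ring
  refine (sum_le_card_nsmul _ _ _ hmain).trans ?_
  rw [nsmul_eq_mul, card_range]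
  push_cast
  exact le_refl _

end HB
end SCP

namespace SCP

theorem poly_le_exp (C : ℝ) (lam : ℕ) : ∃ n0 : ℕ, ∀ n : ℕ, n0 ≤ n → (C * n) ^ lam ≤ 2 ^ n := by
  have h := tendsto_pow_const_mul_const_pow_of_abs_lt_one lam (r := 1 / 2) (by rw [abs_of_pos] <;> norm_num)
  have h2 := h.const_mul (C ^ lam)
  rw [mul_zero] at h2
  have h3 := h2.eventually_le_const (show (0:ℝ) < 1 by norm_num)
  obtain ⟨n0, hn0⟩ := Filter.eventually_atTop.mp h3
  refine ⟨n0, fun n hn => ?_⟩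
  have := hn0 n hn
  rw [one_div, inv_pow, ← div_eq_mul_inv, ← mul_div_assoc, div_le_one (by positivity)] at this
  rw [mul_pow]; exact this

theorem nn_T1 (n m k R l s i g0 lam W n1 : ℕ) (hnk : n ≤ 2 * (k * m)) (hm28 : 28 ≤ m) (hi : i ≤ 3 * (m + 1)) (N : ℕ) (hNr : (N:ℝ) = 2 ^ i) (ρ0 : ℝ) (hρ0 : ρ0 = (1 / 2) ^ (10 * s))
    (hs : s = 9 + 2 * k + 2 * k * R) (hg1 : m ≤ 10 * g0) (hn1r : (1:ℝ) ≤ n) (hkl : (1:ℝ) ≤ (k:ℝ) ^ l)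
    (hW2 : (W:ℝ) ≤ 5 * n * k ^ l) (hn1 : ((2 * 3 ^ l * 11 * (k:ℝ) ^ l) * n) ^ lam ≤ 2 ^ n) :
    (2:ℝ) ^ m * (2 * N * (ρ0 ^ g0 * (2 * (3 ^ l * (2 * W + 1))) ^ lam)) ≤ 1 / 2 ^ (R * n + 1) := by
  have hρpos : 0 < ρ0 := by rw [hρ0]; positivity
  have a1 : (2 * (3 ^ l * (2 * (W:ℝ) + 1))) ^ lam ≤ 2 ^ n := by
    refine le_trans (pow_le_pow_left₀ (by positivity) ?_ _) hn1
    have h3 : (1:ℝ) ≤ n * k ^ l := by nlinarith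
    calc 2 * (3 ^ l * (2 * (W:ℝ) + 1)) ≤ 2 * (3 ^ l * (2 * (5 * n * k ^ l) + n * k ^ l)) := by gcongr
      _ = _ := by ring
  have a2 : ρ0 ^ g0 ≤ (1 / 2) ^ (s * m) := by
    rw [hρ0, ← pow_mul]
    apply pow_le_pow_of_le_one (by norm_num) (by norm_num)
    nlinarith
  have a3 : (N:ℝ) ≤ 2 ^ (3 * (m + 1)) := by rw [hNr]; exact pow_le_pow_right₀ (by norm_num) hi
  have hexp : m + 1 + 3 * (m + 1) + n + (R * n + 1) ≤ s * m := by
    have e1 : R * n ≤ 2 * k * R * m := by calc R * n ≤ R * (2 * (k * m)) := Nat.mul_le_mul_left _ hnk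
          _ = _ := by ring
    have e2 : s * m = 9 * m + 2 * (k * m) + 2 * k * R * m := by rw [hs]; ring
    rw [e2]; omega
  calc (2:ℝ) ^ m * (2 * N * (ρ0 ^ g0 * (2 * (3 ^ l * (2 * W + 1))) ^ lam))
      ≤ 2 ^ m * (2 * 2 ^ (3 * (m + 1)) * ((1 / 2) ^ (s * m) * 2 ^ n)) := by gcongr
    _ = 2 ^ (m + 1 + 3 * (m + 1) + n) / 2 ^ (s * m) := by
        rw [one_div, inv_pow, pow_add, pow_add, pow_add]; ring
    _ ≤ 1 / 2 ^ (R * n + 1) := by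
        rw [div_le_div_iff₀ (by positivity) (by positivity), ← pow_add, one_mul]
        exact pow_le_pow_right₀ (by norm_num) hexp

theorem nn_T2 (n m k R l i g0 : ℕ) (hk : 2 ^ 110 ≤ k) (hnk : n ≤ 2 * (k * m)) (hm28 : 28 ≤ m) (hi : i ≤ 3 * (m + 1)) (N : ℕ) (hNr : (N:ℝ) = 2 ^ i)
    (hl : l = 4 * (k * R + 1)) (hg1 : m ≤ 10 * g0) (hgm : g0 ≤ m) :
    (2:ℝ) ^ m * ((2 * N) ^ l * ((4 * N) ^ (2 * l) * (2 / (k:ℝ) ^ l) ^ g0)) ≤ 1 / 2 ^ (R * n + 1) := by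
  have a3 : (N:ℝ) ≤ 2 ^ (3 * (m + 1)) := by rw [hNr]; exact pow_le_pow_right₀ (by norm_num) hi
  have hkk : (2:ℝ) ^ 110 ≤ k := by exact_mod_cast hk
  have a4 : (2 / (k:ℝ) ^ l) ^ g0 ≤ 2 ^ m / 2 ^ (11 * l * m) := by
    rw [div_pow]
    have h1 : (2:ℝ) ^ g0 ≤ 2 ^ m := pow_le_pow_right₀ (by norm_num) hgm
    have h2 : (2:ℝ) ^ (11 * l * m) ≤ ((k:ℝ) ^ l) ^ g0 := by
      calc (2:ℝ) ^ (11 * l * m) ≤ 2 ^ (110 * (l * g0)) := pow_le_pow_right₀ (by norm_num) (by nlinarith)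
        _ = ((2 ^ 110) ^ l) ^ g0 := by rw [pow_mul, pow_mul]
        _ ≤ _ := by gcongr
    gcongr
  have hexp : m + (3 * (m + 1) + 1) * l + (3 * (m + 1) + 2) * (2 * l) + m + (R * n + 1) ≤ 11 * l * m := by
    have e1 : R * n ≤ 2 * (k * R * m) := by calc R * n ≤ R * (2 * (k * m)) := Nat.mul_le_mul_left _ hnk
          _ = _ := by ring
    have e2 : l * m = 4 * (k * R * m) + 4 * m := by rw [hl]; ring
    have e3 : 28 * l ≤ l * m := by rw [mul_comm]; exact Nat.mul_le_mul_left _ hm28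
    have e4 : m + (3 * (m + 1) + 1) * l + (3 * (m + 1) + 2) * (2 * l) + m + (R * n + 1) = 2 * m + 9 * (l * m) + 14 * l + R * n + 1 := by ring
    rw [e4, mul_assoc]
    omega
  calc (2:ℝ) ^ m * ((2 * N) ^ l * ((4 * N) ^ (2 * l) * (2 / (k:ℝ) ^ l) ^ g0))
      ≤ 2 ^ m * ((2 * 2 ^ (3 * (m + 1))) ^ l * ((4 * 2 ^ (3 * (m + 1))) ^ (2 * l) * (2 ^ m / 2 ^ (11 * l * m)))) := by gcongr
    _ = 2 ^ (m + (3 * (m + 1) + 1) * l + (3 * (m + 1) + 2) * (2 * l) + m) / 2 ^ (11 * l * m) := by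
        rw [show (4:ℝ) = 2 ^ 2 by norm_num, ← pow_succ', ← pow_add, ← pow_mul, ← pow_mul, pow_add, pow_add, pow_add,
          show 2 + 3 * (m + 1) = 3 * (m + 1) + 2 by ring]
        ring
    _ ≤ 1 / 2 ^ (R * n + 1) := by
        rw [div_le_div_iff₀ (by positivity) (by positivity), ← pow_add, one_mul]
        exact pow_le_pow_right₀ (by norm_num) hexp

set_option maxHeartbeats 1000000 in
theorem nonnice_asymp (k R : ℕ) (hk : 2 ^ 110 ≤ k) : ∃ n0 : ℕ, ∀ n : ℕ, n0 ≤ n → ∀ (m r : ℕ), m = n / k →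
    ∀ (e : (Fin m × Fin k) ⊕ Fin r ≃ Fin n) (K i : ℕ) (θ : ℝ), 0 < θ → 1 ≤ K → 2 ≤ K * θ → i ≤ 3 * (m + 1) →
    ∀ a : Fin n → ℤ, PP (uw (Fin n) (K * 2 ^ i)) (fun f => ¬ Nice e (2 ^ i) (Real.sqrt n) (θ / 2) (zz a f)) ≤ 1 / 2 ^ (R * n) := by
  have hk0 : 0 < k := lt_of_lt_of_le (by norm_num) hk
  set l : ℕ := 4 * (k * R + 1) with hl
  set s : ℕ := 9 + 2 * k + 2 * k * R with hs
  set ρ0 : ℝ := (1 / 2) ^ (10 * s) with hρ0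
  have hρpos : 0 < ρ0 := by positivity
  set H : ℕ := 800 * 2 ^ (10 * s) with hH
  have hH1 : 1 ≤ H := Nat.one_le_iff_ne_zero.mpr (by positivity)
  have hkr : (1:ℝ) ≤ k := by exact_mod_cast hk0
  have hHr : (1:ℝ) ≤ H := by exact_mod_cast hH1
  have hbase : (1 - 1 / (4 * (H:ℝ) ^ 2 * k)) < 1 := by
    have : (0:ℝ) < 1 / (4 * (H:ℝ) ^ 2 * k) := by positivity
    linarith
  obtain ⟨lam, hlam⟩ := exists_pow_lt_of_lt_one (show (0:ℝ) < ρ0 / 2 by positivity) hbase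
  obtain ⟨n1, hn1⟩ := poly_le_exp (2 * 3 ^ l * 11 * k ^ l) lam
  refine ⟨max n1 (max (l ^ 2) (max (H ^ 2) (28 * k))), ?_⟩
  intro n hn m r hm e K i θ hθ hK hKθ hi a
  simp only [max_le_iff] at hn
  obtain ⟨hna, hnb, hnc, hnd⟩ := hn
  have hm28 : 28 ≤ m := by
    rw [hm, Nat.le_div_iff_mul_le hk0]; exact hnd
  have hnk : n ≤ 2 * (k * m) := by
    have h1 : n < k * (m + 1) := by
      rw [hm]; have := Nat.lt_mul_div_succ n hk0; exact this
    nlinarith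
  have hmn : m ≤ n := by rw [hm]; exact Nat.div_le_self _ _
  have hnpos : 0 < n := by omega
  have hn1r : (1:ℝ) ≤ n := by exact_mod_cast hnpos
  set sn := Real.sqrt n with hsn
  have hsn1 : 1 ≤ sn := Real.one_le_sqrt.mpr hn1r
  have hsnn : sn ≤ n := by rw [hsn, Real.sqrt_le_left (by linarith)]; nlinarith
  have hlsn : (l:ℝ) ≤ 3 * sn := by
    have : (l:ℝ) ≤ sn := Real.le_sqrt_of_sq_le (by exact_mod_cast hnb)
    linarith
  have hHsn : (H:ℝ) ≤ 3 * sn := by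
    have : (H:ℝ) ≤ sn := Real.le_sqrt_of_sq_le (by exact_mod_cast hnc)
    linarith
  have hHρ : 400 / (H:ℝ) = ρ0 / 2 := by
    rw [hH, hρ0]; push_cast; rw [one_div, inv_pow]; field_simp; norm_num
  clear_value H ρ0 l s
  set W : ℕ := ⌈Real.pi * sn * k ^ l⌉₊ with hW
  have hWpos : 0 < Real.pi * sn * (k:ℝ) ^ l := by positivity
  have hkl : (1:ℝ) ≤ k ^ l := one_le_pow₀ hkr
  have hW2 : (W:ℝ) ≤ 5 * n * k ^ l := by
    have h1 := (Nat.ceil_lt_add_one hWpos.le).le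
    have h2 : Real.pi * sn * k ^ l ≤ 4 * n * k ^ l := by
      have := Real.pi_le_four
      gcongr
    have h3 : (1:ℝ) ≤ n * k ^ l := by nlinarith
    rw [hW]; linarith
  set N : ℕ := 2 ^ i with hN
  have hNr : (N:ℝ) = 2 ^ i := by rw [hN]; push_cast; rfl
  have hN1 : 1 ≤ N := Nat.one_le_two_pow
  set g0 : ℕ := (m + 9) / 10 with hg0
  have hg1 : m ≤ 10 * g0 := by omega
  have hgm : g0 ≤ m := by omega
  have hk2 : 2 ≤ k := le_trans (by norm_num) hk
  have hne : (⟨0, by omega⟩ : Fin k) ≠ ⟨1, by omega⟩ := by simp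
  have main := nonnice (Q := K * N) (by nlinarith) e a hne N hN1 (by nlinarith) sn (θ / 2) (by linarith) (by positivity)
    (by
      push_cast
      have : (0:ℝ) < N := by exact_mod_cast hN1
      nlinarith) l W H lam hlsn (by rw [hW]; exact Nat.one_le_iff_ne_zero.mpr (Nat.ceil_pos.mpr hWpos).ne')
    (by rw [Fintype.card_fin]; exact Nat.le_ceil _) hH1 hHsn ρ0 (by
      rw [Fintype.card_fin]
      linarith) (by rw [hρ0]; exact pow_le_one₀ (by norm_num) (by norm_num)) g0 (by rw [Fintype.card_fin]; omega)
  rw [Fintype.card_fin, Fintype.card_fin] at main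
  refine main.trans ?_
  have hT1 := nn_T1 n m k R l s i g0 lam W n1 hnk hm28 hi N hNr ρ0 hρ0 hs hg1 hn1r hkl hW2 (hn1 n hna)
  have hT2 := nn_T2 n m k R l i g0 hk hnk hm28 hi N hNr hl hg1 hgm
  have : (1:ℝ) / 2 ^ (R * n) = 1 / 2 ^ (R * n + 1) + 1 / 2 ^ (R * n + 1) := by
    rw [pow_succ]; field_simp; norm_num
  rw [this]
  exact add_le_add hT1 hT2

end SCP

namespace SCP

section MB
variable {β κ ρ ι ν : Type*} [Fintype β] [DecidableEq β] [Fintype κ] [DecidableEq κ] [Fintype ρ] [DecidableEq ρ]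
  [Fintype ι] [DecidableEq ι] [Fintype ν] [DecidableEq ν]

open Classical in
/-- many non-good columns -/
def ManyBad (e : (β × κ) ⊕ ρ ≃ ι) (D : ℕ) (A : ν → ι → Bool) : Prop :=
  D ≤ (univ.filter (fun i => ¬ Good e (A i))).card

theorem manyBad_prob (e : (β × κ) ⊕ ρ ≃ ι) {p b : ℝ} (h0 : 0 ≤ p) (h1 : p ≤ 1) (hb0 : 0 < b) (hb1 : b ≤ 1)
    (hb : PP (wv ι p) (fun C => ¬ Good e C) ≤ b) (D : ℕ) :
    PP (wm ν ι p) (ManyBad e D) ≤ 2 ^ (Fintype.card ν) * b ^ D := by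
  classical
  have hw : IsW (wm ν ι p) := isW_wm h0 h1
  have hwv : IsW (wv ι p) := isW_wv h0 h1
  set h : (ι → Bool) → ℝ := fun C => if ¬ Good e C then 1 / b else 1 with hh
  have hpos : ∀ C, 0 ≤ h C := fun C => by simp only [hh]; split_ifs <;> positivity
  have key : ∀ A : ν → ι → Bool, ind (ManyBad e D A) ≤ b ^ D * ∏ i, h (A i) := by
    intro A
    by_cases hA : ManyBad e D A
    · rw [ind_true hA]
      simp only [hh]
      rw [Finset.prod_ite, prod_const, prod_const_one, mul_one]
      unfold ManyBad at hA
      have h2 : (1 / b) ^ D ≤ (1 / b) ^ (univ.filter (fun i => ¬ Good e (A i))).card :=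
        pow_le_pow_right₀ (by rw [le_div_iff₀ hb0]; linarith) (by convert hA)
      calc (1:ℝ) = b ^ D * (1 / b) ^ D := by rw [← mul_pow, mul_one_div_cancel hb0.ne', one_pow]
        _ ≤ _ := mul_le_mul_of_nonneg_left h2 (by positivity)
    · rw [ind_false hA]
      exact mul_nonneg (by positivity) (prod_nonneg (fun i _ => hpos _))
  unfold PP
  refine (EE_mono hw key).trans ?_
  rw [EE_smul, EE_prod (wm ν ι p) (fun _ => h), mul_comm]
  apply mul_le_mul_of_nonneg_right _ (by positivity)
  have hE : ∀ i : ν, ∑ a, wm ν ι p i a * h a ≤ 2 := by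
    intro i
    have : EE (wv ι p) h ≤ 2 := by
      have h3 : ∀ C, h C ≤ 1 + (1 / b) * ind (¬ Good e C) := by
        intro C
        by_cases hC : Good e C
        · simp only [hh, hC, not_true, if_false]; rw [ind_false (by simp)]; linarith
        · simp only [hh, hC, not_false_eq_true, if_true]; rw [ind_true trivial]; linarith
      refine (EE_mono hwv h3).trans ?_
      rw [EE_add, EE_const hwv, EE_smul]
      have : (1 / b) * PP (wv ι p) (fun C => ¬ Good e C) ≤ (1 / b) * b := mul_le_mul_of_nonneg_left hb (by positivity)
      rw [one_div_mul_cancel hb0.ne'] at this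
      unfold PP at this
      linarith
    exact this
  calc ∏ i : ν, ∑ a, wm ν ι p i a * h a ≤ ∏ i : ν, (2:ℝ) := by
        apply prod_le_prod
        · intro i _; exact sum_nonneg (fun a _ => mul_nonneg (hw.1 i a) (hpos a))
        · intro i _; exact hE i
    _ = _ := by simp
end MB

theorem blk_params {p : ℝ} (hp : 0 < p) (hp1 : p < 1 / 2 ^ 111) : ∃ k : ℕ, 2 ^ 110 ≤ k ∧ (k:ℝ) * p ≤ 1 ∧
    1 / 5 ≤ pone (Fin k) p ∧ (1:ℝ) / 4 ≤ (1 - p) ^ k := by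
  set u : ℕ := ⌊1 / (2 * p)⌋₊ with hu
  have hu1 : (u:ℝ) ≤ 1 / (2 * p) := Nat.floor_le (by positivity)
  have hu2 : 1 / (2 * p) < u + 1 := Nat.lt_floor_add_one _
  have a1 : (u:ℝ) * (2 * p) ≤ 1 := by rwa [le_div_iff₀ (by positivity)] at hu1
  have a2 : 1 < ((u:ℝ) + 1) * (2 * p) := by rwa [div_lt_iff₀ (by positivity)] at hu2
  have hp2 : p < 1 / 100 := hp1.trans (by norm_num)
  have hb : (1:ℝ) / 2 ≤ (1 - p) ^ u := by
    have := one_add_mul_le_pow (a := -p) (by linarith) u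
    rw [← sub_eq_add_neg] at this
    nlinarith
  have hk4 : (1:ℝ) / 4 ≤ (1 - p) ^ (2 * u) := by
    rw [mul_comm, pow_mul]; nlinarith
  have hu0 : 1 ≤ u := by
    by_contra h
    have : u = 0 := by omega
    rw [this] at a2; norm_num at a2; linarith
  refine ⟨2 * u, ?_, ?_, ?_, hk4⟩
  · have h1 : (2:ℝ) ^ 110 ≤ 1 / (2 * p) := by
      rw [le_div_iff₀ (by positivity)]
      rw [lt_div_iff₀ (by positivity)] at hp1
      calc (2:ℝ) ^ 110 * (2 * p) = p * 2 ^ 111 := by ring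
        _ ≤ 1 := hp1.le
    have h2 : 2 ^ 110 ≤ u := by
      rw [hu]; apply Nat.le_floor; rw [Nat.cast_pow]; exact h1
    omega
  · push_cast; linarith
  · unfold pone
    rw [Fintype.card_fin]
    have h3 : (1 - p) ^ (2 * u) ≤ (1 - p) ^ (2 * u - 1) := pow_le_pow_of_le_one (by linarith) (by linarith) (by omega)
    push_cast
    have h4 : (1:ℝ) / 4 ≤ (1 - p) ^ (2 * u - 1) := by linarith
    have h5 : 0 ≤ 2 * (u:ℝ) * p := by positivity
    have h6 : 1 - 2 * p ≤ 2 * (u:ℝ) * p := by linarith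
    nlinarith

/-- block equivalence -/
def blockEquiv (n k : ℕ) : (Fin (n / k) × Fin k) ⊕ Fin (n % k) ≃ Fin n :=
  ((Equiv.sumCongr finProdFinEquiv (Equiv.refl _)).trans finSumFinEquiv).trans
    (finCongr (by rw [mul_comm]; exact Nat.div_add_mod n k))

theorem div_large (k : ℕ) (hk : 0 < k) : ∃ n0 : ℕ, ∀ n : ℕ, n0 ≤ n → ((n:ℝ) + 1) * (965 / 1000) ^ (n / k) ≤ 1 := by
  have h := tendsto_pow_const_mul_const_pow_of_abs_lt_one 1 (r := 965 / 1000) (by rw [abs_of_pos] <;> norm_num)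
  have h2 := h.const_mul (3 * k : ℝ)
  rw [mul_zero] at h2
  have h3 := h2.eventually_le_const (show (0:ℝ) < 1 by norm_num)
  obtain ⟨m0, hm0⟩ := Filter.eventually_atTop.mp h3
  refine ⟨(m0 + 1) * k, fun n hn => ?_⟩
  have hm : m0 + 1 ≤ n / k := by rw [Nat.le_div_iff_mul_le hk]; exact hn
  have h1 := hm0 (n / k) (by omega)
  have hnk : n + 1 ≤ 3 * k * (n / k) := by
    have h1 : n < k * (n / k + 1) := Nat.lt_mul_div_succ n hk
    have h2 : 1 ≤ n / k := by omega
    nlinarith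
  have hnk' : (n:ℝ) + 1 ≤ 3 * k * ((n / k : ℕ) : ℝ) := by exact_mod_cast hnk
  rw [pow_one] at h1
  calc ((n:ℝ) + 1) * (965 / 1000) ^ (n / k) ≤ 3 * k * ((n / k : ℕ) : ℝ) * (965 / 1000) ^ (n / k) :=
        mul_le_mul_of_nonneg_right hnk' (by positivity)
    _ ≤ 1 := by rw [mul_assoc]; exact h1

/-- everything for a fixed block length -/
theorem block_fixed {q θ L : ℝ} (hq : 0 < q) (hθ : 0 < θ) (hθ1 : θ ≤ 1) (i0 : ℕ)
    (hL2 : 8 * (20 * (3 + 2 / (q * (θ ^ 2 / 16) * θ ^ 2 / 160))) ≤ L) (hL0 : (2 : ℝ) ^ i0 ≤ L)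
    (hi0 : 4 / θ ≤ 2 ^ i0) (k : ℕ) : ∃ n0 : ℕ, 2 ^ 110 ≤ k → ∀ n, n0 ≤ n → ∀ p : ℝ, q ≤ p → p ≤ 1 / 2 →
      1 / 5 ≤ pone (Fin k) p → 
      (∀ j, PP (wm (Fin n) (Fin n) p) (Hbad (blockEquiv n k) p (Real.sqrt n) θ L i0 (3 * (n / k + 1)) (100 * k) j) ≤ 1 / 2 ^ n) ∧
      PP (wm (Fin n) (Fin n) p) (ManyBad (blockEquiv n k) (100 * k)) ≤ 1 / 2 ^ n ∧ i0 ≤ 3 * (n / k + 1) := by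
  by_cases hk : 2 ^ 110 ≤ k
  swap
  · exact ⟨0, fun h => absurd h hk⟩
  have hk0 : 0 < k := lt_of_lt_of_le (by norm_num) hk
  set K : ℕ := max 6 ⌈2 / θ⌉₊ with hK
  have hK6 : 6 ≤ K := le_max_left _ _
  have hKθ : 2 ≤ K * θ := by
    have : 2 / θ ≤ K := (Nat.le_ceil _).trans (by exact_mod_cast le_max_right _ _)
    rwa [div_le_iff₀ hθ] at this
  have hLpos : 1 ≤ L := le_trans (one_le_pow₀ (by norm_num)) hL0
  obtain ⟨R0, hR0⟩ := pow_unbounded_of_one_lt (756 * K * L) (show (1:ℝ) < 2 by norm_num)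
  obtain ⟨n1, hn1⟩ := nonnice_asymp k (R0 + 608) hk
  obtain ⟨n2, hn2⟩ := div_large k hk0
  refine ⟨max n1 (max n2 (max (6 * k) (i0 * k))), fun _ n hn p hqp hp hpi => ?_⟩
  simp only [max_le_iff] at hn
  obtain ⟨hna, hnb, hnc, hnd⟩ := hn
  have hm6 : 6 ≤ n / k := by rw [Nat.le_div_iff_mul_le hk0]; exact hnc
  have hmi : i0 ≤ n / k := by rw [Nat.le_div_iff_mul_le hk0]; exact hnd
  set m := n / k with hm
  have hmk : k * m ≤ n := Nat.mul_div_le n k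
  have hnk : n ≤ 2 * (k * m) := by
    have h1 : n < k * (m + 1) := Nat.lt_mul_div_succ n hk0
    nlinarith
  have hp0 : 0 ≤ p := by linarith
  have hng0 : PP (wv (Fin n) p) (fun C => ¬ Good (blockEquiv n k) C) ≤ (965 / 1000) ^ m := by
    have := not_good_prob (blockEquiv n k) hp0 (by linarith) hpi
    rwa [Fintype.card_fin] at this
  have hnpos : 0 < n := by nlinarith
  have hn1r : (1:ℝ) ≤ n := by exact_mod_cast hnpos
  refine ⟨fun j => ?_, ?_, by omega⟩
  · have hng : (θ * Real.sqrt n + 1) * PP (wv (Fin n) p) (fun C => ¬ Good (blockEquiv n k) C) ≤ 1 := by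
      refine le_trans ?_ (hn2 n hnb)
      have h1 : Real.sqrt n ≤ n := by rw [Real.sqrt_le_left (by linarith)]; nlinarith
      have h2 : θ * Real.sqrt n ≤ 1 * n := mul_le_mul hθ1 h1 (Real.sqrt_nonneg _) (by norm_num)
      exact mul_le_mul (by linarith) hng0 (PP_nonneg (isW_wv hp0 (by linarith)) _) (by positivity)
    have := hbad_prob (blockEquiv n k) (by rw [Fintype.card_fin]; exact hk0) hq hqp hp hθ hθ1 (sn := Real.sqrt n)
      (Real.sqrt_pos.mpr (by linarith)) (Real.sq_sqrt (by linarith)).symm i0 (3 * (m + 1)) (100 * k) hL2 hL0 hi0 hng j K hK6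
      (1 / 2 ^ ((R0 + 608) * n)) (by positivity) (fun i hi a => hn1 n hna m _ rfl (blockEquiv n k) K i θ hθ (by omega) hKθ hi a)
    refine this.trans ?_
    have b1 : ((3 * (m + 1) : ℕ) : ℝ) + 1 ≤ 2 ^ n := by
      have h1 : 3 * (m + 1) + 1 < 2 ^ n := by
        have h2 : 3 * (m + 1) + 1 ≤ n := by
          have h3 : 2 ^ 110 * m ≤ k * m := Nat.mul_le_mul_right _ hk
          omega
        exact lt_of_le_of_lt h2 Nat.lt_two_pow_self
      exact_mod_cast h1.le
    have b2 : (756 * (K:ℝ) * L) ^ n ≤ 2 ^ (R0 * n) := by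
      rw [pow_mul]; exact pow_le_pow_left₀ (by positivity) hR0.le _
    have b3 : (2:ℝ) ^ (3 * (m + 1) * (100 * k + 1)) ≤ 2 ^ (606 * n) := by
      apply pow_le_pow_right₀ (by norm_num)
      calc 3 * (m + 1) * (100 * k + 1) ≤ 3 * (2 * m) * (101 * k) := Nat.mul_le_mul (by omega) (by omega)
        _ = 606 * (k * m) := by ring
        _ ≤ 606 * n := Nat.mul_le_mul_left _ hmk
    calc (((3 * (m + 1) : ℕ) : ℝ) + 1) * ((756 * (K:ℝ) * L) ^ n * 2 ^ (3 * (m + 1) * (100 * k + 1)) * (1 / 2 ^ ((R0 + 608) * n)))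
        ≤ 2 ^ n * (2 ^ (R0 * n) * 2 ^ (606 * n) * (1 / 2 ^ ((R0 + 608) * n))) := by gcongr
      _ = 1 / 2 ^ n := by
          rw [show (R0 + 608) * n = n + (R0 * n + 606 * n) + n by ring, pow_add _ (n + _), pow_add _ n, pow_add]
          field_simp
  · have h := manyBad_prob (ν := Fin n) (blockEquiv n k) hp0 (by linarith) (b := (965 / 1000) ^ m) (by positivity)
      (pow_le_one₀ (by norm_num) (by norm_num)) hng0 (100 * k)
    refine h.trans ?_
    rw [Fintype.card_fin, ← pow_mul, show m * (100 * k) = 100 * (k * m) by ring, pow_mul]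
    have c1 : ((965 / 1000 : ℝ) ^ 100) ^ (k * m) ≤ (1 / 16) ^ (k * m) := pow_le_pow_left₀ (by positivity) (by norm_num) _
    have c2 : ((1 / 16 : ℝ)) ^ (k * m) = (1 / 4) ^ (2 * (k * m)) := by rw [pow_mul (1 / 4 : ℝ)]; norm_num
    have c3 : (1 / 4 : ℝ) ^ (2 * (k * m)) ≤ (1 / 4) ^ n := pow_le_pow_of_le_one (by norm_num) (by norm_num) hnk
    calc (2:ℝ) ^ n * ((965 / 1000 : ℝ) ^ 100) ^ (k * m) ≤ 2 ^ n * (1 / 4) ^ n := by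
          apply mul_le_mul_of_nonneg_left _ (by positivity); linarith
      _ = 1 / 2 ^ n := by rw [← mul_pow, ← one_div_pow]; norm_num

theorem block_main {q θ : ℝ} (hq : 0 < q) (hθ : 0 < θ) (hθ1 : θ ≤ 1) : ∃ (L : ℝ) (i0 n0 : ℕ), 1 ≤ L ∧ (2:ℝ) ^ i0 ≤ L ∧
    ∀ n, n0 ≤ n → ∀ p : ℝ, q < p → p < 1 / 2 ^ 111 → ∃ k : ℕ, (k:ℝ) * q ≤ 1 ∧ ∃ I : ℕ, i0 ≤ I ∧
      (∀ j, PP (wm (Fin n) (Fin n) p) (Hbad (blockEquiv n k) p (Real.sqrt n) θ L i0 I (100 * k) j) ≤ 1 / 2 ^ n) ∧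
      PP (wm (Fin n) (Fin n) p) (ManyBad (blockEquiv n k) (100 * k)) ≤ 1 / 2 ^ n ∧
      (1:ℝ) / 2 ^ I ≤ (1 - p) ^ n * Real.exp (-(q / 2) * n) := by
  obtain ⟨i0, hi0⟩ := pow_unbounded_of_one_lt (4 / θ) (show (1:ℝ) < 2 by norm_num)
  set L : ℝ := max (8 * (20 * (3 + 2 / (q * (θ ^ 2 / 16) * θ ^ 2 / 160)))) (2 ^ i0) with hL
  choose f hf using block_fixed hq hθ hθ1 i0 (le_max_left _ _ : _ ≤ L) (le_max_right _ _) hi0.le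
  refine ⟨L, i0, (range (⌈1 / q⌉₊ + 1)).sup f, le_trans (one_le_pow₀ (by norm_num)) (le_max_right _ _), le_max_right _ _, ?_⟩
  intro n hn p hqp hp
  have hp0 : 0 < p := by linarith
  have hp2 : p < 1 / 100 := hp.trans (by norm_num)
  obtain ⟨k, hk, hkp, hpi, hk4⟩ := blk_params hp0 hp
  have hk0 : 0 < k := lt_of_lt_of_le (by norm_num) hk
  have hkr : (1:ℝ) ≤ k := by exact_mod_cast hk0
  have hkq : (k:ℝ) * q ≤ 1 := by nlinarith
  have hkr : k ∈ range (⌈1 / q⌉₊ + 1) := by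
    rw [mem_range, Nat.lt_succ_iff]
    have : (k:ℝ) ≤ ⌈1 / q⌉₊ := le_trans (by rw [le_div_iff₀ hq]; exact hkq) (Nat.le_ceil _)
    exact_mod_cast this
  obtain ⟨h1, h2, h3⟩ := hf k hk n ((le_sup hkr).trans hn) p hqp.le (by linarith) hpi
  refine ⟨k, hkq, 3 * (n / k + 1), h3, h1, h2, ?_⟩
  have hlt : n < k * (n / k + 1) := Nat.lt_mul_div_succ n hk0
  set m := n / k with hm
  have e1 : ((1:ℝ) / 4) ^ (m + 1) ≤ (1 - p) ^ n := by
    calc ((1:ℝ) / 4) ^ (m + 1) ≤ ((1 - p) ^ k) ^ (m + 1) := pow_le_pow_left₀ (by norm_num) hk4 _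
      _ = (1 - p) ^ (k * (m + 1)) := by rw [pow_mul]
      _ ≤ (1 - p) ^ n := pow_le_pow_of_le_one (by linarith) (by linarith) hlt.le
  have e2 : ((1:ℝ) / 2) ^ (m + 1) ≤ Real.exp (-(q / 2) * n) := by
    have h5 : (1:ℝ) / 2 ≤ Real.exp (-(1 / 2)) := by
      have := Real.add_one_le_exp (-(1 / 2 : ℝ)); linarith
    calc ((1:ℝ) / 2) ^ (m + 1) ≤ Real.exp (-(1 / 2)) ^ (m + 1) := pow_le_pow_left₀ (by norm_num) h5 _
      _ = Real.exp (((m + 1 : ℕ) : ℝ) * (-(1 / 2))) := by rw [Real.exp_nat_mul]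
      _ ≤ _ := by
        apply Real.exp_le_exp.mpr
        have h6 : (n:ℝ) ≤ k * ((m + 1 : ℕ) : ℝ) := by exact_mod_cast hlt.le
        have h7 : (n:ℝ) * q ≤ k * q * ((m + 1 : ℕ) : ℝ) := by nlinarith
        have h8 : k * q * ((m + 1 : ℕ) : ℝ) ≤ 1 * ((m + 1 : ℕ) : ℝ) := mul_le_mul_of_nonneg_right hkq (by positivity)
        linarith
  calc (1:ℝ) / 2 ^ (3 * (m + 1)) = (1 / 4) ^ (m + 1) * (1 / 2) ^ (m + 1) := by
        rw [← mul_pow, pow_mul, ← one_div_pow]; norm_num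
    _ ≤ _ := mul_le_mul e1 e2 (by positivity) (pow_nonneg (by linarith) _)

end SCP

namespace SCP

/-- transpose of a Boolean array -/
def tr {n : ℕ} (A : Fin n → Fin n → Bool) : Fin n → Fin n → Bool := fun i j => A j i

/-- small singular value event -/
def SM {n : ℕ} (η : ℝ) (A : Fin n → Fin n → Bool) : Prop :=
  ∃ x : Fin n → ℝ, ∑ i, x i ^ 2 = 1 ∧ ∑ i, (XX x (tr A i)) ^ 2 ≤ η ^ 2

theorem normal_exists {n : ℕ} (j : Fin n) (A : Fin n → Fin n → Bool) :
    ∃ w : Fin n → ℝ, ∑ i, w i ^ 2 = 1 ∧ ∀ i, i ≠ j → XX w (A i) = 0 := by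
  set B : Matrix (Fin n) (Fin n) ℝ := fun i l => if i = j then 0 else (if A i l then 1 else 0) with hB
  have hdet : B.det = 0 := Matrix.det_eq_zero_of_row_eq_zero j (fun l => by simp [hB])
  obtain ⟨v, hv0, hv⟩ := Matrix.exists_mulVec_eq_zero_iff.mpr hdet
  have hvX : ∀ i, i ≠ j → XX v (A i) = 0 := by
    intro i hi
    have := congrFun hv i
    simp only [Matrix.mulVec, dotProduct, hB, if_neg hi, Pi.zero_apply] at this
    unfold XX
    refine Eq.trans (sum_congr rfl (fun l _ => ?_)) this
    split_ifs <;> simp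
  have hpos : 0 < ∑ i, v i ^ 2 := by
    obtain ⟨i, hi⟩ := Function.ne_iff.mp hv0
    have : 0 < v i ^ 2 := by have : v i ≠ 0 := hi; positivity
    exact lt_of_lt_of_le this (single_le_sum (f := fun i => v i ^ 2) (fun _ _ => sq_nonneg _) (mem_univ i))
  refine ⟨fun i => (Real.sqrt (∑ i, v i ^ 2))⁻¹ * v i, ?_, ?_⟩
  · simp only [mul_pow]
    rw [← mul_sum, inv_pow, Real.sq_sqrt hpos.le, inv_mul_cancel₀ hpos.ne']
  · intro i hi
    rw [XX_smul, hvX i hi, mul_zero]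

/-- unit normal to all columns but `j` -/
noncomputable def nv {n : ℕ} (j : Fin n) (A : Fin n → Fin n → Bool) : Fin n → ℝ :=
  Classical.choose (normal_exists j (Function.update A j (fun _ => false)))

theorem nv_update {n : ℕ} (j : Fin n) (A : Fin n → Fin n → Bool) (C : Fin n → Bool) :
    nv j (Function.update A j C) = nv j A := by
  unfold nv; simp only [Function.update_idem]

theorem nv_unit {n : ℕ} (j : Fin n) (A : Fin n → Fin n → Bool) : ∑ i, nv j A i ^ 2 = 1 :=
  (Classical.choose_spec (normal_exists j (Function.update A j (fun _ => false)))).1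

theorem nv_normal {n : ℕ} (j : Fin n) (A : Fin n → Fin n → Bool) (i : Fin n) (hi : i ≠ j) : XX (nv j A) (A i) = 0 := by
  have := (Classical.choose_spec (normal_exists j (Function.update A j (fun _ => false)))).2 i hi
  rwa [Function.update_of_ne hi] at this

theorem dual_sum {n : ℕ} (A : Fin n → Fin n → Bool) (w x : Fin n → ℝ) :
    ∑ i, w i * XX x (tr A i) = ∑ l, x l * XX w (A l) := by
  unfold XX tr
  simp only [mul_sum]
  rw [sum_comm]
  apply sum_congr rfl
  intro l _
  apply sum_congr rfl
  intro i _
  split_ifs <;> ring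

section SMP
variable {β κ ρ : Type*} [Fintype β] [DecidableEq β] [Fintype κ] [DecidableEq κ] [Fintype ρ] [DecidableEq ρ]

/-- per-column event -/
def EJ {n : ℕ} (e : (β × κ) ⊕ ρ ≃ Fin n) (θ η1 : ℝ) (j : Fin n) (A : Fin n → Fin n → Bool) : Prop :=
  Good e (A j) ∧ |XX (nv j A) (A j)| ≤ η1 ∧ HasGrad θ (nv j A)

theorem nbad_le {n : ℕ} (e : (β × κ) ⊕ ρ ≃ Fin n) (j : Fin n) (D : ℕ) (A : Fin n → Fin n → Bool) (h : ¬ nbad e j A < D) :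
    ManyBad e D A := by
  classical
  unfold ManyBad
  unfold nbad at h
  refine (not_lt.mp h).trans (card_le_card ?_)
  intro i hi
  rw [mem_filter] at hi ⊢
  exact ⟨mem_univ _, hi.2⟩

open Classical in
theorem sm_cover {n : ℕ} (e : (β × κ) ⊕ ρ ≃ Fin n) {θ η : ℝ} (hθ : 0 < θ) (hη : 0 < η) (hθ1 : θ ≤ 1)
    (hη1 : (10 * n * η / θ) ^ 2 ≤ θ / 17) (D : ℕ) (A : Fin n → Fin n → Bool) (h : SM η A) :
    StructBad θ A ∨ StructBad θ (tr A) ∨ ManyBad e D A ∨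
      θ ^ 2 / 16 * n ≤ D + ((univ.filter (fun j => EJ e θ (10 * n * η / θ) j A)).card : ℝ) := by
  by_cases h1 : StructBad θ A
  · exact Or.inl h1
  by_cases h2 : StructBad θ (tr A)
  · exact Or.inr (Or.inl h2)
  by_cases h3 : ManyBad e D A
  · exact Or.inr (Or.inr (Or.inl h3))
  refine Or.inr (Or.inr (Or.inr ?_))
  obtain ⟨x, hx1, hx2⟩ := h
  have hn0 : 0 < n := by
    rcases Nat.eq_zero_or_pos n with h | h
    · subst h; simp at hx1
    · exact h
  have hn : (1:ℝ) ≤ n := by exact_mod_cast hn0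
  set η1 := 10 * n * η / θ with hηdef
  have hηη : η ≤ η1 := by
    rw [hηdef, le_div_iff₀ hθ]; nlinarith
  have hηpos : 0 < η1 := by positivity
  have hG : HasGrad θ x := by
    by_contra hG
    exact h2 ⟨x, hx1, hx2.trans (le_trans (pow_le_pow_left₀ hη.le hηη 2) hη1), hG⟩
  obtain ⟨s, Y, hs, hGr, hxY⟩ := hG
  have hspos : 0 < s := lt_of_lt_of_le (by positivity) hs
  have hkey : ∀ j, θ / 2 ≤ |Y j| → |XX (nv j A) (A j)| ≤ η1 ∧ HasGrad θ (nv j A) := by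
    intro j hj
    have hxj : θ / (10 * n) ≤ |x j| := by
      rw [hxY, abs_mul, abs_of_pos hspos]
      calc θ / (10 * n) = 1 / (5 * n) * (θ / 2) := by field_simp; norm_num
        _ ≤ s * |Y j| := mul_le_mul hs hj (by positivity) hspos.le
    have hd := dual_sum A (nv j A) x
    have hd2 : ∑ l, x l * XX (nv j A) (A l) = x j * XX (nv j A) (A j) := by
      apply sum_eq_single j
      · intro l _ hl; rw [nv_normal j A l hl, mul_zero]
      · intro h; exact absurd (mem_univ j) h
    have hcs := sum_mul_sq_le_sq_mul_sq univ (nv j A) (fun i => XX x (tr A i))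
    rw [hd, hd2, nv_unit, one_mul] at hcs
    have h4 : |x j * XX (nv j A) (A j)| ≤ η := abs_le_of_sq_le_sq (hcs.trans hx2) hη.le
    rw [abs_mul] at h4
    have h5 : |XX (nv j A) (A j)| ≤ η1 := by
      have h6 : θ / (10 * n) * |XX (nv j A) (A j)| ≤ η := (mul_le_mul_of_nonneg_right hxj (abs_nonneg _)).trans h4
      rw [hηdef, le_div_iff₀ hθ]
      rw [div_mul_eq_mul_div, div_le_iff₀ (by positivity)] at h6
      linarith
    refine ⟨h5, ?_⟩
    by_contra hG
    apply h1
    refine ⟨nv j A, nv_unit j A, ?_, hG⟩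
    have : ∑ r, (XX (nv j A) (A r)) ^ 2 = (XX (nv j A) (A j)) ^ 2 := by
      apply sum_eq_single j
      · intro l _ hl; rw [nv_normal j A l hl]; norm_num
      · intro h; exact absurd (mem_univ j) h
    rw [this, ← sq_abs]
    exact (pow_le_pow_left₀ (abs_nonneg _) h5 2).trans hη1
  refine hGr.2.trans ?_
  unfold ManyBad at h3
  push Not at h3
  have hsub : univ.filter (fun i => θ / 2 ≤ |Y i| ∧ |Y i| ≤ 4 / θ) ⊆
      univ.filter (fun i => ¬ Good e (A i)) ∪ univ.filter (fun j => EJ e θ η1 j A) := by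
    intro i hi
    rw [mem_filter] at hi
    rw [mem_union, mem_filter, mem_filter]
    by_cases hg : Good e (A i)
    · exact Or.inr ⟨mem_univ _, hg, hkey i hi.2.1⟩
    · exact Or.inl ⟨mem_univ _, hg⟩
  have hc := (card_le_card hsub).trans (card_union_le _ _)
  have hc2 : (univ.filter (fun i => θ / 2 ≤ |Y i| ∧ |Y i| ≤ 4 / θ)).card ≤ D + (univ.filter (fun j => EJ e θ η1 j A)).card := by
    omega
  convert (Nat.cast_le (α := ℝ)).mpr hc2 using 1
  push_cast
  rfl

theorem ej_prob {n : ℕ} (e : (β × κ) ⊕ ρ ≃ Fin n) {p θ η1 L : ℝ} (hp0 : 0 ≤ p) (hp1 : p ≤ 1) (hη1 : 0 ≤ η1) (hL : 0 ≤ L)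
    (i0 I D i : ℕ) (hi0 : i0 ≤ i) (hiI : i ≤ I) (hsmall : (2:ℝ) ^ i * (5 * n * η1) ≤ Real.sqrt n) (j : Fin n) :
    PP (wm (Fin n) (Fin n) p) (EJ e θ η1 j) ≤ PP (wm (Fin n) (Fin n) p) (Hbad e p (Real.sqrt n) θ L i0 I D j) +
      PP (wm (Fin n) (Fin n) p) (ManyBad e D) + 2 * L / 2 ^ i := by
  have hw : IsW (wm (Fin n) (Fin n) p) := isW_wm hp0 hp1
  have hwv : IsW (wv (Fin n) p) := isW_wv hp0 hp1
  have hn : (1:ℝ) ≤ n := by exact_mod_cast j.pos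
  have hsn : 0 < Real.sqrt n := Real.sqrt_pos.mpr (by linarith)
  have hLN : 0 ≤ 2 * L / 2 ^ i := by positivity
  unfold PP
  rw [EE_resample hw j]
  have hc := EE_const hw (2 * L / 2 ^ i)
  rw [← EE_add, ← hc, ← EE_add]
  apply EE_mono hw
  intro A
  have htriv : ∑ C, wm (Fin n) (Fin n) p j C * ind (EJ e θ η1 j (Function.update A j C)) ≤ 1 := by
    rw [← hw.2 j]
    apply sum_le_sum
    intro C _
    have := hw.1 j C
    have := ind_le_one (EJ e θ η1 j (Function.update A j C))
    nlinarith
  by_cases hH : Hbad e p (Real.sqrt n) θ L i0 I D j A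
  · rw [ind_true hH]
    have := ind_nonneg (ManyBad e D A)
    linarith
  by_cases hM : ManyBad e D A
  · rw [ind_true hM]
    have := ind_nonneg (Hbad e p (Real.sqrt n) θ L i0 I D j A)
    linarith
  rw [ind_false hH, ind_false hM, zero_add, zero_add]
  have hnb : nbad e j A < D := by
    by_contra h; exact hM (nbad_le e j D A h)
  by_cases hG : HasGrad θ (nv j A)
  swap
  · refine le_trans (le_of_eq ?_) hLN
    apply sum_eq_zero
    intro C _
    rw [ind_false, mul_zero]
    intro h
    have := h.2.2
    rw [nv_update] at this
    exact hG this
  obtain ⟨s, Y, hs, hGr, hxY⟩ := hG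
  have hspos : 0 < s := lt_of_lt_of_le (by positivity) hs
  have hnvY : nv j A = fun i => s * Y i := funext hxY
  have hX : ∀ i, i ≠ j → XX Y (A i) = 0 := by
    intro i hi
    have := nv_normal j A i hi
    rw [hnvY, XX_smul] at this
    exact (mul_eq_zero.mp this).resolve_left hspos.ne'
  have hLO : LOg e p (Real.sqrt n) L (2 ^ i) Y := by
    by_contra h
    exact hH ⟨Y, hGr, hX, hnb, i, hi0, hiI, h⟩
  have h0 := hLO 0
  have hpt : ∀ C, ind (EJ e θ η1 j (Function.update A j C)) ≤ 2 * (ind (Good e C) * gk ((XX (fun l => 2 ^ i * Y l) C - 0) / Real.sqrt n)) := by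
    intro C
    by_cases hE : EJ e θ η1 j (Function.update A j C)
    · rw [ind_true hE]
      obtain ⟨e1, e2, -⟩ := hE
      rw [nv_update, Function.update_self, hnvY, XX_smul, abs_mul, abs_of_pos hspos] at e2
      rw [Function.update_self] at e1
      rw [ind_true e1, one_mul, sub_zero, XX_smul]
      have e3 : |XX Y C| ≤ 5 * n * η1 := by
        have : 1 / (5 * n) * |XX Y C| ≤ η1 := (mul_le_mul_of_nonneg_right hs (abs_nonneg _)).trans e2
        rw [div_mul_eq_mul_div, div_le_iff₀ (by positivity)] at this
        linarith
      have e4 : |2 ^ i * XX Y C / Real.sqrt n| ≤ 1 := by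
        rw [abs_div, abs_mul, abs_of_pos hsn, div_le_one hsn, abs_of_pos (by positivity)]
        exact (mul_le_mul_of_nonneg_left e3 (by positivity)).trans hsmall
      have e5 : 1 / 2 ≤ gk (2 ^ i * XX Y C / Real.sqrt n) := by
        unfold gk
        apply one_div_le_one_div_of_le (by positivity)
        have := (sq_le_one_iff_abs_le_one _).mpr e4
        linarith
      linarith
    · rw [ind_false hE]
      have := mul_nonneg (ind_nonneg (Good e C)) (gk_pos ((XX (fun l => 2 ^ i * Y l) C - 0) / Real.sqrt n)).le
      linarith
  calc ∑ C, wm (Fin n) (Fin n) p j C * ind (EJ e θ η1 j (Function.update A j C))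
      ≤ ∑ C, wm (Fin n) (Fin n) p j C * (2 * (ind (Good e C) * gk ((XX (fun l => 2 ^ i * Y l) C - 0) / Real.sqrt n))) := by
        apply sum_le_sum
        intro C _
        exact mul_le_mul_of_nonneg_left (hpt C) (hw.1 j C)
    _ = 2 * Phi e p (Real.sqrt n) 0 (fun l => 2 ^ i * Y l) := by
        unfold Phi; rw [← EE_smul]; rfl
    _ ≤ 2 * (L / 2 ^ i) := by linarith
    _ = _ := by ring

theorem scale_choice (i0 I : ℕ) (hI : i0 ≤ I) (T : ℝ) (hT : (2:ℝ) ^ i0 ≤ T) :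
    ∃ i, i0 ≤ i ∧ i ≤ I ∧ (2:ℝ) ^ i ≤ T ∧ 1 / (2:ℝ) ^ i ≤ 1 / 2 ^ I + 2 / T := by
  have hT0 : 0 < T := lt_of_lt_of_le (by positivity) hT
  have key : ∃ i, i0 ≤ i ∧ i ≤ I ∧ (2:ℝ) ^ i ≤ T ∧ (i = I ∨ T < 2 ^ (i + 1)) := by
    induction I, hI using Nat.le_induction with
    | base => exact ⟨i0, le_refl _, le_refl _, hT, Or.inl rfl⟩
    | succ I hI ih =>
      obtain ⟨i, a, b, c, d⟩ := ih
      rcases d with d | d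
      · subst d
        by_cases h : (2:ℝ) ^ (i + 1) ≤ T
        · exact ⟨i + 1, by omega, le_refl _, h, Or.inl rfl⟩
        · exact ⟨i, a, by omega, c, Or.inr (not_le.mp h)⟩
      · exact ⟨i, a, by omega, c, Or.inr d⟩
  obtain ⟨i, a, b, c, d⟩ := key
  refine ⟨i, a, b, c, ?_⟩
  have h1 : 0 < 2 / T := by positivity
  have h2 : (0:ℝ) < 1 / 2 ^ I := by positivity
  rcases d with d | d
  · subst d; linarith
  · have h3 : 1 / (2:ℝ) ^ i ≤ 2 / T := by
      rw [div_le_div_iff₀ (by positivity) hT0]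
      rw [pow_succ] at d; linarith
    linarith

end SMP
end SCP

namespace SCP

theorem pw_tr {n : ℕ} (p : ℝ) (A : Fin n → Fin n → Bool) :
    pw (wm (Fin n) (Fin n) p) (tr A) = pw (wm (Fin n) (Fin n) p) A := by
  unfold pw tr
  simp only [wm, wv, pw]
  rw [prod_comm]

theorem EE_tr {n : ℕ} (p : ℝ) (F : (Fin n → Fin n → Bool) → ℝ) :
    EE (wm (Fin n) (Fin n) p) (fun A => F (tr A)) = EE (wm (Fin n) (Fin n) p) F := by
  unfold EE
  refine Fintype.sum_equiv (Equiv.mk tr tr (fun _ => rfl) (fun _ => rfl)) _ _ ?_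
  intro A
  show _ = pw (wm (Fin n) (Fin n) p) (tr A) * F (tr A)
  rw [pw_tr]

theorem PP_tr {n : ℕ} (p : ℝ) (S : (Fin n → Fin n → Bool) → Prop) :
    PP (wm (Fin n) (Fin n) p) (fun A => S (tr A)) = PP (wm (Fin n) (Fin n) p) S :=
  EE_tr p (fun A => ind (S A))

section SMP
variable {β κ ρ : Type*} [Fintype β] [DecidableEq β] [Fintype κ] [DecidableEq κ] [Fintype ρ] [DecidableEq ρ]

theorem ej_prob2 {n : ℕ} (e : (β × κ) ⊕ ρ ≃ Fin n) {p θ η L bd : ℝ} (hp0 : 0 ≤ p) (hp1 : p ≤ 1) (hη : 0 < η) (hL : 1 ≤ L)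
    (hθ : 0 < θ) (i0 I D : ℕ) (hI : i0 ≤ I) (hL0 : (2:ℝ) ^ i0 ≤ L) (j : Fin n) (hbd : 0 ≤ bd)
    (hH : PP (wm (Fin n) (Fin n) p) (Hbad e p (Real.sqrt n) θ L i0 I D j) ≤ bd)
    (hM : PP (wm (Fin n) (Fin n) p) (ManyBad e D) ≤ bd) :
    PP (wm (Fin n) (Fin n) p) (EJ e θ (10 * n * η / θ) j) ≤ 2 * bd + 2 * L / 2 ^ I +
      4 * L * (50 * n ^ 2 * η / (θ * Real.sqrt n)) := by
  have hn : (1:ℝ) ≤ n := by exact_mod_cast j.pos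
  have hsn : 0 < Real.sqrt n := Real.sqrt_pos.mpr (by linarith)
  have hw : IsW (wm (Fin n) (Fin n) p) := isW_wm hp0 hp1
  set T := θ * Real.sqrt n / (50 * n ^ 2 * η) with hT
  have hT0 : 0 < T := by positivity
  have hTi : 50 * n ^ 2 * η / (θ * Real.sqrt n) = 1 / T := by rw [hT, one_div_div]
  rw [hTi]
  have hLI : 0 ≤ 2 * L / 2 ^ I := by positivity
  by_cases hc : (2:ℝ) ^ i0 ≤ T
  · obtain ⟨i, a, b, c, d⟩ := scale_choice i0 I hI T hc
    have h1 : (2:ℝ) ^ i * (5 * n * (10 * n * η / θ)) ≤ Real.sqrt n := by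
      rw [hT, le_div_iff₀ (by positivity)] at c
      have : (2:ℝ) ^ i * (5 * n * (10 * n * η / θ)) = (2 ^ i * (50 * n ^ 2 * η)) / θ := by ring
      rw [this, div_le_iff₀ hθ]; linarith
    have h2 := ej_prob e (θ := θ) hp0 hp1 (η1 := 10 * n * η / θ) (by positivity) (by linarith : 0 ≤ L) i0 I D i a b h1 j
    have h3 : 2 * L / 2 ^ i ≤ 2 * L / 2 ^ I + 4 * L * (1 / T) := by
      have : 2 * L * (1 / 2 ^ i) ≤ 2 * L * (1 / 2 ^ I + 2 / T) := mul_le_mul_of_nonneg_left d (by linarith)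
      calc 2 * L / 2 ^ i = 2 * L * (1 / 2 ^ i) := by ring
        _ ≤ _ := this
        _ = _ := by ring
    linarith
  · push Not at hc
    have h1 := PP_le_one hw (EJ e θ (10 * n * η / θ) j)
    have h2 : 1 ≤ L * (1 / T) := by
      rw [mul_one_div, le_div_iff₀ hT0]; linarith
    linarith

theorem sm_prob {n : ℕ} (e : (β × κ) ⊕ ρ ≃ Fin n) {p θ η L bd : ℝ} (hn0 : 0 < n) (hp0 : 0 ≤ p) (hp1 : p ≤ 1) (hη : 0 < η) (hL : 1 ≤ L)
    (hθ : 0 < θ) (hθ1 : θ ≤ 1) (i0 I D : ℕ) (hI : i0 ≤ I) (hL0 : (2:ℝ) ^ i0 ≤ L) (hbd : 0 ≤ bd)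
    (hη1 : (10 * n * η / θ) ^ 2 ≤ θ / 17) (hD : 2 * (D:ℝ) ≤ θ ^ 2 / 16 * n)
    (hH : ∀ j, PP (wm (Fin n) (Fin n) p) (Hbad e p (Real.sqrt n) θ L i0 I D j) ≤ bd)
    (hM : PP (wm (Fin n) (Fin n) p) (ManyBad e D) ≤ bd) :
    PP (wm (Fin n) (Fin n) p) (SM η) ≤ 2 * PP (wm (Fin n) (Fin n) p) (StructBad θ) + bd +
      32 / θ ^ 2 * (2 * bd + 2 * L / 2 ^ I + 4 * L * (50 * n ^ 2 * η / (θ * Real.sqrt n))) := by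
  classical
  have hn : (1:ℝ) ≤ n := by exact_mod_cast hn0
  have hw : IsW (wm (Fin n) (Fin n) p) := isW_wm hp0 hp1
  set W := wm (Fin n) (Fin n) p with hW
  set R := 2 * bd + 2 * L / 2 ^ I + 4 * L * (50 * n ^ 2 * η / (θ * Real.sqrt n)) with hR
  set η1 := 10 * n * η / θ with hηdef
  have h1 : PP W (SM η) ≤ PP W (fun A => StructBad θ A ∨ (StructBad θ (tr A) ∨ (ManyBad e D A ∨
      θ ^ 2 / 32 * n ≤ ∑ j, ind (EJ e θ η1 j A)))) := by
    apply PP_mono hw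
    intro A hA
    rcases sm_cover e hθ hη hθ1 hη1 D A hA with h | h | h | h
    · exact Or.inl h
    · exact Or.inr (Or.inl h)
    · exact Or.inr (Or.inr (Or.inl h))
    · refine Or.inr (Or.inr (Or.inr ?_))
      have : ∑ j, ind (EJ e θ η1 j A) = ((univ.filter (fun j => EJ e θ η1 j A)).card : ℝ) := by
        rw [card_filter]; push_cast; unfold ind
        apply sum_congr rfl; intro j _; congr
      rw [this]
      have h' := h
      linarith
  have h2 : PP W (fun A => θ ^ 2 / 32 * n ≤ ∑ j, ind (EJ e θ η1 j A)) ≤ 32 / θ ^ 2 * R := by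
    refine (PP_markov hw (fun A => sum_nonneg (fun j _ => ind_nonneg _)) (by positivity)).trans ?_
    rw [EE_sum]
    have h3 : ∑ j, EE W (fun A => ind (EJ e θ η1 j A)) ≤ ∑ j : Fin n, R := by
      apply sum_le_sum
      intro j _
      exact ej_prob2 e hp0 hp1 hη hL hθ i0 I D hI hL0 j hbd (hH j) hM
    rw [sum_const, card_univ, Fintype.card_fin, nsmul_eq_mul] at h3
    rw [div_le_iff₀ (by positivity)]
    refine h3.trans (le_of_eq ?_)
    field_simp
  have h4 := PP_or hw (fun A => StructBad θ A) (fun A => (StructBad θ (tr A) ∨ (ManyBad e D A ∨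
      θ ^ 2 / 32 * n ≤ ∑ j, ind (EJ e θ η1 j A))))
  have h5 := PP_or hw (fun A => StructBad θ (tr A)) (fun A => (ManyBad e D A ∨
      θ ^ 2 / 32 * n ≤ ∑ j, ind (EJ e θ η1 j A)))
  have h6 := PP_or hw (fun A => ManyBad e D A) (fun A => θ ^ 2 / 32 * n ≤ ∑ j, ind (EJ e θ η1 j A))
  have h7 : PP W (fun A => StructBad θ (tr A)) = PP W (StructBad θ) := PP_tr p (StructBad θ)
  have h8 : PP W (fun A => ManyBad e D A) ≤ bd := hM
  have h9 : PP W (fun A => StructBad θ A) = PP W (StructBad θ) := rfl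
  linarith

end SMP
end SCP

namespace SCP

theorem nexp_small {b ε K : ℝ} (hb : 0 < b) (hε : 0 < ε) (hK : 0 < K) {n : ℝ} (hn : 0 < n) (h : 2 * K / (b ^ 2 * ε) ≤ n) :
    K * n * Real.exp (-b * n) ≤ ε := by
  have h1 : (b * n) ^ 2 / 2 ≤ Real.exp (b * n) := by
    have := Real.quadratic_le_exp_of_nonneg (x := b * n) (by positivity)
    have : 0 < b * n := by positivity
    linarith
  rw [neg_mul, Real.exp_neg, ← div_eq_mul_inv, div_le_iff₀ (Real.exp_pos _)]
  refine le_trans ?_ (mul_le_mul_of_nonneg_left h1 hε.le)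
  rw [div_le_iff₀ (by positivity)] at h
  have : n * (2 * K) ≤ n * (n * (b ^ 2 * ε)) := mul_le_mul_of_nonneg_left h hn.le
  linarith

set_option maxHeartbeats 1000000 in
theorem sm_main {q ε θ : ℝ} (hq : 0 < q) (hqc : q < 1 / 2 ^ 111) (hε : 0 < ε) (hθ : θ = q ^ 3 / 2 ^ 31) :
    ∃ (L : ℝ) (n0 : ℕ), 1 ≤ L ∧ ∀ n : ℕ, n0 ≤ n → 0 < n ∧ ∀ p, q < p → p < 1 / 2 ^ 111 → ∀ η, 0 < η →
      (10 * n * η / θ) ^ 2 ≤ θ / 17 →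
      PP (wm (Fin n) (Fin n) p) (SM η) ≤ (2 + ε) * (n * (1 - p) ^ n) +
        32 / θ ^ 2 * (4 * L * (50 * n ^ 2 * η / (θ * Real.sqrt n))) := by
  have hq4 : q ≤ 1 / 4 := hqc.le.trans (by norm_num)
  have hθ0 : 0 < θ := by rw [hθ]; positivity
  have hθ1 : θ ≤ 1 := by
    rw [hθ, div_le_one (by positivity)]
    have : q ^ 3 ≤ 1 := pow_le_one₀ hq.le (by linarith)
    linarith [show (1:ℝ) ≤ 2 ^ 31 by norm_num]
  obtain ⟨L, i0, n0, hL, hL0, hmain⟩ := block_main hq hθ0 hθ1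
  set K := 23 + 64 / θ ^ 2 + 64 * L / θ ^ 2 with hK
  have hK0 : 0 < K := by positivity
  obtain ⟨n1, hn1⟩ := exists_nat_ge (1 / θ + 3200 / (q * θ ^ 2) + 2 * K / ((q / 4) ^ 2 * ε))
  refine ⟨L, max n0 (n1 + 1), hL, ?_⟩
  intro n hn
  have hn0 : n0 ≤ n := (le_max_left _ _).trans hn
  have hnn1 : n1 + 1 ≤ n := (le_max_right _ _).trans hn
  have hnpos : 0 < n := by omega
  have hnR : (1:ℝ) ≤ n := by exact_mod_cast hnpos
  have hnb : 1 / θ + 3200 / (q * θ ^ 2) + 2 * K / ((q / 4) ^ 2 * ε) ≤ n :=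
    hn1.trans (by exact_mod_cast (by omega : n1 ≤ n))
  have hb1 : 0 < 1 / θ := by positivity
  have hb2 : 0 < 3200 / (q * θ ^ 2) := by positivity
  have hb3 : 0 < 2 * K / ((q / 4) ^ 2 * ε) := by positivity
  refine ⟨hnpos, ?_⟩
  intro p hqp hpc η hη hη1
  have hp4 : p ≤ 1 / 4 := hpc.le.trans (by norm_num)
  have hp0 : 0 < p := hq.trans hqp
  obtain ⟨k, hk, I, hI, hH, hM, hIs⟩ := hmain n hn0 p hqp hpc
  have hD : 2 * ((100 * k : ℕ) : ℝ) ≤ θ ^ 2 / 16 * n := by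
    push_cast
    have h1 : (k:ℝ) ≤ 1 / q := by rw [le_div_iff₀ hq]; exact hk
    have h2 : 3200 / (q * θ ^ 2) ≤ n := by linarith
    have h3 : 200 / q ≤ θ ^ 2 / 16 * n := by
      rw [div_le_iff₀ (by positivity)] at h2
      rw [div_le_iff₀ hq]; linarith
    have : 200 / q = 200 * (1 / q) := by ring
    linarith
  have hs := sm_prob (blockEquiv n k) hnpos hp0.le (by linarith) hη hL hθ0 hθ1 i0 I (100 * k) hI hL0
    (bd := 1 / 2 ^ n) (by positivity) hη1 hD hH hM
  have hst := struct_prob hq hqp.le hp4 hθ (n := n) (by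
    have : 1 / θ ≤ n := by linarith
    rw [div_le_iff₀ hθ0] at this; linarith)
  set a := (1 - p) ^ n with ha
  have ha0 : 0 < a := by
    have : 0 < 1 - p := by linarith
    positivity
  set x := Real.exp (-(q / 4) * n) with hx
  have hx0 : 0 < x := Real.exp_pos _
  have hx2 : Real.exp (-(q / 2) * n) ≤ x := by
    apply Real.exp_le_exp.mpr; nlinarith
  have hI2 : 1 / 2 ^ I ≤ a * x := hIs.trans (mul_le_mul_of_nonneg_left hx2 ha0.le)
  have h2n : 1 / 2 ^ n ≤ a * x := by
    refine le_trans ?_ (mul_le_mul_of_nonneg_left hx2 ha0.le)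
    have h1 : Real.exp (-(q / 2) * n) = Real.exp (-(q / 2)) ^ n := by
      rw [← Real.exp_nat_mul]; congr 1; ring
    rw [h1, ha, ← mul_pow, ← one_div_pow]
    apply pow_le_pow_left₀ (by norm_num)
    have h2 := Real.add_one_le_exp (-(q / 2))
    nlinarith
  have hsm := nexp_small (b := q / 4) (by positivity) hε hK0 (by linarith : (0:ℝ) < n) (by linarith)
  rw [← hx] at hsm
  have hax : 0 < a * x := by positivity
  have e1 : 32 / θ ^ 2 * (2 * (1 / 2 ^ n) + 2 * L / 2 ^ I + 4 * L * (50 * n ^ 2 * η / (θ * Real.sqrt n))) ≤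
      (64 / θ ^ 2 + 64 * L / θ ^ 2) * (a * x) + 32 / θ ^ 2 * (4 * L * (50 * n ^ 2 * η / (θ * Real.sqrt n))) := by
    have t1 : 64 / θ ^ 2 * (1 / 2 ^ n) ≤ 64 / θ ^ 2 * (a * x) := mul_le_mul_of_nonneg_left h2n (by positivity)
    have t2 : 64 * L / θ ^ 2 * (1 / 2 ^ I) ≤ 64 * L / θ ^ 2 * (a * x) := mul_le_mul_of_nonneg_left hI2 (by positivity)
    have t3 : 32 / θ ^ 2 * (2 * (1 / 2 ^ n) + 2 * L / 2 ^ I + 4 * L * (50 * n ^ 2 * η / (θ * Real.sqrt n))) =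
      64 / θ ^ 2 * (1 / 2 ^ n) + 64 * L / θ ^ 2 * (1 / 2 ^ I) + 32 / θ ^ 2 * (4 * L * (50 * n ^ 2 * η / (θ * Real.sqrt n))) := by
      ring
    rw [t3]; linarith
  have e2 : 2 * (n * (8 * n + 3) * (a * x)) + a * x + (64 / θ ^ 2 + 64 * L / θ ^ 2) * (a * x) ≤ ε * (n * a) := by
    have s1 : 2 * (n * (8 * n + 3) * (a * x)) + a * x + (64 / θ ^ 2 + 64 * L / θ ^ 2) * (a * x) ≤ K * n ^ 2 * (a * x) := by
      have : 2 * (n * (8 * n + 3)) + 1 + (64 / θ ^ 2 + 64 * L / θ ^ 2) ≤ K * (n:ℝ) ^ 2 := by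
        have u0 : (1:ℝ) ≤ (n:ℝ) ^ 2 := one_le_pow₀ hnR
        have u1 : 0 ≤ 64 / θ ^ 2 + 64 * L / θ ^ 2 := by positivity
        have u2 : (64 / θ ^ 2 + 64 * L / θ ^ 2) * 1 ≤ (64 / θ ^ 2 + 64 * L / θ ^ 2) * (n:ℝ) ^ 2 := mul_le_mul_of_nonneg_left u0 u1
        have u3 : K * (n:ℝ) ^ 2 = 23 * n ^ 2 + (64 / θ ^ 2 + 64 * L / θ ^ 2) * (n:ℝ) ^ 2 := by rw [hK]; ring
        have u4 : (n:ℝ) ≤ (n:ℝ) ^ 2 := by rw [sq]; exact le_mul_of_one_le_left (by linarith) hnR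
        have u5 : 2 * ((n:ℝ) * (8 * n + 3)) = 16 * (n:ℝ) ^ 2 + 6 * n := by ring
        rw [u3, u5]; linarith
      have := mul_le_mul_of_nonneg_right this hax.le
      linarith
    have s2 : K * n ^ 2 * (a * x) = (K * n * x) * (n * a) := by ring
    rw [s2] at s1
    exact s1.trans (mul_le_mul_of_nonneg_right hsm (by positivity))
  linarith

end SCP

namespace SCP

theorem zero_set_prob {n : ℕ} (p : ℝ) (S : Fin n → Fin n → Prop) :
    PP (wm (Fin n) (Fin n) p) (fun A => ∀ r i, S r i → A r i = false) = ∏ r, ∏ i, (1 - p * ind (S r i)) := by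
  unfold PP
  simp only [ind_forall (κ := Fin n)]
  rw [EE_prod (wm (Fin n) (Fin n) p) (fun r C => ∏ i, ind (S r i → C i = false))]
  apply prod_congr rfl
  intro r _
  have h := EE_prod (wv (Fin n) p) (fun i b => ind (S r i → b = false))
  refine Eq.trans h (prod_congr rfl ?_)
  intro i _
  rw [sum_bw]
  by_cases hs : S r i <;> simp [ind, hs]

/-- the line (column or row) of entries -/
def Ln {n : ℕ} : Fin n ⊕ Fin n → Fin n → Fin n → Prop
  | Sum.inl i => fun _ c => c = i
  | Sum.inr j => fun r _ => r = j

/-- the line vanishes -/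
def ZL {n : ℕ} (b : Fin n ⊕ Fin n) (A : Fin n → Fin n → Bool) : Prop := ∀ r i, Ln b r i → A r i = false

theorem ZL_prob {n : ℕ} (p : ℝ) (b : Fin n ⊕ Fin n) : PP (wm (Fin n) (Fin n) p) (ZL b) = (1 - p) ^ n := by
  classical
  refine (zero_set_prob p (Ln b)).trans ?_
  rcases b with i | j
  · simp only [Ln]
    have : ∀ r : Fin n, ∏ c, (1 - p * ind (c = i)) = 1 - p := by
      intro r
      rw [prod_eq_single i]
      · simp [ind]
      · intro r _ hr; simp [hr, ind]
      · simp
    rw [prod_congr rfl (fun r _ => this r)]; simp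
  · simp only [Ln]
    rw [prod_eq_single j]
    · simp [ind]
    · intro r _ hr; simp [hr, ind]
    · simp

theorem ZL_pair {n : ℕ} {p : ℝ} (hp0 : 0 ≤ p) (hp : p ≤ 1 / 2) {b c : Fin n ⊕ Fin n} (hbc : b ≠ c) :
    PP (wm (Fin n) (Fin n) p) (fun A => ZL b A ∧ ZL c A) ≤ 2 * ((1 - p) ^ n) ^ 2 := by
  classical
  have h1 : PP (wm (Fin n) (Fin n) p) (fun A => ZL b A ∧ ZL c A) =
      ∏ r, ∏ i, (1 - p * ind (Ln b r i ∨ Ln c r i)) := by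
    rw [← zero_set_prob p (fun r i => Ln b r i ∨ Ln c r i)]
    congr 1; funext A; apply propext
    constructor
    · rintro ⟨h, h'⟩ r i (h2 | h2)
      · exact h r i h2
      · exact h' r i h2
    · intro h
      exact ⟨fun r i h2 => h r i (Or.inl h2), fun r i h2 => h r i (Or.inr h2)⟩
  have h2 : (∏ r, ∏ i, (1 - p * ind (Ln b r i ∨ Ln c r i))) * (∏ r, ∏ i, (1 - p * ind (Ln b r i ∧ Ln c r i))) =
      (∏ r, ∏ i, (1 - p * ind (Ln b r i))) * (∏ r, ∏ i, (1 - p * ind (Ln c r i))) := by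
    simp only [← prod_mul_distrib]
    apply prod_congr rfl; intro r _
    apply prod_congr rfl; intro i _
    by_cases hb : Ln b r i <;> by_cases hc : Ln c r i <;> simp [hb, hc, ind]
  have h3 : 1 / 2 ≤ ∏ r : Fin n, ∏ i : Fin n, (1 - p * ind (Ln b r i ∧ Ln c r i)) := by
    have hmix : ∀ i j : Fin n, ∏ r : Fin n, ∏ i' : Fin n, (1 - p * ind (i' = i ∧ r = j)) = 1 - p := by
      intro i j
      rw [prod_eq_single j]
      · rw [prod_eq_single i]
        · simp [ind]
        · intro r _ hr; simp [hr, ind]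
        · simp
      · intro r _ hr; simp [hr, ind]
      · simp
    have hone : (∀ r i, ¬ (Ln b r i ∧ Ln c r i)) → 1 / 2 ≤ ∏ r : Fin n, ∏ i : Fin n, (1 - p * ind (Ln b r i ∧ Ln c r i)) := by
      intro h
      simp only [fun r i => ind_false (h r i)]; norm_num
    rcases b with i | j <;> rcases c with i' | j'
    · apply hone
      rintro r l ⟨h, h'⟩
      apply hbc
      simp only [Ln] at h h'
      rw [← h, ← h']
    · have := hmix i j'
      simp only [Ln]
      rw [this]; linarith
    · have := hmix i' j
      simp only [Ln]
      have h5 : ∀ r i : Fin n, (1 - p * ind (r = j ∧ i = i')) = (1 - p * ind (i = i' ∧ r = j)) := by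
        intro r i; simp only [and_comm]
      simp only [h5]
      rw [this]; linarith
    · apply hone
      rintro r l ⟨h, h'⟩
      apply hbc
      simp only [Ln] at h h'
      rw [← h, ← h']
  have hb := ZL_prob p b
  have hc := ZL_prob p c
  have hb' := zero_set_prob p (Ln b)
  have hc' := zero_set_prob p (Ln c)
  unfold ZL at hb hc
  rw [hb] at hb'
  rw [hc] at hc'
  rw [← hb', ← hc', ← h1] at h2
  have hP : 0 ≤ PP (wm (Fin n) (Fin n) p) (fun A => ZL b A ∧ ZL c A) := PP_nonneg (isW_wm hp0 (by linarith)) _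
  have := mul_le_mul_of_nonneg_left h3 hP
  rw [h2] at this
  linarith

theorem ZL_lower {n : ℕ} {p : ℝ} (hp0 : 0 ≤ p) (hp : p ≤ 1 / 2) :
    2 * n * (1 - p) ^ n - 8 * n ^ 2 * ((1 - p) ^ n) ^ 2 ≤ PP (wm (Fin n) (Fin n) p) (fun A => ∃ b, ZL b A) := by
  classical
  have hw : IsW (wm (Fin n) (Fin n) p) := isW_wm hp0 (by linarith)
  set W := wm (Fin n) (Fin n) p with hW
  have h1 : EE W (fun A => 2 * (∑ b, ind (ZL b A)) - ∑ b, ∑ c, ind (ZL b A ∧ ZL c A)) ≤ PP W (fun A => ∃ b, ZL b A) := by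
    apply EE_mono hw
    intro A
    have hs : ∑ b, ∑ c, ind (ZL b A ∧ ZL c A) = (∑ b, ind (ZL b A)) ^ 2 := by
      rw [sq, sum_mul_sum]
      simp only [ind_and]
    rw [hs]
    by_cases h : ∃ b, ZL b A
    · rw [ind_true h]
      nlinarith [sq_nonneg ((∑ b, ind (ZL b A)) - 1)]
    · rw [ind_false h]
      push Not at h
      have : ∑ b, ind (ZL b A) = 0 := sum_eq_zero (fun b _ => ind_false (h b))
      rw [this]; norm_num
  rw [EE_sub, EE_smul, EE_sum, EE_sum] at h1
  have h2 : ∀ b : Fin n ⊕ Fin n, EE W (fun A => ind (ZL b A)) = (1 - p) ^ n := fun b => ZL_prob p b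
  have ha : 0 ≤ (1 - p) ^ n := pow_nonneg (by linarith) n
  have h3 : ∀ b : Fin n ⊕ Fin n, EE W (fun A => ∑ c, ind (ZL b A ∧ ZL c A)) ≤ (1 - p) ^ n + 2 * n * (2 * ((1 - p) ^ n) ^ 2) := by
    intro b
    rw [EE_sum, ← add_sum_erase univ _ (mem_univ b)]
    apply add_le_add
    · rw [← h2 b]
      apply EE_mono hw
      intro A; exact ind_mono (fun h => h.1)
    · have : ∑ x ∈ univ.erase b, EE W (fun A => ind (ZL b A ∧ ZL x A)) ≤ ∑ x ∈ univ.erase b, 2 * ((1 - p) ^ n) ^ 2 := by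
        apply sum_le_sum
        intro c hc
        exact ZL_pair hp0 hp (ne_of_mem_erase hc).symm
      refine this.trans ?_
      rw [sum_const, nsmul_eq_mul]
      apply mul_le_mul_of_nonneg_right _ (by positivity)
      have : (univ.erase b).card ≤ 2 * n := by
        refine (card_le_card (erase_subset _ _)).trans (le_of_eq ?_)
        simp; ring
      exact_mod_cast this
  simp only [h2] at h1
  have h4 := sum_le_sum (s := univ) (fun b (_ : b ∈ (univ : Finset (Fin n ⊕ Fin n))) => h3 b)
  rw [sum_const, nsmul_eq_mul] at h4
  rw [sum_const, nsmul_eq_mul] at h1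
  have hcard : ((univ : Finset (Fin n ⊕ Fin n)).card : ℝ) = 2 * n := by simp; ring
  rw [hcard] at h1 h4
  linarith

theorem ZL_main {q ε : ℝ} (hq : 0 < q) (hqc : q < 1 / 2 ^ 111) (hε : 0 < ε) :
    ∃ n0 : ℕ, ∀ n : ℕ, n0 ≤ n → ∀ p, q < p → p < 1 / 2 ^ 111 →
      2 * n * (1 - p) ^ n - ε * (n * (1 - p) ^ n) ≤ PP (wm (Fin n) (Fin n) p) (fun A => ∃ b, ZL b A) := by
  obtain ⟨n1, hn1⟩ := exists_nat_ge (2 * 8 / (q ^ 2 * ε))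
  refine ⟨n1 + 1, ?_⟩
  intro n hn p hqp hpc
  have hp4 : p ≤ 1 / 4 := hpc.le.trans (by norm_num)
  have hnR : (1:ℝ) ≤ n := by exact_mod_cast (by omega : 1 ≤ n)
  refine le_trans ?_ (ZL_lower (by linarith) (by linarith))
  have h1 := nexp_small (b := q) (K := 8) hq hε (by norm_num) (by linarith : (0:ℝ) < n)
    (hn1.trans (by exact_mod_cast (by omega : n1 ≤ n)))
  have h2 : (1 - p) ^ n ≤ Real.exp (-q * n) := by
    have h3 : Real.exp (-q * n) = Real.exp (-q) ^ n := by
      rw [← Real.exp_nat_mul]; congr 1; ring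
    rw [h3]
    apply pow_le_pow_left₀ (by linarith)
    have := Real.add_one_le_exp (-q)
    linarith
  have ha : 0 ≤ (1 - p) ^ n := pow_nonneg (by linarith) n
  have h3 : 8 * n * (1 - p) ^ n ≤ ε := (mul_le_mul_of_nonneg_left h2 (by positivity)).trans h1
  have h4 := mul_le_mul_of_nonneg_right h3 (by positivity : 0 ≤ n * (1 - p) ^ n)
  linarith

end SCP

namespace SCP

/-- matrix of a Boolean array of columns -/
noncomputable def mx {n : ℕ} (A : Fin n → Fin n → Bool) : Matrix (Fin n) (Fin n) ℝ := fun i j => if A j i then 1 else 0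

theorem pw_mx {n : ℕ} (p : ℝ) (A : Fin n → Fin n → Bool) :
    pw (wm (Fin n) (Fin n) p) A = p ^ (Finset.univ.filter (fun ij : Fin n × Fin n => mx A ij.1 ij.2 = 1)).card *
          (1 - p) ^ (Finset.univ.filter (fun ij : Fin n × Fin n => mx A ij.1 ij.2 = 0)).card := by
  have h1 : pw (wm (Fin n) (Fin n) p) A = ∏ ij : Fin n × Fin n, (if A ij.2 ij.1 then p else 1 - p) := by
    rw [Fintype.prod_prod_type_right]
    rfl
  rw [h1, prod_ite, prod_const, prod_const]
  congr 3
  · apply filter_congr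
    intro ij _
    unfold mx
    by_cases h : A ij.2 ij.1 <;> simp [h]
  · apply filter_congr
    intro ij _
    unfold mx
    by_cases h : A ij.2 ij.1 <;> simp [h]

theorem transfer_le {Ω : Type} [MeasurableSpace Ω] (μ : Measure Ω) [IsProbabilityMeasure μ] {n : ℕ} {p : ℝ}
    (hp0 : 0 ≤ p) (hp1 : p ≤ 1) (M : Ω → Matrix (Fin n) (Fin n) ℝ) (hM : IsBernoulliMatrix μ M p)
    (P : Matrix (Fin n) (Fin n) ℝ → Prop) :
    (μ {ω | P (M ω)}).toReal ≤ PP (wm (Fin n) (Fin n) p) (fun A => P (mx A)) := by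
  classical
  have hw : IsW (wm (Fin n) (Fin n) p) := isW_wm hp0 hp1
  have hsub : {ω | P (M ω)} ⊆ ⋃ A ∈ (univ.filter (fun A : Fin n → Fin n → Bool => P (mx A))), {ω | M ω = mx A} := by
    intro ω hω
    have he : M ω = mx (fun j i => decide (M ω i j = 1)) := by
      ext i j
      unfold mx
      rcases hM.1 ω i j with h | h <;> simp [h]
    simp only [Set.mem_iUnion, mem_filter, mem_univ, true_and, Set.mem_ofPred_eq]
    refine ⟨fun j i => decide (M ω i j = 1), ?_, he⟩
    rw [← he]; exact hω
  have hA : ∀ A : Fin n → Fin n → Bool, μ {ω | M ω = mx A} = ENNReal.ofReal (pw (wm (Fin n) (Fin n) p) A) := by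
    intro A
    rw [hM.2 (mx A) (fun i j => by unfold mx; by_cases h : A j i <;> simp [h]), pw_mx]
  have h1 : μ {ω | P (M ω)} ≤ ENNReal.ofReal (∑ A ∈ univ.filter (fun A : Fin n → Fin n → Bool => P (mx A)), pw (wm (Fin n) (Fin n) p) A) := by
    refine (measure_mono hsub).trans ((measure_biUnion_finset_le _ _).trans (le_of_eq ?_))
    rw [ENNReal.ofReal_sum_of_nonneg (fun A _ => pw_nonneg hw A)]
    exact sum_congr rfl (fun A _ => hA A)
  have h2 := ENNReal.toReal_mono ENNReal.ofReal_ne_top h1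
  rw [ENNReal.toReal_ofReal (sum_nonneg (fun A _ => pw_nonneg hw A))] at h2
  refine h2.trans (le_of_eq ?_)
  unfold PP EE
  rw [sum_filter]
  apply sum_congr rfl
  intro A _
  by_cases h : P (mx A) <;> simp [h, ind]

theorem transfer_ge {Ω : Type} [MeasurableSpace Ω] (μ : Measure Ω) [IsProbabilityMeasure μ] {n : ℕ} {p : ℝ}
    (hp0 : 0 ≤ p) (hp1 : p ≤ 1) (M : Ω → Matrix (Fin n) (Fin n) ℝ) (hM : IsBernoulliMatrix μ M p)
    (P : Matrix (Fin n) (Fin n) ℝ → Prop) :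
    PP (wm (Fin n) (Fin n) p) (fun A => P (mx A)) ≤ (μ {ω | P (M ω)}).toReal := by
  have hw : IsW (wm (Fin n) (Fin n) p) := isW_wm hp0 hp1
  have h1 := transfer_le μ hp0 hp1 M hM (fun B => ¬ P B)
  have h2 : (1 : ℝ) ≤ (μ {ω | P (M ω)}).toReal + (μ {ω | ¬ P (M ω)}).toReal := by
    rw [← ENNReal.toReal_add (measure_ne_top _ _) (measure_ne_top _ _), ← ENNReal.toReal_one]
    apply ENNReal.toReal_mono (by simp [measure_ne_top])
    rw [← measure_univ (μ := μ)]
    refine (measure_mono ?_).trans (measure_union_le _ _)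
    intro ω _
    exact Classical.em (P (M ω))
  have h3 : PP (wm (Fin n) (Fin n) p) (fun A => ¬ P (mx A)) = 1 - PP (wm (Fin n) (Fin n) p) (fun A => P (mx A)) := by
    unfold PP
    simp only [ind_not]
    rw [EE_sub, EE_one hw]
  linarith

theorem mx_mulVec {n : ℕ} (A : Fin n → Fin n → Bool) (x : Fin n → ℝ) (i : Fin n) :
    (mx A).mulVec x i = XX x (tr A i) := by
  unfold Matrix.mulVec dotProduct mx XX tr
  apply sum_congr rfl
  intro l _
  by_cases h : A l i = true <;> simp [h]

theorem SM_of_det {n : ℕ} {η : ℝ} (A : Fin n → Fin n → Bool) (h : (mx A).det = 0) : SM η A := by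
  obtain ⟨v, hv0, hv⟩ := Matrix.exists_mulVec_eq_zero_iff.mpr h
  have hvX : ∀ i, XX v (tr A i) = 0 := by
    intro i
    rw [← mx_mulVec, hv]; rfl
  have hpos : 0 < ∑ i, v i ^ 2 := by
    obtain ⟨i, hi⟩ := Function.ne_iff.mp hv0
    have : 0 < v i ^ 2 := by have : v i ≠ 0 := hi; positivity
    exact lt_of_lt_of_le this (single_le_sum (f := fun i => v i ^ 2) (fun _ _ => sq_nonneg _) (mem_univ i))
  refine ⟨fun i => (Real.sqrt (∑ i, v i ^ 2))⁻¹ * v i, ?_, ?_⟩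
  · simp only [mul_pow]
    rw [← mul_sum, inv_pow, Real.sq_sqrt hpos.le, inv_mul_cancel₀ hpos.ne']
  · simp only [XX_smul, hvX]
    simp; positivity

theorem SM_of_sMin {n : ℕ} (hn : 0 < n) {η : ℝ} (hη : 0 < η) (A : Fin n → Fin n → Bool) (h : sMin (mx A) ≤ η) : SM (2 * η) A := by
  have hlt : sMin (mx A) < 2 * η := by linarith
  have hne : {r | ∃ x : Fin n → ℝ, eNorm x = 1 ∧ r = eNorm ((mx A).mulVec x)}.Nonempty := by
    refine ⟨_, Pi.single ⟨0, hn⟩ 1, ?_, rfl⟩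
    unfold eNorm
    rw [Real.sqrt_eq_one, sum_eq_single ⟨0, hn⟩]
    · simp
    · intro b _ hb; simp [hb]
    · simp
  obtain ⟨r, ⟨x, hx, rfl⟩, hr⟩ := exists_lt_of_csInf_lt hne hlt
  unfold eNorm at hx hr
  rw [Real.sqrt_eq_one] at hx
  refine ⟨x, hx, ?_⟩
  simp only [← mx_mulVec]
  rw [Real.sqrt_lt' (by positivity)] at hr
  exact hr.le

theorem det_of_ZL {n : ℕ} (A : Fin n → Fin n → Bool) (h : ∃ b, ZL b A) : (mx A).det = 0 := by
  obtain ⟨b, hb⟩ := h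
  rcases b with i | j
  · apply Matrix.det_eq_zero_of_row_eq_zero i
    intro l
    have := hb l i rfl
    simp [mx, this]
  · apply Matrix.det_eq_zero_of_column_eq_zero j
    intro l
    have := hb j l rfl
    simp [mx, this]

theorem nu_eq {n : ℕ} (hn : 0 < n) : (n:ℝ) ^ (-(5:ℝ)/2) * (n ^ 2 * Real.sqrt n) = 1 := by
  have hn0 : (0:ℝ) < n := by exact_mod_cast hn
  rw [Real.sqrt_eq_rpow, ← Real.rpow_natCast (n:ℝ) 2, ← Real.rpow_add hn0, ← Real.rpow_add hn0]
  norm_num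

end SCP


end SCPall

set_option maxHeartbeats 1000000 in
/-- Singularity probability and smallest singular value bound for Bernoulli(p) matrices
with `p` between two constants `q < c`. -/
theorem singularity_constant_p :
    ∃ c : ℝ, 0 < c ∧
      ∀ q : ℝ, q ∈ Set.Ioo (0 : ℝ) c → ∀ ε : ℝ, 0 < ε →
        ∃ (Cq : ℝ) (n₀ : ℕ), 0 < Cq ∧
          ∀ n : ℕ, n₀ ≤ n → ∀ p : ℝ, p ∈ Set.Ioo q c →
            ∀ (Ω : Type) [MeasurableSpace Ω] (μ : Measure Ω), IsProbabilityMeasure μ →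
              ∀ M : Ω → Matrix (Fin n) (Fin n) ℝ, IsBernoulliMatrix μ M p →
                |(μ {ω | (M ω).det = 0}).toReal - 2 * n * (1 - p) ^ n|
                    ≤ ε * (n * (1 - p) ^ n) ∧
                ∀ t : ℝ, 0 < t →
                  (μ {ω | sMin (M ω) ≤ Cq * (n : ℝ) ^ (-(5 : ℝ) / 2) * t}).toReal
                    ≤ t + (2 + ε) * (n * (1 - p) ^ n) := by
  refine ⟨1 / 2 ^ 111, by norm_num, ?_⟩
  rintro q ⟨hq, hqc⟩ ε hε
  set θ : ℝ := q ^ 3 / 2 ^ 31 with hθ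
  have hθ0 : 0 < θ := by positivity
  have hq1 : q ≤ 1 := hqc.le.trans (by norm_num)
  have hθ17 : θ ≤ 1 / 17 := by
    rw [hθ, div_le_iff₀ (by positivity)]
    have : q ^ 3 ≤ 1 := pow_le_one₀ hq.le hq1
    linarith [show (17:ℝ) ≤ 2 ^ 31 by norm_num]
  obtain ⟨L, n1, hL, hmain⟩ := SCP.sm_main hq hqc hε hθ
  obtain ⟨n2, hlow⟩ := SCP.ZL_main hq hqc hε
  have hL0 : 0 < L := by linarith
  refine ⟨θ ^ 3 / (12800 * L), max n1 n2, by positivity, ?_⟩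
  rintro n hn p ⟨hqp, hpc⟩ Ω _ μ hμ M hM
  obtain ⟨hnpos, hup⟩ := hmain n ((le_max_left _ _).trans hn)
  have hup := hup p hqp hpc
  have hlo := hlow n ((le_max_right _ _).trans hn) p hqp hpc
  have hp0 : 0 ≤ p := (hq.trans hqp).le
  have hp1 : p ≤ 1 := hpc.le.trans (by norm_num)
  have hw : SCP.IsW (SCP.wm (Fin n) (Fin n) p) := SCP.isW_wm hp0 hp1
  have hnR : (1:ℝ) ≤ n := by exact_mod_cast hnpos
  have hsn : 0 < Real.sqrt n := Real.sqrt_pos.mpr (by linarith)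
  have ha : 0 ≤ n * (1 - p) ^ n := mul_nonneg (by linarith) (pow_nonneg (by linarith) n)
  have hsq : ∀ y : ℝ, 0 ≤ y → y ≤ θ / 17 → y ^ 2 ≤ θ / 17 := by
    intro y hy hy2
    have : y ≤ 1 := by linarith
    nlinarith
  constructor
  · have hge := SCP.transfer_ge μ hp0 hp1 M hM (fun B => B.det = 0)
    have hle := SCP.transfer_le μ hp0 hp1 M hM (fun B => B.det = 0)
    have hl2 : SCP.PP (SCP.wm (Fin n) (Fin n) p) (fun A => ∃ b, SCP.ZL b A) ≤
        SCP.PP (SCP.wm (Fin n) (Fin n) p) (fun A => (SCP.mx A).det = 0) :=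
      SCP.PP_mono hw (fun A hA => SCP.det_of_ZL A hA)
    have hu2 : SCP.PP (SCP.wm (Fin n) (Fin n) p) (fun A => (SCP.mx A).det = 0) ≤ (2 + ε) * (n * (1 - p) ^ n) := by
      apply le_of_forall_pos_le_add
      intro δ hδ
      set K : ℝ := 32 / θ ^ 2 * (4 * L * (50 * n ^ 2 / (θ * Real.sqrt n))) with hK
      have hK0 : 0 < K := by positivity
      set η : ℝ := min (θ ^ 2 / (170 * n)) (δ / K) with hη
      have hη0 : 0 < η := lt_min (by positivity) (by positivity)
      have h1 : η ≤ θ ^ 2 / (170 * n) := min_le_left _ _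
      have h2 : η ≤ δ / K := min_le_right _ _
      have h3 : 10 * n * η / θ ≤ θ / 17 := by
        rw [le_div_iff₀ (by positivity)] at h1
        rw [div_le_iff₀ hθ0]
        nlinarith
      have h4 := hup η hη0 (hsq _ (by positivity) h3)
      have h5 : 32 / θ ^ 2 * (4 * L * (50 * n ^ 2 * η / (θ * Real.sqrt n))) = K * η := by rw [hK]; ring
      rw [h5] at h4
      have h6 : K * η ≤ δ := by
        rw [le_div_iff₀ hK0] at h2; linarith
      have h7 : SCP.PP (SCP.wm (Fin n) (Fin n) p) (fun A => (SCP.mx A).det = 0) ≤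
          SCP.PP (SCP.wm (Fin n) (Fin n) p) (SCP.SM η) := SCP.PP_mono hw (fun A hA => SCP.SM_of_det A hA)
      linarith
    rw [abs_le]
    constructor <;> linarith
  · intro t ht
    have hle := SCP.transfer_le μ hp0 hp1 M hM (fun B => sMin B ≤ θ ^ 3 / (12800 * L) * (n : ℝ) ^ (-(5 : ℝ) / 2) * t)
    refine hle.trans ?_
    by_cases ht1 : 1 < t
    · have h1 := SCP.PP_le_one hw (fun A => sMin (SCP.mx A) ≤ θ ^ 3 / (12800 * L) * (n : ℝ) ^ (-(5 : ℝ) / 2) * t)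
      have h2 : 0 ≤ (2 + ε) * (n * (1 - p) ^ n) := mul_nonneg (by linarith) ha
      linarith
    push Not at ht1
    have hν := SCP.nu_eq hnpos
    set ν : ℝ := (n : ℝ) ^ (-(5 : ℝ) / 2) with hνd
    have hν0 : 0 < ν := Real.rpow_pos_of_pos (by linarith) _
    set η' : ℝ := θ ^ 3 / (12800 * L) * ν * t with hη'
    have hη'0 : 0 < η' := by positivity
    have hs1 : (1:ℝ) ≤ Real.sqrt n := Real.one_le_sqrt.mpr hnR
    have hn1 : n * ν ≤ 1 := by
      rw [← hν]
      have : (n:ℝ) * ν * 1 ≤ n * ν * (n * Real.sqrt n) := by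
        apply mul_le_mul_of_nonneg_left _ (by positivity)
        nlinarith
      linarith
    have h3 : 10 * n * (2 * η') / θ ≤ θ / 17 := by
      have e1 : 10 * n * (2 * η') / θ = θ ^ 2 / (640 * L) * ((n * ν) * t) := by
        rw [hη']; field_simp; norm_num
      have e2 : (n * ν) * t ≤ 1 := mul_le_one₀ hn1 ht.le ht1
      have e3 : θ ^ 2 / (640 * L) * ((n * ν) * t) ≤ θ ^ 2 / (640 * L) := mul_le_of_le_one_right (by positivity) e2
      have e4 : θ ^ 2 / (640 * L) ≤ θ ^ 2 / 640 := by
        apply div_le_div_of_nonneg_left (by positivity) (by norm_num)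
        linarith
      rw [e1]
      nlinarith
    have h4 := hup (2 * η') (by positivity) (hsq _ (by positivity) h3)
    have h5 : SCP.PP (SCP.wm (Fin n) (Fin n) p) (fun A => sMin (SCP.mx A) ≤ η') ≤
        SCP.PP (SCP.wm (Fin n) (Fin n) p) (SCP.SM (2 * η')) :=
      SCP.PP_mono hw (fun A hA => SCP.SM_of_sMin hnpos hη'0 A hA)
    have h6 : 32 / θ ^ 2 * (4 * L * (50 * n ^ 2 * (2 * η') / (θ * Real.sqrt n))) ≤ t := by
      have e1 : 32 / θ ^ 2 * (4 * L * (50 * n ^ 2 * (2 * η') / (θ * Real.sqrt n))) = (n ^ 2 * ν / Real.sqrt n) * t := by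
        rw [hη']; field_simp; norm_num
      rw [e1]
      apply mul_le_of_le_one_left ht.le
      rw [div_le_one hsn]
      have : (n:ℝ) ^ 2 * ν * 1 ≤ n ^ 2 * ν * Real.sqrt n := mul_le_mul_of_nonneg_left hs1 (by positivity)
      linarith
    linarith
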